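/- arXiv:2306.10844 — 7 statements merged into one kernel-verified Lean document; each statement's English description precedes it below -/
import Mathlib

section
/- Let N ≥ 1, σ > 0, and let −1 = x_0 < x_1 < … < x_N = 1 be a partition of [−1,1]. Define the piecewise constant density ρ(x) = Σ_{k=0}^{N−1} (σ/N)/(x_{k+1} − x_k) · 1_{[x_k, x_{k+1})}(x). Then the discrete mean of the partition points equals N/(N+1) times the normalized first moment of ρ: (1/(N+1)) Σ_{k=0}^N x_k = (N/(N+1)) · (1/σ) ∫_{−1}^{1} x ρ(x) dx. -/
/-- core identity in Lemma 3.6, convergence of momenta.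
For a partition `−1 = x_0 < … < x_N = 1` of `[−1,1]` and the piecewise constant density
`ρ = Σ_{k<N} (σ/N)/(x_{k+1}−x_k) · 1_{[x_k,x_{k+1})}`, the discrete mean of the partition
points equals `N/(N+1)` times the normalized first moment of `ρ`:
`(1/(N+1)) Σ_{k=0}^N x_k = (N/(N+1)) (1/σ) ∫_{−1}^1 y ρ(y) dy`. -/
theorem stmt2
    (N : ℕ) (hN : 1 ≤ N) (σ : ℝ) (hσ : 0 < σ)
    (x : ℕ → ℝ)
    (hx0 : x 0 = -1) (hxN : x N = 1)
    (hmono : ∀ k, k < N → x k < x (k + 1))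
    (ρ : ℝ → ℝ)
    (hρ : ∀ y, ρ y = ∑ k ∈ Finset.range N,
      Set.indicator (Set.Ico (x k) (x (k + 1)))
        (fun _ => (σ / N) / (x (k + 1) - x k)) y) :
    (1 / (N + 1 : ℝ)) * ∑ k ∈ Finset.range (N + 1), x k =
      ((N : ℝ) / (N + 1 : ℝ)) * ((1 / σ) * ∫ y in Set.Icc (-1 : ℝ) 1, y * ρ y) := by
  have hle : ∀ j i, i + j ≤ N → x i ≤ x (i + j) := by
    intro j
    induction j with
    | zero => intro i _; simp
    | succ j ih =>
      intro i h
      exact (ih i (by omega)).trans (hmono (i + j) (by omega)).le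
  have hlo : ∀ k, k ≤ N → -1 ≤ x k := by
    intro k hk
    have := hle k 0 (by omega)
    rwa [hx0, zero_add] at this
  have hhi : ∀ k, k ≤ N → x k ≤ 1 := by
    intro k hk
    have := hle (N - k) k (by omega)
    rwa [Nat.add_sub_cancel' hk, hxN] at this
  have hNpos : (0 : ℝ) < N := by exact_mod_cast hN
  have hrew : ∀ y, y * ρ y = ∑ k ∈ Finset.range N,
      Set.indicator (Set.Ico (x k) (x (k + 1)))
        (fun y => y * ((σ / N) / (x (k + 1) - x k))) y := by
    intro y
    rw [hρ, Finset.mul_sum]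
    refine Finset.sum_congr rfl fun k _ => ?_
    by_cases h : y ∈ Set.Ico (x k) (x (k + 1)) <;> simp [h]
  have hint : ∫ y in Set.Icc (-1 : ℝ) 1, y * ρ y
      = ∑ k ∈ Finset.range N, (σ / N) * ((x k + x (k + 1)) / 2) := by
    simp_rw [hrew]
    rw [MeasureTheory.integral_finsetSum]
    · refine Finset.sum_congr rfl fun k hk => ?_
      have hk' := Finset.mem_range.1 hk
      have h1 := hmono k hk'
      have hsub : Set.Ico (x k) (x (k + 1)) ⊆ Set.Icc (-1 : ℝ) 1 := fun y hy =>
        ⟨(hlo k hk'.le).trans hy.1, hy.2.le.trans (hhi (k + 1) hk')⟩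
      rw [MeasureTheory.setIntegral_indicator measurableSet_Ico,
        Set.inter_eq_right.2 hsub, MeasureTheory.integral_Ico_eq_integral_Ioc,
        ← intervalIntegral.integral_of_le h1.le, intervalIntegral.integral_mul_const,
        integral_id]
      have h2 : x (k + 1) - x k ≠ 0 := (sub_pos.2 h1).ne'
      field_simp
      ring
    · intro k _
      refine MeasureTheory.Integrable.indicator ?_ measurableSet_Ico
      exact (Continuous.continuousOn (by fun_prop)).integrableOn_Icc
  have hsum : ∑ k ∈ Finset.range N, ((x k + x (k + 1)) / 2)
      = ∑ k ∈ Finset.range (N + 1), x k := by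
    rw [← Finset.sum_div, Finset.sum_add_distrib]
    have a := Finset.sum_range_succ x N
    have b := Finset.sum_range_succ' x N
    linarith
  rw [hint, ← Finset.mul_sum, hsum]
  field_simp
end

section
/- Let σ > 0, N ≥ 1, σ_N = σ/N, and let −1 = x_0 < x_1 < … < x_N = 1 be a partition of Ω = [−1,1]. Let ρ be the piecewise constant density ρ(x) = Σ_{k=0}^{N−1} ρ_k 1_{[x_k,x_{k+1})}(x) with ρ_k = σ_N/(x_{k+1} − x_k), and let ρ̃ be the empirical measure ρ̃ = σ_N Σ_{k=0}^{N} δ_{x_k}. Then the L¹([0,σ]) distance between the pseudo-inverses of ρ̃ and ρ is at most σ_N |Ω| / 2 = σ/N, i.e. ∫_0^σ |X_{ρ̃}(m) − X_{ρ}(m)| dm ≤ σ_N |Ω| / 2. -/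
open MeasureTheory

/-- Pseudo-inverse of a finite nonnegative measure on `ℝ`:
`X_μ(z) = inf {x : μ((−∞,x]) > z}`. -/
noncomputable def pseudoInvMeas (μ : Measure ℝ) (z : ℝ) : ℝ :=
  sInf {x : ℝ | z < (μ (Set.Iic x)).toReal}

/-- Pseudo-inverse of a nonnegative density `f` on `ℝ`:
`X_f(z) = inf {x : ∫_{−∞}^x f > z}`. -/
noncomputable def pseudoInvFun (f : ℝ → ℝ) (z : ℝ) : ℝ :=
  sInf {x : ℝ | z < ∫ y in Set.Iic x, f y}

lemma aux_mono (N : ℕ) (x : ℕ → ℝ) (hmono : ∀ k, k < N → x k < x (k + 1)) :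
    ∀ i j, i ≤ j → j ≤ N → x i ≤ x j := by
  intro i j hij
  induction j, hij using Nat.le_induction with
  | base => intro _; exact le_rfl
  | succ n hn ih => intro h; exact (ih (by omega)).trans (hmono n (by omega)).le

lemma aux_emp (N : ℕ) (s : ℝ) (hs : 0 < s) (x : ℕ → ℝ)
    (hm : ∀ i j, i ≤ j → j ≤ N → x i ≤ x j)
    (k : ℕ) (hk : k < N) (m : ℝ) (h1 : k * s ≤ m) (h2 : m < (k + 1) * s) :
    pseudoInvMeas (ENNReal.ofReal s • ∑ k ∈ Finset.range (N + 1), Measure.dirac (x k)) m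
      = x k := by
  have key : ∀ y, ((ENNReal.ofReal s •
      ∑ k ∈ Finset.range (N + 1), Measure.dirac (x k) : Measure ℝ) (Set.Iic y)).toReal
      = s * ∑ j ∈ Finset.range (N + 1), (if x j ≤ y then (1 : ℝ) else 0) := by
    intro y
    rw [Measure.smul_apply, Measure.finsetSum_apply, smul_eq_mul, ENNReal.toReal_mul,
      ENNReal.toReal_ofReal hs.le, ENNReal.toReal_sum]
    · congr 1
      apply Finset.sum_congr rfl
      intro j _
      rw [Measure.dirac_apply' _ measurableSet_Iic]
      by_cases h : x j ≤ y <;> simp [Set.indicator, h]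
    · intro j _
      exact measure_ne_top _ _
  have hset : {y : ℝ | m < ((ENNReal.ofReal s •
      ∑ k ∈ Finset.range (N + 1), Measure.dirac (x k) : Measure ℝ) (Set.Iic y)).toReal}
      = Set.Ici (x k) := by
    ext y
    rw [Set.mem_setOf_eq, key, Set.mem_Ici]
    constructor
    · intro h
      by_contra hy
      push Not at hy
      have : ∑ j ∈ Finset.range (N + 1), (if x j ≤ y then (1 : ℝ) else 0) ≤ k := by
        rw [← Finset.sum_subset (s₁ := Finset.range k)]
        · calc _ ≤ ∑ j ∈ Finset.range k, (1 : ℝ) := by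
                apply Finset.sum_le_sum
                intro j _
                split_ifs <;> norm_num
            _ = k := by simp
        · intro j; simp only [Finset.mem_range]; omega
        · intro j hj hjk
          simp only [Finset.mem_range] at hj hjk
          have := hm k j (by omega) (by omega)
          rw [if_neg (by linarith)]
      nlinarith
    · intro hy
      have : (k + 1 : ℝ) ≤ ∑ j ∈ Finset.range (N + 1), (if x j ≤ y then (1 : ℝ) else 0) := by
        calc (k + 1 : ℝ) = ∑ j ∈ Finset.range (k + 1), (1 : ℝ) := by simp
          _ = ∑ j ∈ Finset.range (k + 1), (if x j ≤ y then (1 : ℝ) else 0) := by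
            apply Finset.sum_congr rfl
            intro j hj
            simp only [Finset.mem_range] at hj
            rw [if_pos ((hm j k (by omega) (by omega)).trans hy)]
          _ ≤ _ := by
            apply Finset.sum_le_sum_of_subset_of_nonneg
            · intro j; simp only [Finset.mem_range]; omega
            · intro j _ _
              split_ifs <;> norm_num
      nlinarith
  rw [pseudoInvMeas, hset, csInf_Ici]

lemma aux_int (a b c y : ℝ) :
    ∫ t in Set.Iic y, Set.indicator (Set.Ico a b) (fun _ => c) t
      = c * max 0 (min y b - a) := by
  rw [setIntegral_indicator measurableSet_Ico, setIntegral_const, smul_eq_mul, mul_comm]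
  congr 1
  rw [Measure.real]
  by_cases h : y < b
  · have : Set.Iic y ∩ Set.Ico a b = Set.Icc a y := by
      ext t; simp only [Set.mem_inter_iff, Set.mem_Iic, Set.mem_Ico, Set.mem_Icc]
      constructor
      · rintro ⟨h1, h2, h3⟩; exact ⟨h2, h1⟩
      · rintro ⟨h1, h2⟩; exact ⟨h2, h1, by linarith⟩
    rw [this, Real.volume_Icc, ENNReal.toReal_ofReal', min_eq_left h.le, max_comm]
  · have : Set.Iic y ∩ Set.Ico a b = Set.Ico a b := by
      ext t; simp only [Set.mem_inter_iff, Set.mem_Iic, Set.mem_Ico]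
      constructor
      · rintro ⟨h1, h2, h3⟩; exact ⟨h2, h3⟩
      · rintro ⟨h1, h2⟩; exact ⟨by linarith, h1, by linarith⟩
    rw [this, Real.volume_Ico, ENNReal.toReal_ofReal', min_eq_right (by linarith), max_comm]

lemma aux_fun (N : ℕ) (s : ℝ) (hs : 0 < s) (x : ℕ → ℝ)
    (hmono : ∀ k, k < N → x k < x (k + 1))
    (hm : ∀ i j, i ≤ j → j ≤ N → x i ≤ x j)
    (ρ : ℝ → ℝ)
    (hρ : ∀ y, ρ y = ∑ k ∈ Finset.range N,
      Set.indicator (Set.Ico (x k) (x (k + 1))) (fun _ => s / (x (k + 1) - x k)) y)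
    (k : ℕ) (hk : k < N) (m : ℝ) (h1 : k * s ≤ m) (h2 : m < (k + 1) * s) :
    pseudoInvFun ρ m = x k + (m - k * s) * ((x (k + 1) - x k) / s) := by
  have key : ∀ y, ∫ t in Set.Iic y, ρ t = ∑ j ∈ Finset.range N,
      s / (x (j + 1) - x j) * max 0 (min y (x (j + 1)) - x j) := by
    intro y
    simp_rw [hρ]
    rw [integral_finsetSum]
    · apply Finset.sum_congr rfl
      intro j _
      exact aux_int _ _ _ _
    · intro j _
      apply Integrable.integrableOn
      rw [integrable_indicator_iff measurableSet_Ico]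
      exact integrableOn_const (by simp)
  set F : ℝ → ℝ := fun y => ∫ t in Set.Iic y, ρ t with hF
  have hFm : Monotone F := by
    intro y z hyz
    simp only [hF, key]
    apply Finset.sum_le_sum
    intro j hj
    have := hmono j (Finset.mem_range.1 hj)
    have h0 : 0 ≤ s / (x (j + 1) - x j) := div_nonneg hs.le (by linarith)
    gcongr
  have hd := hmono k hk
  have hval : ∀ y, x k ≤ y → y ≤ x (k + 1) →
      F y = k * s + s / (x (k + 1) - x k) * (y - x k) := by
    intro y hy1 hy2
    simp only [hF, key]
    rw [← Finset.sum_subset (s₁ := Finset.range (k + 1)), Finset.sum_range_succ]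
    · congr 1
      · calc _ = ∑ j ∈ Finset.range k, s := by
              apply Finset.sum_congr rfl
              intro j hj
              simp only [Finset.mem_range] at hj
              have a1 := hm (j + 1) k (by omega) (by omega)
              have a2 := hmono j (by omega)
              rw [min_eq_right (by linarith), max_eq_right (by linarith)]
              exact div_mul_cancel₀ _ (by linarith)
          _ = k * s := by simp
      · rw [min_eq_left hy2, max_eq_right (by linarith)]
    · intro j; simp only [Finset.mem_range]; omega
    · intro j hj hjk
      simp only [Finset.mem_range] at hj hjk
      have a1 := hm (k + 1) j (by omega) (by omega)
      rw [max_eq_left, mul_zero]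
      have := min_le_left y (x (j + 1))
      linarith
  have hdp : 0 < x (k + 1) - x k := by linarith
  set p := x k + (m - k * s) * ((x (k + 1) - x k) / s) with hp
  have hr : 0 < (x (k + 1) - x k) / s := div_pos hdp hs
  have hp1 : x k ≤ p := by
    have := mul_nonneg (sub_nonneg.2 h1) hr.le
    linarith
  have hp2 : p < x (k + 1) := by
    have : (m - k * s) * ((x (k + 1) - x k) / s) < s * ((x (k + 1) - x k) / s) :=
      mul_lt_mul_of_pos_right (by linarith) hr
    rw [mul_div_cancel₀ _ hs.ne'] at this
    linarith
  have hFp : F p = m := by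
    rw [hval p hp1 hp2.le, hp]
    field_simp
    ring
  have hset : {y : ℝ | m < F y} = Set.Ioi p := by
    ext y
    rw [Set.mem_setOf_eq, Set.mem_Ioi]
    constructor
    · intro h
      by_contra hy
      have := hFm (not_lt.1 hy)
      linarith
    · intro hy
      have hz : p < min y (x (k + 1)) := lt_min hy hp2
      have b1 := hFm (min_le_left y (x (k + 1)))
      have b2 := hval _ (hp1.trans hz.le) (min_le_right _ _)
      have b3 := hval p hp1 hp2.le
      have b4 : s / (x (k + 1) - x k) * (p - x k)
          < s / (x (k + 1) - x k) * (min y (x (k + 1)) - x k) :=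
        mul_lt_mul_of_pos_left (by linarith) (div_pos hs hdp)
      linarith
  rw [pseudoInvFun]
  change sInf {y : ℝ | m < F y} = p
  rw [hset, csInf_Ioi]

/-- Lemma 3.8, quantitative estimate.
For a partition `−1 = x_0 < … < x_N = 1` of `Ω = [−1,1]`, the piecewise constant density
`ρ = Σ_{k<N} ρ_k 1_{[x_k,x_{k+1})}` with `ρ_k = σ_N/(x_{k+1}−x_k)`, `σ_N = σ/N`, and the
empirical measure `ρ̃ = σ_N Σ_{k=0}^N δ_{x_k}`, the `L¹([0,σ])` distance between the
pseudo-inverses of `ρ̃` and `ρ` is at most `σ_N |Ω|/2 = σ/N`. -/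
theorem stmt3
    (N : ℕ) (hN : 1 ≤ N) (σ : ℝ) (hσ : 0 < σ)
    (x : ℕ → ℝ)
    (hx0 : x 0 = -1) (hxN : x N = 1)
    (hmono : ∀ k, k < N → x k < x (k + 1))
    (ρ : ℝ → ℝ)
    (hρ : ∀ y, ρ y = ∑ k ∈ Finset.range N,
      Set.indicator (Set.Ico (x k) (x (k + 1)))
        (fun _ => (σ / N) / (x (k + 1) - x k)) y)
    (ρemp : Measure ℝ)
    (hρemp : ρemp = ENNReal.ofReal (σ / N) •
      ∑ k ∈ Finset.range (N + 1), Measure.dirac (x k)) :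
    ∫ m in Set.Icc (0 : ℝ) σ, |pseudoInvMeas ρemp m - pseudoInvFun ρ m| ≤
      (σ / N) * 2 / 2 := by
  have hN' : (0 : ℝ) < N := by exact_mod_cast hN
  obtain ⟨s, hs⟩ : ∃ s, s = σ / N := ⟨_, rfl⟩
  have hs0 : 0 < s := hs ▸ div_pos hσ hN'
  have hσs : σ = N * s := by rw [hs]; field_simp
  rw [← hs] at hρemp ⊢
  simp only [← hs] at hρ
  have hm := aux_mono N x hmono
  subst hρemp
  set g : ℝ → ℝ := fun m => |pseudoInvMeas (ENNReal.ofReal s •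
    ∑ k ∈ Finset.range (N + 1), Measure.dirac (x k)) m - pseudoInvFun ρ m| with hg
  have hgv : ∀ k < N, ∀ m ∈ Set.Ioo ((k : ℝ) * s) (((k + 1 : ℕ) : ℝ) * s),
      g m = (m - k * s) * ((x (k + 1) - x k) / s) := by
    intro k hk m hmk
    have e2 : m < ((k : ℝ) + 1) * s := by have := hmk.2; push_cast at this; exact this
    simp only [hg]
    rw [aux_emp N s hs0 x hm k hk m hmk.1.le e2,
      aux_fun N s hs0 x hmono hm ρ hρ k hk m hmk.1.le e2]
    rw [sub_add_cancel_left, abs_neg, abs_of_nonneg]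
    exact mul_nonneg (by linarith [hmk.1]) (div_nonneg (by linarith [hmono k hk]) hs0.le)
  have hle : ∀ k : ℕ, (k : ℝ) * s ≤ ((k + 1 : ℕ) : ℝ) * s := by
    intro k; push_cast; nlinarith
  have hint : ∀ k < N, IntervalIntegrable g volume ((k : ℝ) * s) (((k + 1 : ℕ) : ℝ) * s) := by
    intro k hk
    have hc : IntervalIntegrable (fun m : ℝ => (m - k * s) * ((x (k + 1) - x k) / s)) volume
        ((k : ℝ) * s) (((k + 1 : ℕ) : ℝ) * s) :=
      Continuous.intervalIntegrable (by fun_prop) _ _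
    rw [intervalIntegrable_iff_integrableOn_Ioo_of_le (hle k)] at hc ⊢
    exact hc.congr_fun (fun m hmk => (hgv k hk m hmk).symm) measurableSet_Ioo
  have hval : ∀ k < N, ∫ m in ((k : ℝ) * s)..(((k + 1 : ℕ) : ℝ) * s), g m
      = (x (k + 1) - x k) * (s / 2) := by
    intro k hk
    have : ∫ m in ((k : ℝ) * s)..(((k + 1 : ℕ) : ℝ) * s), g m
        = ∫ m in ((k : ℝ) * s)..(((k + 1 : ℕ) : ℝ) * s),
          (m - k * s) * ((x (k + 1) - x k) / s) := by
      rw [intervalIntegral.integral_of_le (hle k), intervalIntegral.integral_of_le (hle k),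
        integral_Ioc_eq_integral_Ioo, integral_Ioc_eq_integral_Ioo]
      exact setIntegral_congr_fun measurableSet_Ioo (hgv k hk)
    rw [this, intervalIntegral.integral_mul_const,
      intervalIntegral.integral_comp_sub_right (fun m => m), integral_id]
    push_cast
    field_simp
    ring
  have hsum := intervalIntegral.sum_integral_adjacent_intervals
    (a := fun k : ℕ => (k : ℝ) * s) (n := N) (f := g) (μ := volume) hint
  rw [integral_Icc_eq_integral_Ioc, ← intervalIntegral.integral_of_le hσ.le]
  simp only [Nat.cast_zero, zero_mul] at hsum
  rw [hσs, ← hsum, Finset.sum_congr rfl (fun k hk => hval k (Finset.mem_range.1 hk)),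
    ← Finset.sum_mul, Finset.sum_range_sub, hx0, hxN]
  linarith
end

section
/- For each N ≥ 2 let (x_k^{i,N}, a_N^i) be a C¹ solution of the DPA system on [0,T] with ordered particles, and let ρ^{i,N} be the associated piecewise constant densities. Fix t ∈ [0,T] and suppose ρ^{i,N}(t,·) → ρ^i(t,·) in L¹(Ω) as N → ∞ for some ρ^i(t,·) ∈ L¹(Ω) with mass σ^i. Then the discrete mean opinion converges to the mean opinion of the limit density: μ_x^{i,N}(t) = (1/(N+1)) Σ_{k=0}^N x_k^{i,N}(t) → μ_{ρ^i}(t) = (1/σ^i) ∫_Ω y ρ^i(t,y) dy as N → ∞. -/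
open MeasureTheory Filter

/-- Piecewise constant density reconstructed from particles `x_0 < … < x_N`, with mass
`σ/N` on each interval `[x_k, x_{k+1})`. -/
noncomputable def pcDensity (N : ℕ) (σi : ℝ) (xi : ℕ → ℝ) (y : ℝ) : ℝ :=
  ∑ k ∈ Finset.range N,
    Set.indicator (Set.Ico (xi k) (xi (k+1))) (fun _ => (σi / N) / (xi (k+1) - xi k)) y

lemma aux_le (N : ℕ) (xi : ℕ → ℝ) (h : ∀ k < N, xi k < xi (k+1)) :
    ∀ m, ∀ k, k + m ≤ N → xi k ≤ xi (k+m) := by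
  intro m
  induction m with
  | zero => intro k _; exact le_rfl
  | succ m ih =>
    intro k hk
    exact (ih k (by omega)).trans (h (k+m) (by omega)).le

lemma aux_integrable (N : ℕ) (s : ℝ) (xi : ℕ → ℝ) : Integrable (pcDensity N s xi) := by
  unfold pcDensity
  refine integrable_finset_sum _ (fun k _ => ?_)
  rw [integrable_indicator_iff measurableSet_Ico]
  exact integrableOn_const (by simp)

lemma aux_mul_integrable (f : ℝ → ℝ) (hf : IntegrableOn f (Set.Icc (-1:ℝ) 1)) :
    IntegrableOn (fun y => y * f y) (Set.Icc (-1:ℝ) 1) :=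
  hf.continuousOn_mul continuousOn_id isCompact_Icc

lemma aux_moment (N : ℕ) (s : ℝ) (xi : ℕ → ℝ) (h : ∀ k < N, xi k < xi (k+1))
    (h0 : xi 0 = -1) (hN : xi N = 1) :
    ∫ y in Set.Icc (-1:ℝ) 1, y * pcDensity N s xi y
      = (s / N) * ∑ k ∈ Finset.range (N+1), xi k := by
  have hsum : ∑ k ∈ Finset.range (N+1), xi k
      = ∑ k ∈ Finset.range N, (xi k + xi (k+1)) / 2 := by
    have e1 := Finset.sum_range_succ xi N
    have e2 := Finset.sum_range_succ' xi N
    rw [← Finset.sum_div, Finset.sum_add_distrib]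
    linarith
  have hle := aux_le N xi h
  rw [hsum, Finset.mul_sum]
  unfold pcDensity
  simp_rw [Finset.mul_sum]
  rw [integral_finset_sum]
  · refine Finset.sum_congr rfl (fun k hk => ?_)
    have hk' : k < N := Finset.mem_range.mp hk
    have hlt := h k hk'
    have ha : -1 ≤ xi k := by
      have := hle k 0 (by omega)
      rwa [h0, Nat.zero_add] at this
    have hb : xi (k+1) ≤ 1 := by
      have := hle (N-(k+1)) (k+1) (by omega)
      rwa [show k+1+(N-(k+1)) = N by omega, hN] at this
    have hsub : Set.Ico (xi k) (xi (k+1)) ⊆ Set.Icc (-1:ℝ) 1 :=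
      fun y hy => ⟨ha.trans hy.1, hy.2.le.trans hb⟩
    have e : ∀ y : ℝ, y * Set.indicator (Set.Ico (xi k) (xi (k+1)))
        (fun _ => (s / N) / (xi (k+1) - xi k)) y
        = Set.indicator (Set.Ico (xi k) (xi (k+1)))
          (fun y => y * ((s / N) / (xi (k+1) - xi k))) y := by
      intro y
      by_cases hy : y ∈ Set.Ico (xi k) (xi (k+1)) <;> simp [hy]
    simp_rw [e]
    rw [setIntegral_indicator measurableSet_Ico, Set.inter_eq_right.mpr hsub,
      integral_Ico_eq_integral_Ioc, ← intervalIntegral.integral_of_le hlt.le,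
      intervalIntegral.integral_mul_const, integral_id]
    have : xi (k+1) - xi k ≠ 0 := by linarith
    generalize s / (N:ℝ) = c
    field_simp
    ring
  · intro k _
    refine aux_mul_integrable _ (Integrable.integrableOn ?_)
    rw [integrable_indicator_iff measurableSet_Ico]
    exact integrableOn_const (by simp)

/-- Lemma 3.6, convergence of momenta.
For C¹ solutions of the DPA system (one for each `N = n+2`) with ordered particles, if at a
fixed time `t ∈ [0,T]` the piecewise constant densities converge in `L¹(Ω)` to a density
`ρ^i(t,·)` of mass `σ^i`, then the discrete mean opinions
`μ_x^{i,N}(t) = (1/(N+1)) Σ_k x_k^{i,N}(t)` converge to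
`μ_{ρ^i}(t) = (1/σ^i) ∫_Ω y ρ^i(t,y) dy`. -/
theorem stmt11
    (M d : ℕ) (hM : 1 ≤ M) (T : ℝ) (hT : 0 < T)
    (σ : Fin M → ℝ) (hσ : ∀ i, 0 < σ i)
    (A K A₁ : Fin M → Fin M → ℝ → ℝ → ℝ → ℝ)
    (cA c1A cK CK : ℝ) (hcK : 0 < cK)
    (hA_nonneg : ∀ i j x y c, 0 ≤ A i j x y c)
    (hA_deriv : ∀ i j y c x₀, HasDerivAt (fun s => A i j s y c) (A₁ i j x₀ y c) x₀)
    (hA_lip : ∀ i j x x' y y' c, |A i j x' y' c - A i j x y c| ≤ cA * (|x' - x| + |y' - y|))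
    (hA1_lip : ∀ i j x y y' c, |A₁ i j x y' c - A₁ i j x y c| ≤ c1A * |y' - y|)
    (hK_bdd : ∀ i j x y c, |K i j x y c| ≤ CK)
    (hK_cont : ∀ i j, Continuous (fun p : ℝ × ℝ × ℝ => K i j p.1 p.2.1 p.2.2))
    (hK_lip : ∀ i j x x' y y' c, |K i j x' y' c - K i j x y c| ≤ cK * (|x' - x| + |y' - y|))
    (hK_diag : ∀ i x c, K i i x x c = 0)
    (Φ : Fin M → ℝ → ℝ)
    (hΦ_mono : ∀ i, MonotoneOn (Φ i) (Set.Ici 0))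
    (hΦ_lip : ∀ i, ∃ L : NNReal, LipschitzOnWith L (Φ i) (Set.Ici 0))
    (hΦ0 : ∀ i, Φ i 0 = 0)
    (V : ℝ → ℝ → ℝ → EuclideanSpace ℝ (Fin d))
    (hV_C1 : ContDiff ℝ 1 (fun p : ℝ × ℝ × ℝ => V p.1 p.2.1 p.2.2))
    (hV_bdd : ∃ CV, ∀ p q r, ‖V p q r‖ ≤ CV)
    -- for each n, a DPA solution with N = n + 2
    (x : ℕ → Fin M → ℕ → ℝ → ℝ) (a : ℕ → Fin M → ℝ → EuclideanSpace ℝ (Fin d))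
    (hx0 : ∀ n i t, x n i 0 t = -1) (hxN : ∀ n i t, x n i (n+2) t = 1)
    (hx_order : ∀ n i k t, k < n+2 → t ∈ Set.Icc (0:ℝ) T → x n i k t < x n i (k+1) t)
    (hx_ode : ∀ n i k, 0 < k → k < n+2 → ∀ t ∈ Set.Icc (0:ℝ) T,
      HasDerivAt (x n i k)
        (((∑ j, ∑ l ∈ Finset.range (n+3),
              (σ j / (n+2)) * A i j (x n i k t) (x n j l t) (dist (a n i t) (a n j t)))
            / (σ i / (n+2))) *
            (Φ i ((σ i / (n+2)) / (x n i k t - x n i (k-1) t)) -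
             Φ i ((σ i / (n+2)) / (x n i (k+1) t - x n i k t)))
          + ∑ j, ∑ l ∈ Finset.range (n+3),
              (σ j / (n+2)) * K i j (x n i k t) (x n j l t) (dist (a n i t) (a n j t))) t)
    (ha_ode : ∀ n i, ∀ t ∈ Set.Icc (0:ℝ) T,
      HasDerivAt (a n i)
        (∑ j, V (((n:ℝ)+3)⁻¹ * ∑ k ∈ Finset.range (n+3), x n i k t)
                (((n:ℝ)+3)⁻¹ * ∑ k ∈ Finset.range (n+3), x n j k t)
                (dist (a n i t) (a n j t))) t)
    -- fixed time and L¹(Ω) convergence to a limit density of mass σ^i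
    (i : Fin M) (t : ℝ) (ht : t ∈ Set.Icc (0:ℝ) T)
    (ρlim : ℝ → ℝ)
    (hρlim_int : IntegrableOn ρlim (Set.Icc (-1:ℝ) 1))
    (hρlim_mass : ∫ y in Set.Icc (-1:ℝ) 1, ρlim y = σ i)
    (hconv : Tendsto (fun n : ℕ => ∫ y in Set.Icc (-1:ℝ) 1,
        |pcDensity (n+2) (σ i) (fun k => x n i k t) y - ρlim y|) atTop (nhds 0)) :
    Tendsto (fun n : ℕ => ((n:ℝ)+3)⁻¹ * ∑ k ∈ Finset.range (n+3), x n i k t)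
      atTop (nhds ((σ i)⁻¹ * ∫ y in Set.Icc (-1:ℝ) 1, y * ρlim y)) := by
  have hs := hσ i
  have hlim : Tendsto (fun n : ℕ => ∫ y in Set.Icc (-1:ℝ) 1,
      y * pcDensity (n+2) (σ i) (fun k => x n i k t) y) atTop
      (nhds (∫ y in Set.Icc (-1:ℝ) 1, y * ρlim y)) := by
    rw [tendsto_iff_norm_sub_tendsto_zero]
    refine squeeze_zero (fun _ => norm_nonneg _) (fun n => ?_) hconv
    have hp : IntegrableOn (pcDensity (n+2) (σ i) (fun k => x n i k t)) (Set.Icc (-1:ℝ) 1) :=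
      (aux_integrable _ _ _).integrableOn
    rw [← integral_sub (aux_mul_integrable _ hp) (aux_mul_integrable _ hρlim_int)]
    refine norm_integral_le_of_norm_le (hp.sub hρlim_int).abs ?_
    refine (ae_restrict_iff' measurableSet_Icc).mpr (Eventually.of_forall fun y hy => ?_)
    rw [← mul_sub, Real.norm_eq_abs, abs_mul]
    exact mul_le_of_le_one_left (abs_nonneg _) (abs_le.mpr hy)
  have hr : Tendsto (fun n : ℕ => ((n:ℝ)+2) / ((n:ℝ)+3)) atTop (nhds 1) := by
    have h1 : Tendsto (fun n : ℕ => 1 - 1 / (((n+2 : ℕ):ℝ) + 1)) atTop (nhds (1 - 0)) :=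
      tendsto_const_nhds.sub
        ((tendsto_add_atTop_iff_nat (f := fun n : ℕ => 1 / ((n:ℝ) + 1)) 2).mpr
          tendsto_one_div_add_atTop_nhds_zero_nat)
    rw [sub_zero] at h1
    refine h1.congr (fun n => ?_)
    have : (n:ℝ) + 3 ≠ 0 := by positivity
    push_cast
    rw [show (n:ℝ) + 2 + 1 = n + 3 by ring]
    field_simp
    ring
  have := hr.mul (hlim.const_mul (σ i)⁻¹)
  rw [one_mul] at this
  refine this.congr (fun n => ?_)
  rw [aux_moment (n+2) (σ i) (fun k => x n i k t) (fun k hk => hx_order n i k t hk ht)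
    (hx0 n i t) (hxN n i t)]
  have h2 : (n:ℝ) + 2 ≠ 0 := by positivity
  have h3 : (n:ℝ) + 3 ≠ 0 := by positivity
  push_cast
  field_simp
end

section
/- For each N ≥ 2 let (x_k^{i,N}, a_N^i) be a C¹ solution of the DPA system on [0,T] with ordered particles, all with the same initial nodes ā^i ∈ ℝ^d, and suppose that for each i the piecewise constant densities ρ^{i,N} converge in L¹(Ω_T) to ρ^i ∈ L¹ ∩ L^∞(Ω_T) (along the full sequence). Then for each i ∈ {1,…,M} there exists a continuous curve a^i : [0,T] → ℝ^d such that a_N^i → a^i uniformly on [0,T] as N → ∞, and the limits satisfy the integral equation a^i(t) = ā^i + Σ_{j=1}^M ∫_0^t V(μ_{ρ^i}(τ), μ_{ρ^j}(τ), a^{ij}(τ)) dτ for all t ∈ [0,T], where a^{ij}(τ) = |a^i(τ) − a^j(τ)| is the Euclidean distance and μ_{ρ^i}(τ) = (1/σ^i) ∫_Ω y ρ^i(τ,y) dy. -/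
open MeasureTheory Filter

theorem aux_gron (u : ℝ → ℝ) (hu : Continuous u) (hu0 : ∀ t, 0 ≤ u t) (T K δ : ℝ)
    (hK : 0 ≤ K) (hδ : 0 ≤ δ)
    (h : ∀ t ∈ Set.Icc (0:ℝ) T, u t ≤ δ + K * ∫ s in (0:ℝ)..t, u s) :
    ∀ t ∈ Set.Icc (0:ℝ) T, u t ≤ δ * Real.exp (K * T) := by
  intro t ht
  have hw : ∀ t, HasDerivAt (fun t => δ + K * ∫ s in (0:ℝ)..t, u s) (K * u t) t := fun t =>
    ((hu.integral_hasStrictDerivAt 0 t).hasDerivAt.const_mul K).const_add δ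
  have key := norm_le_gronwallBound_of_norm_deriv_right_le (a := 0) (b := T) (δ := δ) (K := K)
    (ε := 0) (f := fun t => δ + K * ∫ s in (0:ℝ)..t, u s) (f' := fun t => K * u t)
    (fun t _ => (hw t).continuousAt.continuousWithinAt)
    (fun t _ => (hw t).hasDerivWithinAt)
    (by simp [abs_of_nonneg hδ])
    (by
      intro x hx
      rw [Real.norm_of_nonneg (mul_nonneg hK (hu0 x)), add_zero]
      exact mul_le_mul_of_nonneg_left ((h x ⟨hx.1, hx.2.le⟩).trans (le_abs_self _)) hK) t ht
  rw [gronwallBound_ε0, sub_zero] at key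
  refine (h t ht).trans (((le_abs_self _).trans key).trans ?_)
  gcongr
  exact ht.2

theorem aux_limit {B F : Type*} [NormedAddCommGroup B] [NormedSpace ℝ B]
    [NormedAddCommGroup F] [NormedSpace ℝ F] [CompleteSpace F]
    (T : ℝ) (hT : 0 < T) (G : B → F → F) (K C : ℝ) (hK : 0 ≤ K)
    (hG : ∀ b b' a a', ‖G b a - G b' a'‖ ≤ K * (‖b - b'‖ + ‖a - a'‖))
    (hGc : Continuous (Function.uncurry G))
    (hGb : ∀ b a, ‖G b a‖ ≤ C)
    (a : ℕ → ℝ → F) (b : ℕ → ℝ → B) (β : ℝ → B) (a0 : F)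
    (ha : ∀ n, Continuous (a n)) (hb : ∀ n, Continuous (b n))
    (hβ : IntegrableOn β (Set.Icc 0 T))
    (hab : ∀ n, ∀ t ∈ Set.Icc (0:ℝ) T, a n t = a0 + ∫ τ in (0:ℝ)..t, G (b n τ) (a n τ))
    (hlim : Tendsto (fun n => ∫ t in (0:ℝ)..T, ‖b n t - β t‖) atTop (nhds 0)) :
    ∃ aL : ℝ → F, ContinuousOn aL (Set.Icc 0 T) ∧
      TendstoUniformlyOn a aL atTop (Set.Icc 0 T) ∧
      IntegrableOn (fun τ => G (β τ) (aL τ)) (Set.Icc 0 T) ∧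
      ∀ t ∈ Set.Icc (0:ℝ) T, aL t = a0 + ∫ τ in (0:ℝ)..t, G (β τ) (aL τ) := by
  have hcont : ∀ n, Continuous fun τ => G (b n τ) (a n τ) := fun n =>
    hGc.comp ((hb n).prodMk (ha n))
  have hβi : ∀ t ∈ Set.Icc (0:ℝ) T, IntervalIntegrable β volume 0 t := fun t ht =>
    (intervalIntegrable_iff_integrableOn_Icc_of_le ht.1).2
      (hβ.mono_set (Set.Icc_subset_Icc_right ht.2))
  have hTT : T ∈ Set.Icc (0:ℝ) T := ⟨hT.le, le_rfl⟩
  set e : ℕ → ℝ := fun n => ∫ t in (0:ℝ)..T, ‖b n t - β t‖ with he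
  have he0 : ∀ n, 0 ≤ e n := fun n =>
    intervalIntegral.integral_nonneg hT.le fun _ _ => norm_nonneg _
  have hdiffi : ∀ n, ∀ t ∈ Set.Icc (0:ℝ) T,
      IntervalIntegrable (fun s => ‖b n s - β s‖) volume 0 t := fun n t ht =>
    (((hb n).intervalIntegrable 0 t).sub (hβi t ht)).norm
  have hmono : ∀ f : ℝ → ℝ, (∀ s, 0 ≤ f s) → IntervalIntegrable f volume 0 T →
      ∀ t ∈ Set.Icc (0:ℝ) T, ∫ s in (0:ℝ)..t, f s ≤ ∫ s in (0:ℝ)..T, f s := by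
    intro f hf hfi t ht
    exact intervalIntegral.integral_mono_interval le_rfl ht.1 ht.2
      (Eventually.of_forall hf) hfi
  -- Cauchy estimate
  have hC : ∀ n m, ∀ t ∈ Set.Icc (0:ℝ) T,
      ‖a n t - a m t‖ ≤ K * (e n + e m) * Real.exp (K * T) := by
    intro n m
    apply aux_gron (fun t => ‖a n t - a m t‖) ((ha n).sub (ha m)).norm (fun _ => norm_nonneg _)
      T K _ hK (mul_nonneg hK (add_nonneg (he0 n) (he0 m)))
    intro t ht
    have hbb : ∫ s in (0:ℝ)..t, ‖b n s - b m s‖ ≤ e n + e m := by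
      refine (hmono _ (fun s => norm_nonneg _)
        (((hb n).sub (hb m)).norm.intervalIntegrable 0 T) t ht).trans ?_
      rw [he]
      simp only
      rw [← intervalIntegral.integral_add (hdiffi n T hTT) (hdiffi m T hTT)]
      refine intervalIntegral.integral_mono_on hT.le
        (((hb n).sub (hb m)).norm.intervalIntegrable 0 T)
        ((hdiffi n T hTT).add (hdiffi m T hTT)) ?_
      intro s _
      have := norm_sub_le_norm_sub_add_norm_sub (b n s) (β s) (b m s)
      rwa [norm_sub_rev (β s)] at this
    calc ‖a n t - a m t‖ = ‖∫ s in (0:ℝ)..t, (G (b n s) (a n s) - G (b m s) (a m s))‖ := by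
          rw [intervalIntegral.integral_sub ((hcont n).intervalIntegrable 0 t)
            ((hcont m).intervalIntegrable 0 t), hab n t ht, hab m t ht]
          simp
      _ ≤ ∫ s in (0:ℝ)..t, (K * ‖b n s - b m s‖ + K * ‖a n s - a m s‖) := by
          refine intervalIntegral.norm_integral_le_of_norm_le ht.1
            (Eventually.of_forall fun s _ => ?_) ?_
          · rw [← mul_add]; exact hG _ _ _ _
          · exact Continuous.intervalIntegrable (by fun_prop) _ _
      _ = K * (∫ s in (0:ℝ)..t, ‖b n s - b m s‖) + K * ∫ s in (0:ℝ)..t, ‖a n s - a m s‖ := by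
          rw [intervalIntegral.integral_add, intervalIntegral.integral_const_mul,
            intervalIntegral.integral_const_mul]
          · exact Continuous.intervalIntegrable (by fun_prop) _ _
          · exact Continuous.intervalIntegrable (by fun_prop) _ _
      _ ≤ _ := by gcongr
  have hCau : UniformCauchySeqOn a atTop (Set.Icc 0 T) := by
    rw [Metric.uniformCauchySeqOn_iff]
    intro ε hε
    have h1 : Tendsto (fun n => K * (e n + e n) * Real.exp (K * T)) atTop (nhds 0) := by
      simpa using ((hlim.add hlim).const_mul K).mul_const (Real.exp (K * T))
    obtain ⟨N, hN⟩ := eventually_atTop.1 (h1.eventually (gt_mem_nhds hε))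
    refine ⟨N, fun m hm n hn t ht => ?_⟩
    rw [dist_eq_norm]
    refine (hC m n t ht).trans_lt ?_
    have a1 := hN m hm
    have a2 := hN n hn
    nlinarith
  have hex : ∀ t ∈ Set.Icc (0:ℝ) T, ∃ l, Tendsto (fun n => a n t) atTop (nhds l) := fun t ht =>
    cauchySeq_tendsto_of_complete (hCau.cauchySeq ht)
  choose! aL haL using hex
  have hunif := hCau.tendstoUniformlyOn_of_tendsto haL
  have hcL : ContinuousOn aL (Set.Icc 0 T) :=
    hunif.continuousOn (Frequently.of_forall fun n => (ha n).continuousOn)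
  have hI : IntegrableOn (fun τ => G (β τ) (aL τ)) (Set.Icc 0 T) := by
    refine Integrable.of_bound (C := C) ?_ (Eventually.of_forall fun _ => hGb _ _)
    exact hGc.comp_aestronglyMeasurable
      (hβ.aestronglyMeasurable.prodMk (hcL.aestronglyMeasurable measurableSet_Icc))
  refine ⟨aL, hcL, hunif, hI, fun t ht => ?_⟩
  have hIt : IntervalIntegrable (fun τ => G (β τ) (aL τ)) volume 0 t :=
    (intervalIntegrable_iff_integrableOn_Icc_of_le ht.1).2
      (hI.mono_set (Set.Icc_subset_Icc_right ht.2))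
  have haLi : IntervalIntegrable aL volume 0 t :=
    ContinuousOn.intervalIntegrable_of_Icc ht.1 (hcL.mono (Set.Icc_subset_Icc_right ht.2))
  have hCL : ∀ n, ∀ t ∈ Set.Icc (0:ℝ) T,
      ‖a n t - aL t‖ ≤ K * (e n + 0) * Real.exp (K * T) := by
    intro n t ht
    refine le_of_tendsto_of_tendsto (tendsto_const_nhds.sub (haL t ht)).norm
      (((hlim.const_add (e n)).const_mul K).mul_const (Real.exp (K * T))) 
      (Eventually.of_forall fun m => hC n m t ht)
  have hest : ∀ n, ‖(∫ τ in (0:ℝ)..t, G (b n τ) (a n τ)) - ∫ τ in (0:ℝ)..t, G (β τ) (aL τ)‖ ≤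
      K * e n + K * (T * (K * (e n + 0) * Real.exp (K * T))) := by
    intro n
    rw [← intervalIntegral.integral_sub ((hcont n).intervalIntegrable 0 t) hIt]
    calc _ ≤ ∫ s in (0:ℝ)..t, (K * ‖b n s - β s‖ + K * (K * (e n + 0) * Real.exp (K * T))) := by
          refine intervalIntegral.norm_integral_le_of_norm_le ht.1
            (Eventually.of_forall fun s hs => ?_) ?_
          · rw [← mul_add]
            refine (hG _ _ _ _).trans ?_
            gcongr
            exact hCL n s ⟨hs.1.le, hs.2.trans ht.2⟩
          · exact ((hdiffi n t ht).const_mul K).add (by simp)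
      _ = K * (∫ s in (0:ℝ)..t, ‖b n s - β s‖) + K * (t * (K * (e n + 0) * Real.exp (K * T))) := by
          rw [intervalIntegral.integral_add ((hdiffi n t ht).const_mul K) (by simp),
            intervalIntegral.integral_const_mul, intervalIntegral.integral_const, smul_eq_mul,
            sub_zero]
          ring
      _ ≤ _ := by
          have := he0 n
          gcongr
          · exact hmono _ (fun s => norm_nonneg _) (hdiffi n T hTT) t ht
          · exact ht.2
  have hz : Tendsto (fun n => K * e n + K * (T * (K * (e n + 0) * Real.exp (K * T)))) atTop
      (nhds 0) := by
    have := (hlim.const_mul K).add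
      ((((hlim.add_const 0).const_mul K).mul_const (Real.exp (K * T))).const_mul T |>.const_mul K)
    simpa using this
  have hlimI := tendsto_iff_norm_sub_tendsto_zero.2
    (squeeze_zero (fun n => norm_nonneg _) hest hz)
  refine tendsto_nhds_unique (haL t ht) ?_
  refine (hlimI.const_add a0).congr fun n => (hab n t ht).symm

theorem aux_bounds (N : ℕ) (xi : ℕ → ℝ) (h0 : xi 0 = -1) (hN : xi N = 1)
    (ho : ∀ k, k < N → xi k < xi (k+1)) : ∀ k, k ≤ N → -1 ≤ xi k ∧ xi k ≤ 1 := by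
  have hm : ∀ a c, a + c ≤ N → xi a ≤ xi (a + c) := by
    intro a c
    induction c with
    | zero => intro _; simp
    | succ c ih =>
      intro h
      exact (ih (by omega)).trans (ho (a + c) (by omega)).le
  intro k hk
  constructor
  · have := hm 0 k (by omega)
    rw [zero_add, h0] at this
    exact this
  · have := hm k (N - k) (by omega)
    rw [Nat.add_sub_cancel' hk, hN] at this
    exact this

theorem aux_pc_nonneg (N : ℕ) (σi : ℝ) (hσ : 0 < σi) (xi : ℕ → ℝ)
    (ho : ∀ k, k < N → xi k < xi (k+1)) (y : ℝ) : 0 ≤ pcDensity N σi xi y := by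
  unfold pcDensity
  refine Finset.sum_nonneg fun k hk => Set.indicator_nonneg (fun _ _ => ?_) _
  have := ho k (Finset.mem_range.1 hk)
  have : 0 < xi (k+1) - xi k := by linarith
  positivity

theorem aux_term (u v c : ℝ) (huv : u < v) (hu : -1 ≤ u) (hv : v ≤ 1) (g : ℝ → ℝ) :
    ∫ y in Set.Icc (-1:ℝ) 1, g y * Set.indicator (Set.Ico u v) (fun _ => c) y
      = (∫ y in u..v, g y) * c := by
  have : (fun y => g y * Set.indicator (Set.Ico u v) (fun _ => c) y)
      = Set.indicator (Set.Ico u v) (fun y => g y * c) := by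
    ext y
    by_cases hy : y ∈ Set.Ico u v <;> simp [hy]
  rw [this, setIntegral_indicator measurableSet_Ico,
    Set.inter_eq_right.2 (Set.Ico_subset_Icc_self.trans (Set.Icc_subset_Icc hu hv)),
    integral_Ico_eq_integral_Ioo, ← integral_Ioc_eq_integral_Ioo,
    ← intervalIntegral.integral_of_le huv.le, intervalIntegral.integral_mul_const]

theorem aux_term_int (u v c : ℝ) (g : ℝ → ℝ) (hg : Continuous g) :
    IntegrableOn (fun y => g y * Set.indicator (Set.Ico u v) (fun _ => c) y)
      (Set.Icc (-1:ℝ) 1) := by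
  have : (fun y => g y * Set.indicator (Set.Ico u v) (fun _ => c) y)
      = Set.indicator (Set.Ico u v) (fun y => g y * c) := by
    ext y
    by_cases hy : y ∈ Set.Ico u v <;> simp [hy]
  rw [this]
  refine IntegrableOn.indicator ?_ measurableSet_Ico
  exact (hg.mul continuous_const).continuousOn.integrableOn_Icc

theorem aux_pc_int (N : ℕ) (σi : ℝ) (xi : ℕ → ℝ) (g : ℝ → ℝ) (hg : Continuous g) :
    IntegrableOn (fun y => g y * pcDensity N σi xi y) (Set.Icc (-1:ℝ) 1) := by
  unfold pcDensity
  simp only [Finset.mul_sum]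
  exact integrable_finsetSum _ fun k _ => aux_term_int _ _ _ g hg

theorem aux_pc_eq (N : ℕ) (σi : ℝ) (xi : ℕ → ℝ) (g : ℝ → ℝ) (hg : Continuous g)
    (h0 : xi 0 = -1) (hN : xi N = 1) (ho : ∀ k, k < N → xi k < xi (k+1)) :
    ∫ y in Set.Icc (-1:ℝ) 1, g y * pcDensity N σi xi y
      = ∑ k ∈ Finset.range N, (∫ y in (xi k)..(xi (k+1)), g y) *
          ((σi / N) / (xi (k+1) - xi k)) := by
  unfold pcDensity
  simp only [Finset.mul_sum]
  rw [integral_finsetSum _ fun k _ => aux_term_int _ _ _ g hg]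
  refine Finset.sum_congr rfl fun k hk => ?_
  have hk := Finset.mem_range.1 hk
  exact aux_term _ _ _ (ho k hk) (aux_bounds N xi h0 hN ho k hk.le).1
    (aux_bounds N xi h0 hN ho (k+1) hk).2 g

theorem aux_pc_mass (N : ℕ) (hN0 : 0 < N) (σi : ℝ) (xi : ℕ → ℝ)
    (h0 : xi 0 = -1) (hN : xi N = 1) (ho : ∀ k, k < N → xi k < xi (k+1)) :
    ∫ y in Set.Icc (-1:ℝ) 1, pcDensity N σi xi y = σi := by
  have h := aux_pc_eq N σi xi (fun _ => 1) continuous_const h0 hN ho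
  simp only [one_mul] at h
  rw [h]
  have : ∀ k ∈ Finset.range N, (∫ y in (xi k)..(xi (k+1)), (1:ℝ)) *
          ((σi / N) / (xi (k+1) - xi k)) = σi / N := by
    intro k hk
    have := ho k (Finset.mem_range.1 hk)
    have : xi (k+1) - xi k ≠ 0 := by linarith
    simp
    field_simp
  rw [Finset.sum_congr rfl this]
  simp
  field_simp

theorem aux_pc_mean (N : ℕ) (σi : ℝ) (xi : ℕ → ℝ)
    (h0 : xi 0 = -1) (hN : xi N = 1) (ho : ∀ k, k < N → xi k < xi (k+1)) :
    ∫ y in Set.Icc (-1:ℝ) 1, y * pcDensity N σi xi y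
      = σi / N * ∑ k ∈ Finset.range (N+1), xi k := by
  rw [aux_pc_eq N σi xi (fun y => y) continuous_id h0 hN ho]
  have : ∀ k ∈ Finset.range N, (∫ y in (xi k)..(xi (k+1)), y) *
          ((σi / N) / (xi (k+1) - xi k)) = σi / N * ((xi k + xi (k+1)) / 2) := by
    intro k hk
    have := ho k (Finset.mem_range.1 hk)
    have : xi (k+1) - xi k ≠ 0 := by linarith
    rw [integral_id]
    field_simp
    ring
  rw [Finset.sum_congr rfl this, ← Finset.mul_sum, ← Finset.sum_div, Finset.sum_add_distrib]
  have e1 := Finset.sum_range_succ xi N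
  have e2 := Finset.sum_range_succ' xi N
  congr 1
  linarith

theorem aux_mean_est (n : ℕ) (σi : ℝ) (hσ : 0 < σi) (xi : ℕ → ℝ)
    (h0 : xi 0 = -1) (hN : xi (n+2) = 1) (ho : ∀ k, k < n+2 → xi k < xi (k+1))
    (r : ℝ → ℝ) (hr : IntegrableOn r (Set.Icc (-1:ℝ) 1)) :
    |((n:ℝ)+3)⁻¹ * ∑ k ∈ Finset.range (n+3), xi k
        - σi⁻¹ * ∫ y in Set.Icc (-1:ℝ) 1, y * r y| ≤
      ((n:ℝ)+2)⁻¹ + σi⁻¹ * ∫ y in Set.Icc (-1:ℝ) 1, |pcDensity (n+2) σi xi y - r y| := by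
  set S := ∑ k ∈ Finset.range (n+3), xi k with hS
  have hSb : |S| ≤ n + 3 := by
    calc |S| ≤ ∑ k ∈ Finset.range (n+3), |xi k| := Finset.abs_sum_le_sum_abs _ _
      _ ≤ ∑ k ∈ Finset.range (n+3), (1:ℝ) := by
        refine Finset.sum_le_sum fun k hk => abs_le.2 ?_
        exact aux_bounds (n+2) xi h0 hN ho k (by have := Finset.mem_range.1 hk; omega)
      _ = n + 3 := by simp
  have hm := aux_pc_mean (n+2) σi xi h0 hN ho
  push_cast at hm
  rw [show n + 2 + 1 = n + 3 from rfl, ← hS] at hm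
  have hpi := aux_pc_int (n+2) σi xi (fun y => y) continuous_id
  have hpi1 := aux_pc_int (n+2) σi xi (fun y => 1) continuous_const
  simp only [one_mul] at hpi1
  have hri : IntegrableOn (fun y => y * r y) (Set.Icc (-1:ℝ) 1) :=
    hr.continuousOn_mul continuous_id.continuousOn isCompact_Icc
  have hd : |(∫ y in Set.Icc (-1:ℝ) 1, y * pcDensity (n+2) σi xi y)
      - ∫ y in Set.Icc (-1:ℝ) 1, y * r y| ≤
      ∫ y in Set.Icc (-1:ℝ) 1, |pcDensity (n+2) σi xi y - r y| := by
    rw [← integral_sub hpi hri]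
    rw [← Real.norm_eq_abs]
    refine (norm_integral_le_integral_norm _).trans ?_
    refine setIntegral_mono_on (hpi.sub hri).norm (hpi1.sub hr).norm measurableSet_Icc ?_
    intro y hy
    rw [← mul_sub, norm_mul]
    exact mul_le_of_le_one_left (norm_nonneg _) (abs_le.2 hy)
  rw [hm] at hd
  have hn2 : (0:ℝ) < n + 2 := by positivity
  have hn3 : (0:ℝ) < n + 3 := by positivity
  have e : ((n:ℝ)+3)⁻¹ * S - σi⁻¹ * ∫ y in Set.Icc (-1:ℝ) 1, y * r y
      = - (((n:ℝ)+2)⁻¹ * (((n:ℝ)+3)⁻¹ * S)) +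
        σi⁻¹ * (σi / (n+2) * S - ∫ y in Set.Icc (-1:ℝ) 1, y * r y) := by
    generalize (∫ y in Set.Icc (-1:ℝ) 1, y * r y) = I
    field_simp
    ring
  rw [e]
  refine (abs_add_le _ _).trans (add_le_add ?_ ?_)
  · rw [abs_neg, abs_mul, abs_mul, abs_of_pos (inv_pos.2 hn2), abs_of_pos (inv_pos.2 hn3)]
    refine mul_le_of_le_one_right (inv_pos.2 hn2).le ?_
    rw [inv_mul_le_iff₀ hn3]
    linarith
  · rw [abs_mul, abs_of_pos (inv_pos.2 hσ)]
    gcongr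

theorem aux_mean_conv (T : ℝ) (hT : 0 < T) (σi : ℝ) (hσ : 0 < σi) (x : ℕ → ℕ → ℝ → ℝ)
    (hxc : ∀ n k, k ≤ n+2 → ContinuousOn (x n k) (Set.Icc 0 T))
    (hx0 : ∀ n t, x n 0 t = -1) (hxN : ∀ n t, x n (n+2) t = 1)
    (ho : ∀ n k t, k < n+2 → t ∈ Set.Icc (0:ℝ) T → x n k t < x n (k+1) t)
    (ρ : ℝ → ℝ → ℝ) (C : ℝ) (hC : ∀ t y, |ρ t y| ≤ C)
    (hρ : IntegrableOn (Function.uncurry ρ) (Set.Icc (0:ℝ) T ×ˢ Set.Icc (-1:ℝ) 1))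
    (hconv : Tendsto (fun n : ℕ => ∫ t in Set.Icc (0:ℝ) T, ∫ y in Set.Icc (-1:ℝ) 1,
        |pcDensity (n+2) σi (fun k => x n k t) y - ρ t y|) atTop (nhds 0)) :
    (∀ t, |σi⁻¹ * ∫ y in Set.Icc (-1:ℝ) 1, y * ρ t y| ≤ σi⁻¹ * (C * 2)) ∧
    IntegrableOn (fun t => σi⁻¹ * ∫ y in Set.Icc (-1:ℝ) 1, y * ρ t y) (Set.Icc 0 T) ∧
    Tendsto (fun n : ℕ => ∫ t in Set.Icc (0:ℝ) T,
      |((n:ℝ)+3)⁻¹ * ∑ k ∈ Finset.range (n+3), x n k t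
        - σi⁻¹ * ∫ y in Set.Icc (-1:ℝ) 1, y * ρ t y|) atTop (nhds 0) := by
  have hb : ∀ t, |σi⁻¹ * ∫ y in Set.Icc (-1:ℝ) 1, y * ρ t y| ≤ σi⁻¹ * (C * 2) := by
    intro t
    rw [abs_mul, abs_of_pos (inv_pos.2 hσ)]
    gcongr
    have := norm_setIntegral_le_of_norm_le_const (μ := volume) (s := Set.Icc (-1:ℝ) 1)
      (f := fun y => y * ρ t y) (C := C) (by simp) (by
        intro y hy
        rw [norm_mul]
        exact (mul_le_of_le_one_left (norm_nonneg _) (abs_le.2 hy)).trans (hC t y))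
    rw [Real.volume_real_Icc_of_le (by norm_num)] at this
    norm_num at this ⊢
    exact this
  have hρ' : Integrable (Function.uncurry ρ)
      ((volume.restrict (Set.Icc (0:ℝ) T)).prod (volume.restrict (Set.Icc (-1:ℝ) 1))) := by
    rw [Measure.prod_restrict]; exact hρ
  have hβm : AEStronglyMeasurable (fun t => σi⁻¹ * ∫ y in Set.Icc (-1:ℝ) 1, y * ρ t y)
      (volume.restrict (Set.Icc (0:ℝ) T)) := by
    refine AEStronglyMeasurable.const_mul ?_ _
    exact ((measurable_snd.aestronglyMeasurable).mul
      hρ'.aestronglyMeasurable).integral_prod_right'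
  have hβi : IntegrableOn (fun t => σi⁻¹ * ∫ y in Set.Icc (-1:ℝ) 1, y * ρ t y) (Set.Icc 0 T) :=
    Integrable.of_bound hβm _ (Eventually.of_forall hb)
  refine ⟨hb, hβi, ?_⟩
  have hae : ∀ᵐ t ∂(volume.restrict (Set.Icc (0:ℝ) T)),
      IntegrableOn (ρ t) (Set.Icc (-1:ℝ) 1) := hρ'.prod_right_ae
  have hmem : ∀ᵐ t ∂(volume.restrict (Set.Icc (0:ℝ) T)), t ∈ Set.Icc (0:ℝ) T :=
    ae_restrict_mem measurableSet_Icc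
  -- measurability and integrability of the `L¹` distance in time
  have hFi : ∀ n, IntegrableOn (fun t => ∫ y in Set.Icc (-1:ℝ) 1,
        |pcDensity (n+2) σi (fun k => x n k t) y - ρ t y|) (Set.Icc 0 T) := by
    intro n
    have hclc : Continuous (fun t : ℝ => max 0 (min T t)) := by fun_prop
    have hcm : ∀ t, max 0 (min T t) ∈ Set.Icc (0:ℝ) T := fun t =>
      ⟨le_max_left _ _, max_le hT.le (min_le_left _ _)⟩
    have hxm : ∀ k, k ≤ n+2 → Measurable (fun t => x n k (max 0 (min T t))) := fun k hk =>
      ((hxc n k hk).comp_continuous hclc hcm).measurable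
    have hpm : Measurable (fun p : ℝ × ℝ =>
        pcDensity (n+2) σi (fun k => x n k (max 0 (min T p.1))) p.2) := by
      unfold pcDensity
      refine Finset.measurable_sum _ fun k hk => ?_
      have hk := Finset.mem_range.1 hk
      have m1 : Measurable (fun p : ℝ × ℝ => x n k (max 0 (min T p.1))) :=
        (hxm k hk.le).comp measurable_fst
      have m2 : Measurable (fun p : ℝ × ℝ => x n (k+1) (max 0 (min T p.1))) :=
        (hxm (k+1) hk).comp measurable_fst
      have hs : MeasurableSet {p : ℝ × ℝ | x n k (max 0 (min T p.1)) ≤ p.2 ∧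
          p.2 < x n (k+1) (max 0 (min T p.1))} :=
        (measurableSet_le m1 measurable_snd).inter (measurableSet_lt measurable_snd m2)
      exact Measurable.indicator (f := fun p : ℝ × ℝ => σi / ((n+2 : ℕ) : ℝ) /
        (x n (k+1) (max 0 (min T p.1)) - x n k (max 0 (min T p.1))))
        (measurable_const.div (m2.sub m1)) hs
    have hFm : AEStronglyMeasurable (fun t => ∫ y in Set.Icc (-1:ℝ) 1,
        |pcDensity (n+2) σi (fun k => x n k (max 0 (min T t))) y - ρ t y|)
        (volume.restrict (Set.Icc (0:ℝ) T)) := by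
      have := (hpm.aestronglyMeasurable.sub hρ'.aestronglyMeasurable).norm.integral_prod_right'
      exact this
    refine Integrable.of_bound (C := σi + C * 2) (hFm.congr ?_) ?_
    · filter_upwards [hmem] with t ht
      rw [min_eq_right ht.2, max_eq_right ht.1]
    · filter_upwards [hmem] with t ht
      have hpi1 := aux_pc_int (n+2) σi (fun k => x n k t) (fun y => 1) continuous_const
      simp only [one_mul] at hpi1
      rw [Real.norm_of_nonneg (integral_nonneg fun _ => abs_nonneg _)]
      calc _ ≤ ∫ y in Set.Icc (-1:ℝ) 1, (pcDensity (n+2) σi (fun k => x n k t) y + C) := by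
            refine integral_mono_of_nonneg (Eventually.of_forall fun _ => abs_nonneg _)
              (hpi1.add (by simp)) (Eventually.of_forall fun y => ?_)
            refine (abs_sub _ _).trans (add_le_add ?_ (hC t y))
            rw [abs_of_nonneg (aux_pc_nonneg _ _ hσ _ (fun k hk => ho n k t hk ht) y)]
        _ = σi + C * 2 := by
            rw [integral_add hpi1 (by simp), aux_pc_mass (n+2) (by omega) σi _ (hx0 n t)
              (hxN n t) (fun k hk => ho n k t hk ht)]
            simp
            ring_nf
  refine squeeze_zero (g := fun n : ℕ => T * ((n:ℝ)+2)⁻¹ + σi⁻¹ * ∫ t in Set.Icc (0:ℝ) T,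
      ∫ y in Set.Icc (-1:ℝ) 1, |pcDensity (n+2) σi (fun k => x n k t) y - ρ t y|)
    (fun n => integral_nonneg fun _ => abs_nonneg _) (fun n => ?_) ?_
  · calc _ ≤ ∫ t in Set.Icc (0:ℝ) T, (((n:ℝ)+2)⁻¹ + σi⁻¹ * ∫ y in Set.Icc (-1:ℝ) 1,
          |pcDensity (n+2) σi (fun k => x n k t) y - ρ t y|) := by
          refine integral_mono_of_nonneg (Eventually.of_forall fun _ => abs_nonneg _)
            (Integrable.add (by simp) ((hFi n).const_mul _)) ?_
          filter_upwards [hmem, hae] with t ht hr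
          exact aux_mean_est n σi hσ (fun k => x n k t) (hx0 n t) (hxN n t)
            (fun k hk => ho n k t hk ht) (ρ t) hr
      _ = _ := by
          rw [integral_add (by simp) ((hFi n).const_mul _), integral_const_mul]
          simp [hT.le]
  · have h1 : Tendsto (fun n : ℕ => ((n:ℝ)+2)⁻¹) atTop (nhds 0) :=
      tendsto_inv_atTop_zero.comp
        (tendsto_atTop_add_const_right _ _ tendsto_natCast_atTop_atTop)
    simpa using (h1.const_mul T).add (hconv.const_mul σi⁻¹)

theorem aux_clamp_lip (R r r' : ℝ) :
    |max (-R) (min R r) - max (-R) (min R r')| ≤ |r - r'| := by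
  rw [max_comm (-R), max_comm (-R), min_comm R, min_comm R]
  exact (abs_sup_sub_sup_le_abs _ _ _).trans (abs_inf_sub_inf_le_abs _ _ _)

theorem aux_clamp_eq (R r : ℝ) (h : |r| ≤ R) : max (-R) (min R r) = r := by
  have := abs_le.1 h
  rw [min_eq_right this.2, max_eq_right this.1]

theorem aux_V {E : Type*} [NormedAddCommGroup E] [NormedSpace ℝ E] (V : ℝ → ℝ → ℝ → E)
    (hV : ContDiff ℝ 1 (fun p : ℝ × ℝ × ℝ => V p.1 p.2.1 p.2.2)) (R : ℝ) (hR : 0 ≤ R) :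
    ∃ K : ℝ, 0 ≤ K ∧ ∀ p q r p' q' r',
      ‖V (max (-R) (min R p)) (max (-R) (min R q)) (max (-R) (min R r)) -
        V (max (-R) (min R p')) (max (-R) (min R q')) (max (-R) (min R r'))‖ ≤
      K * max |p - p'| (max |q - q'| |r - r'|) := by
  obtain ⟨K, hK⟩ := (hV.contDiffOn (s := Set.Icc (-R) R ×ˢ Set.Icc (-R) R ×ˢ Set.Icc (-R) R)
    ).exists_lipschitzOnWith one_ne_zero
    ((convex_Icc _ _).prod ((convex_Icc _ _).prod (convex_Icc _ _)))
    (isCompact_Icc.prod (isCompact_Icc.prod isCompact_Icc))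
  refine ⟨K, K.2, fun p q r p' q' r' => ?_⟩
  have hm : ∀ r, max (-R) (min R r) ∈ Set.Icc (-R) R := fun r =>
    ⟨le_max_left _ _, max_le (by linarith) (min_le_left _ _)⟩
  have h := hK.norm_sub_le (x := (max (-R) (min R p), max (-R) (min R q), max (-R) (min R r)))
    ⟨hm _, hm _, hm _⟩
    (y := (max (-R) (min R p'), max (-R) (min R q'), max (-R) (min R r'))) ⟨hm _, hm _, hm _⟩
  refine h.trans ?_
  gcongr
  exact max_le_max (aux_clamp_lip _ _ _) (max_le_max (aux_clamp_lip _ _ _) (aux_clamp_lip _ _ _))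

/-- Proposition 3.7, convergence of the network nodes.
For C¹ solutions of the DPA system (one for each `N = n+2`) with ordered particles and the
same initial nodes `ā^i`, if the piecewise constant densities converge in `L¹(Ω_T)` to
`ρ^i ∈ L¹ ∩ L^∞(Ω_T)`, then the nodes `a_N^i` converge uniformly on `[0,T]` to continuous
curves `a^i` satisfying `a^i(t) = ā^i + Σ_j ∫_0^t V(μ_{ρ^i}, μ_{ρ^j}, |a^i − a^j|) dτ`. -/
theorem stmt12
    (M d : ℕ) (hM : 1 ≤ M) (T : ℝ) (hT : 0 < T)
    (σ : Fin M → ℝ) (hσ : ∀ i, 0 < σ i)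
    (A K A₁ : Fin M → Fin M → ℝ → ℝ → ℝ → ℝ)
    (cA c1A cK CK : ℝ) (hcK : 0 < cK)
    (hA_nonneg : ∀ i j x y c, 0 ≤ A i j x y c)
    (hA_deriv : ∀ i j y c x₀, HasDerivAt (fun s => A i j s y c) (A₁ i j x₀ y c) x₀)
    (hA_lip : ∀ i j x x' y y' c, |A i j x' y' c - A i j x y c| ≤ cA * (|x' - x| + |y' - y|))
    (hA1_lip : ∀ i j x y y' c, |A₁ i j x y' c - A₁ i j x y c| ≤ c1A * |y' - y|)
    (hK_bdd : ∀ i j x y c, |K i j x y c| ≤ CK)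
    (hK_cont : ∀ i j, Continuous (fun p : ℝ × ℝ × ℝ => K i j p.1 p.2.1 p.2.2))
    (hK_lip : ∀ i j x x' y y' c, |K i j x' y' c - K i j x y c| ≤ cK * (|x' - x| + |y' - y|))
    (hK_diag : ∀ i x c, K i i x x c = 0)
    (Φ : Fin M → ℝ → ℝ)
    (hΦ_mono : ∀ i, MonotoneOn (Φ i) (Set.Ici 0))
    (hΦ_lip : ∀ i, ∃ L : NNReal, LipschitzOnWith L (Φ i) (Set.Ici 0))
    (hΦ0 : ∀ i, Φ i 0 = 0)
    (V : ℝ → ℝ → ℝ → EuclideanSpace ℝ (Fin d))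
    (hV_C1 : ContDiff ℝ 1 (fun p : ℝ × ℝ × ℝ => V p.1 p.2.1 p.2.2))
    (hV_bdd : ∃ CV, ∀ p q r, ‖V p q r‖ ≤ CV)
    -- for each n, a DPA solution with N = n + 2, all with the same initial nodes
    (x : ℕ → Fin M → ℕ → ℝ → ℝ) (a : ℕ → Fin M → ℝ → EuclideanSpace ℝ (Fin d))
    (abar : Fin M → EuclideanSpace ℝ (Fin d))
    (ha_init : ∀ n i, a n i 0 = abar i)
    (hx0 : ∀ n i t, x n i 0 t = -1) (hxN : ∀ n i t, x n i (n+2) t = 1)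
    (hx_order : ∀ n i k t, k < n+2 → t ∈ Set.Icc (0:ℝ) T → x n i k t < x n i (k+1) t)
    (hx_ode : ∀ n i k, 0 < k → k < n+2 → ∀ t ∈ Set.Icc (0:ℝ) T,
      HasDerivAt (x n i k)
        (((∑ j, ∑ l ∈ Finset.range (n+3),
              (σ j / (n+2)) * A i j (x n i k t) (x n j l t) (dist (a n i t) (a n j t)))
            / (σ i / (n+2))) *
            (Φ i ((σ i / (n+2)) / (x n i k t - x n i (k-1) t)) -
             Φ i ((σ i / (n+2)) / (x n i (k+1) t - x n i k t)))
          + ∑ j, ∑ l ∈ Finset.range (n+3),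
              (σ j / (n+2)) * K i j (x n i k t) (x n j l t) (dist (a n i t) (a n j t))) t)
    (ha_ode : ∀ n i, ∀ t ∈ Set.Icc (0:ℝ) T,
      HasDerivAt (a n i)
        (∑ j, V (((n:ℝ)+3)⁻¹ * ∑ k ∈ Finset.range (n+3), x n i k t)
                (((n:ℝ)+3)⁻¹ * ∑ k ∈ Finset.range (n+3), x n j k t)
                (dist (a n i t) (a n j t))) t)
    -- L¹(Ω_T) convergence of the piecewise constant densities (full sequence)
    (ρ : Fin M → ℝ → ℝ → ℝ)
    (hρ_bdd : ∀ i, ∃ C : ℝ, ∀ t y, |ρ i t y| ≤ C)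
    (hρ_int : ∀ i, IntegrableOn (Function.uncurry (ρ i))
      (Set.Icc (0:ℝ) T ×ˢ Set.Icc (-1:ℝ) 1))
    (hconv : ∀ i, Tendsto (fun n : ℕ => ∫ t in Set.Icc (0:ℝ) T, ∫ y in Set.Icc (-1:ℝ) 1,
        |pcDensity (n+2) (σ i) (fun k => x n i k t) y - ρ i t y|) atTop (nhds 0)) :
    ∃ aL : Fin M → ℝ → EuclideanSpace ℝ (Fin d), ∀ i : Fin M,
      ContinuousOn (aL i) (Set.Icc (0:ℝ) T) ∧
      TendstoUniformlyOn (fun n t => a n i t) (aL i) atTop (Set.Icc (0:ℝ) T) ∧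
      ∀ t ∈ Set.Icc (0:ℝ) T,
        aL i t = abar i + ∑ j, ∫ τ in (0:ℝ)..t,
          V ((σ i)⁻¹ * ∫ y in Set.Icc (-1:ℝ) 1, y * ρ i τ y)
            ((σ j)⁻¹ * ∫ y in Set.Icc (-1:ℝ) 1, y * ρ j τ y)
            (dist (aL i τ) (aL j τ)) := by
  obtain ⟨CV, hCV⟩ := hV_bdd
  choose C hC using hρ_bdd
  have hCV0 : 0 ≤ CV := (norm_nonneg _).trans (hCV 0 0 0)
  have hC0 : ∀ i, 0 ≤ C i := fun i => (abs_nonneg _).trans (hC i 0 0)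
  have hxc : ∀ n i k, k ≤ n+2 → ContinuousOn (x n i k) (Set.Icc 0 T) := by
    intro n i k hk
    rcases Nat.eq_zero_or_pos k with rfl | hk0
    · exact continuousOn_const.congr fun t _ => hx0 n i t
    rcases hk.eq_or_lt with rfl | hk1
    · exact continuousOn_const.congr fun t _ => hxN n i t
    · exact fun t ht => (hx_ode n i k hk0 hk1 t ht).continuousAt.continuousWithinAt
  have hmc := fun i => aux_mean_conv T hT (σ i) (hσ i) (fun n => x n i) (fun n k => hxc n i k)
    (fun n => hx0 n i) (fun n => hxN n i) (fun n => hx_order n i) (ρ i) (C i) (hC i) (hρ_int i)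
    (hconv i)
  -- notation
  let bm : ℕ → ℝ → Fin M → ℝ := fun n t i => ((n:ℝ)+3)⁻¹ * ∑ k ∈ Finset.range (n+3), x n i k t
  let β : ℝ → Fin M → ℝ := fun t i => (σ i)⁻¹ * ∫ y in Set.Icc (-1:ℝ) 1, y * ρ i t y
  have hbm1 : ∀ n i, ∀ t ∈ Set.Icc (0:ℝ) T, |bm n t i| ≤ 1 := by
    intro n i t ht
    have hn3 : (0:ℝ) < n + 3 := by positivity
    simp only [bm]
    rw [abs_mul, abs_of_pos (inv_pos.2 hn3), inv_mul_le_iff₀ hn3]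
    calc _ ≤ ∑ k ∈ Finset.range (n+3), |x n i k t| := Finset.abs_sum_le_sum_abs _ _
      _ ≤ ∑ k ∈ Finset.range (n+3), (1:ℝ) := by
        refine Finset.sum_le_sum fun k hk => abs_le.2 ?_
        exact aux_bounds (n+2) (fun k => x n i k t) (hx0 n i t) (hxN n i t)
          (fun k hk => hx_order n i k t hk ht) k (by have := Finset.mem_range.1 hk; omega)
      _ = (n + 3) * 1 := by simp
  have hac : ∀ n i, ContinuousOn (a n i) (Set.Icc 0 T) := fun n i t ht =>
    (ha_ode n i t ht).continuousAt.continuousWithinAt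
  have h0T : (0:ℝ) ∈ Set.Icc 0 T := ⟨le_rfl, hT.le⟩
  have hab : ∀ n i, ∀ t ∈ Set.Icc (0:ℝ) T, ‖a n i t‖ ≤ ∑ i, ‖abar i‖ + M * CV * T := by
    intro n i t ht
    have h1 := (convex_Icc (0:ℝ) T).norm_image_sub_le_of_norm_hasDerivWithin_le
      (f := a n i) (C := M * CV) (fun t ht => (ha_ode n i t ht).hasDerivWithinAt)
      (fun t ht => by
        refine (norm_sum_le _ _).trans ((Finset.sum_le_sum fun j _ => hCV _ _ _).trans ?_)
        simp) h0T ht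
    rw [ha_init, sub_zero, Real.norm_of_nonneg ht.1] at h1
    have h2 : ‖abar i‖ ≤ ∑ i, ‖abar i‖ :=
      Finset.single_le_sum (f := fun i => ‖abar i‖) (fun _ _ => norm_nonneg _) (Finset.mem_univ i)
    have h3 : M * CV * t ≤ M * CV * T := by
      have := ht.2
      gcongr
    have h4 := norm_le_norm_add_norm_sub' (a n i t) (abar i)
    linarith
  obtain ⟨P, hP⟩ : ∃ P, P = ∑ i, ‖abar i‖ + M * CV * T := ⟨_, rfl⟩
  rw [← hP] at hab
  have hP0 : 0 ≤ P := by rw [hP]; positivity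
  have hcs : 0 ≤ ∑ i, (σ i)⁻¹ * (C i * 2) := Finset.sum_nonneg fun i _ => by
    have := hσ i
    have := hC0 i
    positivity
  obtain ⟨R, hR⟩ : ∃ R, R = 1 + 2 * P + ∑ i, (σ i)⁻¹ * (C i * 2) := ⟨_, rfl⟩
  have hR1 : 1 ≤ R := by linarith
  have hRβ : ∀ t i, |β t i| ≤ R := by
    intro t i
    have h1 := (hmc i).1 t
    have h2 : (σ i)⁻¹ * (C i * 2) ≤ ∑ i, (σ i)⁻¹ * (C i * 2) :=
      Finset.single_le_sum (f := fun i => (σ i)⁻¹ * (C i * 2)) (fun i _ => by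
        have := hσ i
        have := hC0 i
        positivity) (Finset.mem_univ i)
    simp only [β]
    linarith
  have hRd : ∀ n i j, ∀ t ∈ Set.Icc (0:ℝ) T, dist (a n i t) (a n j t) ≤ R := by
    intro n i j t ht
    rw [dist_eq_norm]
    have := norm_sub_le (a n i t) (a n j t)
    have := hab n i t ht
    have := hab n j t ht
    linarith
  obtain ⟨K, hK0, hK⟩ := aux_V V hV_C1 R (by linarith)
  let V' : ℝ → ℝ → ℝ → EuclideanSpace ℝ (Fin d) := fun p q r =>
    V (max (-R) (min R p)) (max (-R) (min R q)) (max (-R) (min R r))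
  have hV'c : Continuous (fun p : ℝ × ℝ × ℝ => V' p.1 p.2.1 p.2.2) :=
    hV_C1.continuous.comp (f := fun p : ℝ × ℝ × ℝ =>
      (max (-R) (min R p.1), max (-R) (min R p.2.1), max (-R) (min R p.2.2))) (by fun_prop)
  have hV'eq : ∀ p q r, |p| ≤ R → |q| ≤ R → |r| ≤ R → V' p q r = V p q r := by
    intro p q r hp hq hr
    simp only [V', aux_clamp_eq R _ hp, aux_clamp_eq R _ hq, aux_clamp_eq R _ hr]
  let G : (Fin M → ℝ) → (Fin M → EuclideanSpace ℝ (Fin d)) → (Fin M → EuclideanSpace ℝ (Fin d)) :=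
    fun b a i => ∑ j, V' (b i) (b j) (dist (a i) (a j))
  have hGlip : ∀ b b' a a', ‖G b a - G b' a'‖ ≤ (M * (K * 2)) * (‖b - b'‖ + ‖a - a'‖) := by
    intro b b' a a'
    rw [pi_norm_le_iff_of_nonneg (by positivity)]
    intro i
    have hb : ∀ i, |b i - b' i| ≤ ‖b - b'‖ := fun i => norm_le_pi_norm (b - b') i
    have haa : ∀ i, ‖a i - a' i‖ ≤ ‖a - a'‖ := fun i => norm_le_pi_norm (a - a') i
    simp only [G, Pi.sub_apply]
    rw [← Finset.sum_sub_distrib]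
    refine (norm_sum_le _ _).trans ?_
    have : ∀ j ∈ Finset.univ, ‖V' (b i) (b j) (dist (a i) (a j)) -
        V' (b' i) (b' j) (dist (a' i) (a' j))‖ ≤ (K * 2) * (‖b - b'‖ + ‖a - a'‖) := by
      intro j _
      refine (hK _ _ _ _ _ _).trans ?_
      rw [mul_assoc]
      refine mul_le_mul_of_nonneg_left ?_ hK0
      have n1 := norm_nonneg (b - b')
      have n2 := norm_nonneg (a - a')
      refine max_le ?_ (max_le ?_ ?_)
      · linarith [hb i]
      · linarith [hb j]
      · have h5 := dist_dist_dist_le (a i) (a j) (a' i) (a' j)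
        rw [Real.dist_eq, dist_eq_norm (a i) (a' i), dist_eq_norm (a j) (a' j)] at h5
        linarith [haa i, haa j]
    refine (Finset.sum_le_sum this).trans (le_of_eq ?_)
    simp
    ring
  have hGc : Continuous (Function.uncurry G) := by
    refine continuous_pi fun i => continuous_finsetSum _ fun j _ => ?_
    exact hV'c.comp (f := fun p : (Fin M → ℝ) × (Fin M → EuclideanSpace ℝ (Fin d)) =>
      (p.1 i, p.1 j, dist (p.2 i) (p.2 j))) (by fun_prop)
  have hGb : ∀ b a, ‖G b a‖ ≤ M * CV := by
    intro b a
    rw [pi_norm_le_iff_of_nonneg (by positivity)]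
    intro i
    refine (norm_sum_le _ _).trans ((Finset.sum_le_sum fun j _ => hCV _ _ _).trans ?_)
    simp
  -- clamped curves
  have hclc : Continuous (fun t : ℝ => max 0 (min T t)) := by fun_prop
  have hcm : ∀ t, max 0 (min T t) ∈ Set.Icc (0:ℝ) T := fun t =>
    ⟨le_max_left _ _, max_le hT.le (min_le_left _ _)⟩
  have hce : ∀ t ∈ Set.Icc (0:ℝ) T, max 0 (min T t) = t := fun t ht => by
    rw [min_eq_right ht.2, max_eq_right ht.1]
  let aa : ℕ → ℝ → Fin M → EuclideanSpace ℝ (Fin d) := fun n t i => a n i (max 0 (min T t))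
  let bb : ℕ → ℝ → Fin M → ℝ := fun n t => bm n (max 0 (min T t))
  have haac : ∀ n, Continuous (aa n) := fun n => continuous_pi fun i =>
    (hac n i).comp_continuous hclc hcm
  have hbbc : ∀ n, Continuous (bb n) := fun n => continuous_pi fun i => by
    refine continuous_const.mul (continuous_finsetSum _ fun k hk => ?_)
    exact (hxc n i k (by have := Finset.mem_range.1 hk; omega)).comp_continuous hclc hcm
  have hβi : IntegrableOn β (Set.Icc 0 T) := Integrable.of_eval fun i => (hmc i).2.1
  have hder : ∀ n, ∀ t ∈ Set.Icc (0:ℝ) T,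
      HasDerivAt (fun t i => a n i t) (G (bb n t) (aa n t)) t := by
    intro n t ht
    rw [hasDerivAt_pi]
    intro i
    refine (ha_ode n i t ht).congr_deriv (Eq.symm ?_)
    simp only [G, aa, bb, hce t ht]
    refine Finset.sum_congr rfl fun j _ => ?_
    exact hV'eq _ _ _ ((hbm1 n i t ht).trans hR1) ((hbm1 n j t ht).trans hR1)
      (by rw [abs_of_nonneg dist_nonneg]; exact hRd n i j t ht)
  have hinteq : ∀ n, ∀ t ∈ Set.Icc (0:ℝ) T,
      aa n t = abar + ∫ τ in (0:ℝ)..t, G (bb n τ) (aa n τ) := by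
    intro n t ht
    have hc : Continuous (fun τ => G (bb n τ) (aa n τ)) := hGc.comp ((hbbc n).prodMk (haac n))
    rw [intervalIntegral.integral_eq_sub_of_hasDerivAt (f := fun t i => a n i t)
      (fun s hs => by
        rw [Set.uIcc_of_le ht.1] at hs
        exact hder n s ⟨hs.1, hs.2.trans ht.2⟩) (hc.intervalIntegrable _ _)]
    funext i
    simp [aa, hce t ht, ha_init]
  have hlim : Tendsto (fun n => ∫ t in (0:ℝ)..T, ‖bb n t - β t‖) atTop (nhds 0) := by
    have hsum := tendsto_finsetSum (Finset.univ : Finset (Fin M)) fun i _ => (hmc i).2.2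
    simp only [Finset.sum_const_zero] at hsum
    refine squeeze_zero (fun n => intervalIntegral.integral_nonneg hT.le
      fun _ _ => norm_nonneg _) (fun n => ?_) hsum
    have hii : ∀ i, IntegrableOn (fun t => |bb n t i - β t i|) (Set.Icc 0 T) := fun i =>
      (((continuous_apply i).comp (hbbc n)).continuousOn.integrableOn_Icc.sub (hmc i).2.1).abs
    rw [intervalIntegral.integral_of_le hT.le, ← integral_Icc_eq_integral_Ioc]
    calc _ ≤ ∫ t in Set.Icc 0 T, ∑ i, |bb n t i - β t i| := by
          refine integral_mono_of_nonneg (Eventually.of_forall fun _ => norm_nonneg _)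
            (integrable_finsetSum _ fun i _ => hii i) (Eventually.of_forall fun t => ?_)
          refine (pi_norm_le_iff_of_nonneg (Finset.sum_nonneg fun _ _ => abs_nonneg _)).2
            fun i => ?_
          exact Finset.single_le_sum (f := fun i => |bb n t i - β t i|)
            (fun _ _ => abs_nonneg _) (Finset.mem_univ i)
      _ = ∑ i, ∫ t in Set.Icc 0 T, |bb n t i - β t i| :=
          integral_finsetSum _ fun i _ => hii i
      _ = _ := by
          refine Finset.sum_congr rfl fun i _ => setIntegral_congr_fun measurableSet_Icc ?_
          intro t ht
          simp only [bb, hce t ht, bm, β]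
      _ ≤ _ := le_rfl
  obtain ⟨aL, hLc, hLu, hLi, hLeq⟩ := aux_limit T hT G (M * (K * 2)) (M * CV) (by positivity)
    hGlip hGc hGb aa bb β abar haac hbbc hβi hinteq hlim
  have hpt : ∀ i, ∀ t ∈ Set.Icc (0:ℝ) T, Tendsto (fun n => a n i t) atTop (nhds (aL t i)) := by
    intro i t ht
    have := (tendsto_pi_nhds.1 (hLu.tendsto_at ht)) i
    simpa only [aa, hce t ht] using this
  have hdL : ∀ i j, ∀ t ∈ Set.Icc (0:ℝ) T, dist (aL t i) (aL t j) ≤ R := fun i j t ht =>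
    le_of_tendsto ((hpt i t ht).dist (hpt j t ht)) (Eventually.of_forall fun n => hRd n i j t ht)
  refine ⟨fun i t => aL t i, fun i => ⟨?_, ?_, ?_⟩⟩
  · exact (continuous_apply i).comp_continuousOn hLc
  · rw [Metric.tendstoUniformlyOn_iff] at hLu ⊢
    intro ε hε
    filter_upwards [hLu ε hε] with n hn t ht
    have h1 := hn t ht
    refine lt_of_le_of_lt ?_ h1
    have := dist_le_pi_dist (aL t) (aa n t) i
    simpa only [aa, hce t ht] using this
  · intro t ht
    have hLit : IntervalIntegrable (fun τ => G (β τ) (aL τ)) volume 0 t :=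
      (intervalIntegrable_iff_integrableOn_Icc_of_le ht.1).2
        (hLi.mono_set (Set.Icc_subset_Icc_right ht.2))
    have e1 := congrFun (hLeq t ht) i
    have e2 := (ContinuousLinearMap.proj (R := ℝ) (φ := fun _ : Fin M => EuclideanSpace ℝ (Fin d))
      i).intervalIntegral_comp_comm hLit
    simp only [ContinuousLinearMap.proj_apply] at e2
    refine e1.trans ?_
    rw [Pi.add_apply, ← e2]
    congr 1
    simp only [G]
    rw [intervalIntegral.integral_finsetSum]
    · refine Finset.sum_congr rfl fun j _ => intervalIntegral.integral_congr fun τ hτ => ?_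
      rw [Set.uIcc_of_le ht.1] at hτ
      have hτ' : τ ∈ Set.Icc (0:ℝ) T := ⟨hτ.1, hτ.2.trans ht.2⟩
      exact hV'eq _ _ _ (hRβ τ i) (hRβ τ j)
        (by rw [abs_of_nonneg dist_nonneg]; exact hdL i j τ hτ')
    · intro j _
      refine (intervalIntegrable_iff_integrableOn_Icc_of_le ht.1).2 (IntegrableOn.mono_set ?_
        (Set.Icc_subset_Icc_right ht.2))
      refine Integrable.of_bound (C := CV) ?_ (Eventually.of_forall fun _ => hCV _ _ _)
      have hLm := hLc.aestronglyMeasurable (μ := volume) measurableSet_Icc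
      exact (hV'c.comp (f := fun p : (Fin M → ℝ) × (Fin M → EuclideanSpace ℝ (Fin d)) =>
        (p.1 i, p.1 j, dist (p.2 i) (p.2 j))) (by fun_prop)).comp_aestronglyMeasurable
        (hβi.aestronglyMeasurable.prodMk hLm)
end

section
/- For each N ≥ 2 let (x_k^{i,N}, a_N^i) be a C¹ solution of the DPA system on [0,T] with ordered particles, let ρ^{i,N} be the piecewise constant densities and ρ̃^{i,N}(t) = σ_N^i Σ_{k=0}^N δ_{x_k^{i,N}(t)} the empirical measures. Assume additionally that ∂₁A^{ij} is continuous and bounded on Ω×Ω×ℝ (jointly in all three variables). Suppose ρ^{i,N} → ρ^i in L¹(Ω_T) with ρ^i ∈ L¹∩L^∞(Ω_T), a_N^j → a^j uniformly on [0,T] for all j, and ∫_0^T d_{W¹}(ρ̃^{j,N}(t,·), ρ^j(t,·)) dt → 0 for all j. Then for every ζ ∈ C_c^∞((0,T)×(−1,1)), ∫_{Ω_T} Φ^i(ρ^{i,N}(t,x)) ∂_x β^i(ρ̃^N, a_N; x) ∂_x ζ(t,x) dx dt → ∫_{Ω_T} Φ^i(ρ^i(t,x)) ∂_x β^i(ρ,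 a; x) ∂_x ζ(t,x) dx dt as N → ∞, where for a vector of finite measures or densities ρ = (ρ^1,…,ρ^M) on Ω and nodes a = (a^1,…,a^M) ∈ (ℝ^d)^M with a^{ij} = |a^i − a^j|, the derivative of the diffusion mobility is ∂_x β^i(ρ, a; x) = Σ_j ∫_Ω ∂₁A^{ij}(x,y,a^{ij}) dρ^j(y). -/
open MeasureTheory Filter

namespace S13

lemma pc_nonneg (N : ℕ) (s : ℝ) (hs : 0 < s) (y : ℕ → ℝ)
    (hy : ∀ k < N, y k < y (k+1)) (z : ℝ) : 0 ≤ pcDensity N s y z := by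
  unfold pcDensity
  refine Finset.sum_nonneg fun k hk => Set.indicator_nonneg (fun _ _ => ?_) _
  have := hy k (Finset.mem_range.1 hk)
  have : 0 < y (k+1) - y k := by linarith
  positivity

lemma pc_aesm {α : Type*} [MeasurableSpace α] (μ : Measure α) (N : ℕ) (s : ℝ)
    (x : ℕ → α → ℝ) (f : α → ℝ)
    (hx : ∀ k ≤ N, AEMeasurable (x k) μ) (hf : AEMeasurable f μ) :
    AEStronglyMeasurable (fun p => pcDensity N s (fun k => x k p) (f p)) μ := by
  unfold pcDensity
  refine Finset.aestronglyMeasurable_fun_sum _ fun k hk => ?_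
  have hk' := Finset.mem_range.1 hk
  have h0 := hx k (by omega)
  have h1 := hx (k+1) (by omega)
  have hs : NullMeasurableSet ({p | x k p ≤ f p} ∩ {p | f p < x (k+1) p}) μ :=
    (nullMeasurableSet_le h0 hf).inter (nullMeasurableSet_lt hf h1)
  have hg : AEStronglyMeasurable (fun p => (s / N) / (x (k+1) p - x k p)) μ :=
    (aemeasurable_const.div (h1.sub h0)).aestronglyMeasurable
  refine (hg.indicator₀ hs).congr (Filter.Eventually.of_forall fun p => ?_)
  simp only [Set.indicator, Set.mem_inter_iff, Set.mem_ofPred_eq, Set.mem_Ico]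

lemma mono_pts (N : ℕ) (y : ℕ → ℝ) (hy : ∀ k < N, y k < y (k+1)) :
    ∀ b ≤ N, ∀ a ≤ b, y a ≤ y b := by
  intro b
  induction b with
  | zero => intro _ a ha; obtain rfl : a = 0 := by omega
            exact le_rfl
  | succ b ih =>
    intro hb a ha
    rcases Nat.lt_or_ge a (b+1) with h | h
    · exact (ih (by omega) a (by omega)).trans (hy b (by omega)).le
    · obtain rfl : a = b+1 := by omega
      exact le_rfl

lemma pc_integral (N : ℕ) (s : ℝ) (y : ℕ → ℝ)
    (hy : ∀ k < N, y k < y (k+1)) (h0 : y 0 = -1) (hN : y N = 1) (g : ℝ → ℝ) (hg : Continuous g) :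
    IntegrableOn (fun z => g z * pcDensity N s y z) (Set.Icc (-1) 1) ∧
    ∫ z in Set.Icc (-1:ℝ) 1, g z * pcDensity N s y z =
      ∑ k ∈ Finset.range N, ∫ z in Set.Ico (y k) (y (k+1)), g z * ((s / N) / (y (k+1) - y k)) := by
  have hpt : ∀ z, g z * pcDensity N s y z = ∑ k ∈ Finset.range N,
      (Set.Ico (y k) (y (k+1))).indicator (fun z => g z * ((s / N) / (y (k+1) - y k))) z := by
    intro z
    unfold pcDensity
    rw [Finset.mul_sum]
    refine Finset.sum_congr rfl fun k _ => ?_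
    simp only [Set.indicator]
    split_ifs <;> simp
  have hint : ∀ k ∈ Finset.range N, IntegrableOn
      ((Set.Ico (y k) (y (k+1))).indicator (fun z => g z * ((s / N) / (y (k+1) - y k))))
      (Set.Icc (-1) 1) := by
    intro k _
    refine Integrable.indicator ?_ measurableSet_Ico
    exact (hg.mul continuous_const).continuousOn.integrableOn_compact isCompact_Icc
  simp only [hpt]
  refine ⟨integrable_finsetSum _ hint, ?_⟩
  rw [integral_finsetSum _ hint]
  refine Finset.sum_congr rfl fun k hk => ?_
  rw [integral_indicator measurableSet_Ico, Measure.restrict_restrict measurableSet_Ico]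
  congr 2
  refine Set.inter_eq_left.2 fun z hz => ?_
  have hk' := Finset.mem_range.1 hk
  have a1 := mono_pts N y hy k hk'.le 0 (by omega)
  have a2 := mono_pts N y hy N le_rfl (k+1) hk'
  exact ⟨by linarith [hz.1], by linarith [hz.2]⟩

lemma quad (N : ℕ) (hN0 : 0 < N) (s : ℝ) (hs : 0 < s) (y : ℕ → ℝ)
    (hy : ∀ k < N, y k < y (k+1)) (h0 : y 0 = -1) (hN : y N = 1) (g : ℝ → ℝ) (hg : Continuous g)
    (C L : ℝ) (hC : ∀ z, |g z| ≤ C) (hL : ∀ z z', |g z' - g z| ≤ L * |z' - z|) :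
    |∑ l ∈ Finset.range (N+1), (s / N) * g (y l) -
      ∫ z in Set.Icc (-1:ℝ) 1, g z * pcDensity N s y z| ≤ (s / N) * (2 * L + C) := by
  rw [(pc_integral N s y hy h0 hN g hg).2, Finset.sum_range_succ, add_sub_right_comm,
    ← Finset.sum_sub_distrib]
  have hNpos : (0:ℝ) < N := by exact_mod_cast hN0
  have hsN : 0 < s / N := by positivity
  have hL0 : 0 ≤ L := by
    have := (abs_nonneg _).trans (hL 0 1); simpa using this
  have key : ∀ k ∈ Finset.range N, |s / N * g (y k) -
      ∫ z in Set.Ico (y k) (y (k+1)), g z * ((s / N) / (y (k+1) - y k))| ≤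
      (s / N * L) * (y (k+1) - y k) := by
    intro k hk
    have hgap : 0 < y (k+1) - y k := by linarith [hy k (Finset.mem_range.1 hk)]
    have hvol : (volume : Measure ℝ).real (Set.Ico (y k) (y (k+1))) = y (k+1) - y k := by
      rw [Measure.real, Real.volume_Ico, ENNReal.toReal_ofReal hgap.le]
    have e1 : s / N * g (y k) = ∫ z in Set.Ico (y k) (y (k+1)), g (y k) * ((s / N) / (y (k+1) - y k)) := by
      rw [setIntegral_const, hvol, smul_eq_mul]; field_simp
    have i1 : ∀ c : ℝ → ℝ, Continuous c → IntegrableOn c (Set.Ico (y k) (y (k+1))) := fun c hc =>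
      (hc.continuousOn.integrableOn_compact (isCompact_Icc (a := y k) (b := y (k+1)))).mono_set
        Set.Ico_subset_Icc_self
    rw [e1, ← integral_sub (i1 _ continuous_const) (i1 _ (by fun_prop))]
    have hb := norm_setIntegral_le_of_norm_le_const (μ := (volume : Measure ℝ))
      (s := Set.Ico (y k) (y (k+1)))
      (f := fun z => g (y k) * ((s / N) / (y (k+1) - y k)) - g z * ((s / N) / (y (k+1) - y k)))
      (C := s / N * L) (by simp) (by
        intro z hz
        rw [← sub_mul, Real.norm_eq_abs, abs_mul, abs_of_pos (div_pos hsN hgap)]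
        have h1 := hL z (y k)
        have h2 : |y k - z| ≤ y (k+1) - y k := by
          rw [abs_le]; constructor <;> linarith [hz.1, hz.2]
        have h3 : |g (y k) - g z| ≤ L * (y (k+1) - y k) := h1.trans (by gcongr)
        calc _ ≤ L * (y (k+1) - y k) * (s / N / (y (k+1) - y k)) := by gcongr
          _ = s / N * L := by field_simp)
    rw [hvol] at hb
    exact hb
  have hsum := (Finset.abs_sum_le_sum_abs _ _).trans (Finset.sum_le_sum key)
  rw [← Finset.mul_sum, Finset.sum_range_sub, hN, h0] at hsum
  have hlast : |s / N * g (y N)| ≤ s / N * C := by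
    rw [abs_mul, abs_of_pos hsN]; gcongr; exact hC _
  refine (abs_add_le _ _).trans ?_
  linarith

lemma tendsto_of_le (F : ℕ → ℝ) (l K : ℝ) (hK : 0 ≤ K) (r : ℕ → ℝ) (hr : Tendsto r atTop (nhds 0))
    (h : ∀ ε > 0, ∀ᶠ n in atTop, |F n - l| ≤ K * ε + r n) : Tendsto F atTop (nhds l) := by
  rw [Metric.tendsto_nhds]
  intro ε hε
  have hd : 0 < ε / (2 * (K + 1)) := by positivity
  filter_upwards [h _ hd, hr.eventually_lt_const (show 0 < ε / 2 by positivity)] with n h1 h2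
  rw [Real.dist_eq]
  have : K * (ε / (2 * (K+1))) ≤ ε / 2 := by
    rw [mul_div_assoc', div_le_div_iff₀ (by positivity) (by positivity)]; nlinarith
  linarith

lemma unif_A {X : Type*} (I : Set X) (f : ℝ × ℝ × ℝ → ℝ) (hf : Continuous f)
    (dn : ℕ → X → ℝ) (d : X → ℝ) (R : ℝ) (hd : ∀ t ∈ I, |d t| ≤ R)
    (hu : TendstoUniformlyOn dn d atTop I) (ε : ℝ) (hε : 0 < ε) :
    ∀ᶠ n in atTop, ∀ t ∈ I, ∀ y ∈ Set.Icc (-1:ℝ) 1, ∀ z ∈ Set.Icc (-1:ℝ) 1,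
      |f (y, z, dn n t) - f (y, z, d t)| ≤ ε := by
  have hc : IsCompact (Set.Icc (-1:ℝ) 1 ×ˢ Set.Icc (-1:ℝ) 1 ×ˢ Set.Icc (-(R+1)) (R+1)) :=
    isCompact_Icc.prod (isCompact_Icc.prod isCompact_Icc)
  have huc := hc.uniformContinuousOn_of_continuous hf.continuousOn
  rw [Metric.uniformContinuousOn_iff] at huc
  obtain ⟨δ, hδ, H⟩ := huc ε hε
  rw [Metric.tendstoUniformlyOn_iff] at hu
  filter_upwards [hu (min δ 1) (by positivity)] with n hn t ht y hy z hz
  have h1 := hn t ht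
  have h2 := abs_le.1 (hd t ht)
  have h3 := lt_of_lt_of_le h1 (min_le_left _ _)
  have h4 := lt_of_lt_of_le h1 (min_le_right _ _)
  rw [Real.dist_eq, abs_lt] at h4
  have := H (y, z, dn n t) ⟨hy, hz, by constructor <;> simp only <;> linarith⟩ (y, z, d t)
    ⟨hy, hz, by constructor <;> simp only <;> linarith⟩ (by
      rw [dist_comm]; simp [Prod.dist_eq, h3])
  rw [Real.dist_eq] at this
  exact this.le

/-- measurability of the limit mobility -/
lemma B_aesm (μ ν : Measure ℝ) [SFinite μ] [SFinite ν] (f : ℝ × ℝ × ℝ → ℝ) (hf : Continuous f)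
    (d : ℝ → ℝ) (hd : AEMeasurable d μ) (ρ : ℝ → ℝ → ℝ)
    (hρ : AEStronglyMeasurable (Function.uncurry ρ) (μ.prod ν)) :
    AEStronglyMeasurable (fun p : ℝ × ℝ => ∫ z, f (p.2, z, d p.1) * ρ p.1 z ∂ν) (μ.prod ν) := by
  have hq : Measure.QuasiMeasurePreserving (fun q : (ℝ × ℝ) × ℝ => (q.1.1, q.2))
      ((μ.prod ν).prod ν) (μ.prod ν) :=
    QuasiMeasurePreserving.prodMap Measure.quasiMeasurePreserving_fst (Measure.QuasiMeasurePreserving.id ν)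
  have h1 : AEStronglyMeasurable (fun q : (ℝ × ℝ) × ℝ => ρ q.1.1 q.2) ((μ.prod ν).prod ν) :=
    hρ.comp_quasiMeasurePreserving hq
  have hd' : AEMeasurable (fun q : (ℝ × ℝ) × ℝ => d q.1.1) ((μ.prod ν).prod ν) :=
    (hd.comp_fst (ν := ν)).comp_fst (ν := ν)
  have h2 : AEStronglyMeasurable (fun q : (ℝ × ℝ) × ℝ => f (q.1.2, q.2, d q.1.1))
      ((μ.prod ν).prod ν) :=
    (hf.measurable.comp_aemeasurable ((by fun_prop : Measurable (fun q : (ℝ × ℝ) × ℝ => q.1.2)).aemeasurable.prodMk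
      (measurable_snd.aemeasurable.prodMk hd'))).aestronglyMeasurable
  exact (h2.mul h1).integral_prod_right'

/-- derivative of test function -/
lemma zeta_deriv (ζ : ℝ → ℝ → ℝ) (h : ContDiff ℝ (⊤ : ℕ∞) (Function.uncurry ζ)) :
    Continuous (fun p : ℝ × ℝ => deriv (fun z => ζ p.1 z) p.2) := by
  have he : (fun p : ℝ × ℝ => deriv (fun z => ζ p.1 z) p.2) =
      fun p => fderiv ℝ (Function.uncurry ζ) p (0, 1) := by
    funext p
    have h1 : HasFDerivAt (Function.uncurry ζ) (fderiv ℝ (Function.uncurry ζ) p) (p.1, p.2) :=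
      ((h.differentiable (by simp)) p).hasFDerivAt
    have h2 : HasDerivAt (fun z : ℝ => (p.1, z)) ((0:ℝ), (1:ℝ)) p.2 :=
      (hasDerivAt_const _ _).prodMk (hasDerivAt_id _)
    exact (h1.comp_hasDerivAt p.2 h2).deriv
  rw [he]
  exact (h.continuous_fderiv (by simp)).clm_apply continuous_const

lemma phi_aesm {α : Type*} [MeasurableSpace α] (μ : Measure α) (Φ : ℝ → ℝ) (L : NNReal)
    (hΦ : LipschitzOnWith L Φ (Set.Ici 0)) (f : α → ℝ) (hf : AEStronglyMeasurable f μ)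
    (h0 : ∀ᵐ p ∂μ, 0 ≤ f p) : AEStronglyMeasurable (fun p => Φ (f p)) μ := by
  have hc : Continuous (fun s : ℝ => Φ (max s 0)) :=
    hΦ.continuousOn.comp_continuous (by fun_prop) (fun s => Set.mem_Ici.2 (le_max_right _ _))
  refine (hc.comp_aestronglyMeasurable hf).congr ?_
  filter_upwards [h0] with p hp
  rw [max_eq_left hp]

lemma per_t (Φ : ℝ → ℝ) (L : NNReal) (hΦ : LipschitzOnWith L Φ (Set.Ici 0)) (hΦ0 : Φ 0 = 0)
    (p r Bn B D : ℝ → ℝ) (Cr CB CB' CD η : ℝ) (hη : 0 ≤ η)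
    (hp0 : ∀ y, 0 ≤ p y) (hp : IntegrableOn p (Set.Icc (-1) 1))
    (hr0 : ∀ᵐ y ∂(volume.restrict (Set.Icc (-1:ℝ) 1)), 0 ≤ r y)
    (hr : IntegrableOn r (Set.Icc (-1) 1)) (hCr : ∀ y, |r y| ≤ Cr)
    (hBn : AEStronglyMeasurable Bn (volume.restrict (Set.Icc (-1:ℝ) 1)))
    (hB : AEStronglyMeasurable B (volume.restrict (Set.Icc (-1:ℝ) 1)))
    (hD : AEStronglyMeasurable D (volume.restrict (Set.Icc (-1:ℝ) 1)))
    (hCB : ∀ y, |Bn y| ≤ CB) (hCB' : ∀ y, |B y| ≤ CB')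
    (hBB : ∀ y ∈ Set.Icc (-1:ℝ) 1, |Bn y - B y| ≤ η)
    (hCD : ∀ y ∈ Set.Icc (-1:ℝ) 1, |D y| ≤ CD) :
    |(∫ y in Set.Icc (-1:ℝ) 1, Φ (p y) * Bn y * D y) - ∫ y in Set.Icc (-1:ℝ) 1, Φ (r y) * B y * D y|
      ≤ L * CB * CD * (∫ y in Set.Icc (-1:ℝ) 1, |p y - r y|) + 2 * (L * Cr * CD) * η := by
  have hCr0 : 0 ≤ Cr := (abs_nonneg _).trans (hCr 0)
  have hCB0 : 0 ≤ CB := (abs_nonneg _).trans (hCB 0)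
  have hCB0' : 0 ≤ CB' := (abs_nonneg _).trans (hCB' 0)
  have hCD0 : 0 ≤ CD := (abs_nonneg _).trans (hCD 0 (by simp))
  have hlip : ∀ a b : ℝ, 0 ≤ a → 0 ≤ b → |Φ a - Φ b| ≤ L * |a - b| := by
    intro a b ha hb
    simpa [Real.dist_eq] using hΦ.dist_le_mul a ha b hb
  have hlip0 : ∀ a : ℝ, 0 ≤ a → |Φ a| ≤ L * |a| := by
    intro a ha
    simpa [hΦ0] using hlip a 0 ha le_rfl
  have hmem := ae_restrict_mem (μ := (volume : Measure ℝ)) (measurableSet_Icc (a := (-1:ℝ)) (b := 1))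
  have i1 : IntegrableOn (fun y => Φ (p y) * Bn y * D y) (Set.Icc (-1) 1) := by
    refine Integrable.mono' (hp.abs.const_mul (L * CB * CD))
      (((phi_aesm _ Φ L hΦ p hp.aestronglyMeasurable (Eventually.of_forall hp0)).mul hBn).mul hD) ?_
    filter_upwards [hmem] with y hy
    rw [Real.norm_eq_abs, abs_mul, abs_mul]
    calc _ ≤ (L * |p y|) * CB * CD := by
          gcongr
          · exact hlip0 _ (hp0 y)
          · exact hCB y
          · exact hCD y hy
      _ = _ := by ring
  have i2 : IntegrableOn (fun y => Φ (r y) * B y * D y) (Set.Icc (-1) 1) := by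
    refine Integrable.mono' (hr.abs.const_mul (L * CB' * CD))
      (((phi_aesm _ Φ L hΦ r hr.aestronglyMeasurable hr0).mul hB).mul hD) ?_
    filter_upwards [hmem, hr0] with y hy hy0
    rw [Real.norm_eq_abs, abs_mul, abs_mul]
    calc _ ≤ (L * |r y|) * CB' * CD := by
          gcongr
          · exact hlip0 _ hy0
          · exact hCB' y
          · exact hCD y hy
      _ = _ := by ring
  rw [← integral_sub i1 i2]
  have i3 : IntegrableOn (fun y => |p y - r y|) (Set.Icc (-1) 1) := (hp.sub hr).abs
  have i4 : IntegrableOn (fun _ : ℝ => L * Cr * CD * η) (Set.Icc (-1:ℝ) 1) :=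
    continuous_const.continuousOn.integrableOn_compact isCompact_Icc
  have hb := norm_integral_le_of_norm_le (μ := volume.restrict (Set.Icc (-1:ℝ) 1))
    (f := fun y => Φ (p y) * Bn y * D y - Φ (r y) * B y * D y)
    ((i3.const_mul (L * CB * CD)).add i4) (by
      filter_upwards [hmem, hr0] with y hy hy0
      have e : Φ (p y) * Bn y * D y - Φ (r y) * B y * D y =
        (Φ (p y) - Φ (r y)) * Bn y * D y + Φ (r y) * (Bn y - B y) * D y := by ring
      rw [e]
      refine (norm_add_le _ _).trans ?_
      simp only [Real.norm_eq_abs, abs_mul, Pi.add_apply]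
      have h1 : |Φ (p y) - Φ (r y)| * |Bn y| * |D y| ≤ (L * |p y - r y|) * CB * CD := by
        gcongr
        · exact hlip _ _ (hp0 y) hy0
        · exact hCB y
        · exact hCD y hy
      have h2 : |Φ (r y)| * |Bn y - B y| * |D y| ≤ (L * Cr) * η * CD := by
        gcongr
        · exact (hlip0 _ hy0).trans (by gcongr; exact hCr y)
        · exact hBB y hy
        · exact hCD y hy
      linarith)
  refine hb.trans (le_of_eq ?_)
  simp only [Pi.add_apply]
  rw [integral_add (i3.const_mul _) i4, integral_const_mul, setIntegral_const]
  simp only [Measure.real, Real.volume_Icc, smul_eq_mul]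
  rw [ENNReal.toReal_ofReal (by norm_num)]
  ring

lemma B_diff (N : ℕ) (hN0 : 0 < N) (s : ℝ) (hs : 0 < s) (y : ℕ → ℝ)
    (hy : ∀ k < N, y k < y (k+1)) (h0 : y 0 = -1) (hN : y N = 1) (g g' : ℝ → ℝ)
    (hg : Continuous g) (hg' : Continuous g')
    (C L : ℝ) (hC : ∀ z, |g z| ≤ C) (hL : ∀ z z', |g z' - g z| ≤ L * |z' - z|)
    (r : ℝ → ℝ) (hr : IntegrableOn r (Set.Icc (-1) 1)) (Cr : ℝ) (hCr : ∀ y, |r y| ≤ Cr)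
    (ε : ℝ) (hε : ∀ z ∈ Set.Icc (-1:ℝ) 1, |g z - g' z| ≤ ε) :
    |∑ l ∈ Finset.range (N+1), (s / N) * g (y l) - ∫ z in Set.Icc (-1:ℝ) 1, g' z * r z| ≤
      (s / N) * (2 * L + C) + C * (∫ z in Set.Icc (-1:ℝ) 1, |pcDensity N s y z - r z|)
        + 2 * Cr * ε := by
  have h1 := quad N hN0 s hs y hy h0 hN g hg C L hC hL
  have hC0 : 0 ≤ C := (abs_nonneg _).trans (hC 0)
  have hε0 : 0 ≤ ε := (abs_nonneg _).trans (hε 0 (by simp))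
  have hmem := ae_restrict_mem (μ := (volume : Measure ℝ)) (measurableSet_Icc (a := (-1:ℝ)) (b := 1))
  have ip : IntegrableOn (pcDensity N s y) (Set.Icc (-1) 1) := by
    simpa using (pc_integral N s y hy h0 hN (fun _ => 1) continuous_const).1
  have i1 := (pc_integral N s y hy h0 hN g hg).1
  have i2 : IntegrableOn (fun z => g' z * r z) (Set.Icc (-1) 1) :=
    hr.continuousOn_mul hg'.continuousOn isCompact_Icc
  have i3 : IntegrableOn (fun y_1 => |pcDensity N s y y_1 - r y_1|) (Set.Icc (-1) 1) := (ip.sub hr).abs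
  have i4 : IntegrableOn (fun _ : ℝ => Cr * ε) (Set.Icc (-1:ℝ) 1) :=
    continuous_const.continuousOn.integrableOn_compact isCompact_Icc
  have hb := norm_integral_le_of_norm_le (μ := volume.restrict (Set.Icc (-1:ℝ) 1))
    (f := fun z => g z * pcDensity N s y z - g' z * r z)
    ((i3.const_mul C).add i4) (by
      filter_upwards [hmem] with z hz
      have e : g z * pcDensity N s y z - g' z * r z =
        g z * (pcDensity N s y z - r z) + (g z - g' z) * r z := by ring
      rw [e]
      refine (norm_add_le _ _).trans ?_
      simp only [Real.norm_eq_abs, abs_mul, Pi.add_apply]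
      have h1 : |g z| * |pcDensity N s y z - r z| ≤ C * |pcDensity N s y z - r z| := by
        gcongr; exact hC z
      have h2 : |g z - g' z| * |r z| ≤ ε * Cr := by
        gcongr
        · exact hε z hz
        · exact hCr z
      linarith)
  rw [integral_sub i1 i2] at hb
  simp only [Pi.add_apply] at hb
  rw [integral_add (i3.const_mul _) i4, integral_const_mul, setIntegral_const] at hb
  simp only [Measure.real, Real.volume_Icc, smul_eq_mul] at hb
  rw [ENNReal.toReal_ofReal (by norm_num), Real.norm_eq_abs] at hb
  have := abs_add_le (∑ l ∈ Finset.range (N+1), (s / N) * g (y l) -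
      ∫ z in Set.Icc (-1:ℝ) 1, g z * pcDensity N s y z)
      ((∫ z in Set.Icc (-1:ℝ) 1, g z * pcDensity N s y z) - ∫ z in Set.Icc (-1:ℝ) 1, g' z * r z)
  rw [sub_add_sub_cancel] at this
  linarith

lemma pc_mass (N : ℕ) (hN0 : 0 < N) (s : ℝ) (hs : 0 < s) (y : ℕ → ℝ)
    (hy : ∀ k < N, y k < y (k+1)) (h0 : y 0 = -1) (hN : y N = 1) :
    IntegrableOn (pcDensity N s y) (Set.Icc (-1) 1) ∧
    ∫ z in Set.Icc (-1:ℝ) 1, pcDensity N s y z ≤ (N + 2) * (s / N) := by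
  refine ⟨by simpa using (pc_integral N s y hy h0 hN (fun _ => 1) continuous_const).1, ?_⟩
  have := quad N hN0 s hs y hy h0 hN (fun _ => 1) continuous_const 1 0 (by simp) (by simp)
  simp only [one_mul, mul_one, Finset.sum_const, Finset.card_range, nsmul_eq_mul] at this
  have := (abs_le.1 this).1
  push_cast at this
  linarith

lemma e_bound (N : ℕ) (hN0 : 0 < N) (s : ℝ) (hs : 0 < s) (y : ℕ → ℝ)
    (hy : ∀ k < N, y k < y (k+1)) (h0 : y 0 = -1) (hN : y N = 1) (r : ℝ → ℝ)
    (Cr : ℝ) (hCr : ∀ y, |r y| ≤ Cr) :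
    ‖∫ z in Set.Icc (-1:ℝ) 1, |pcDensity N s y z - r z|‖ ≤ (N + 2) * (s / N) + 2 * Cr := by
  have hm := pc_mass N hN0 s hs y hy h0 hN
  have i4 : IntegrableOn (fun _ : ℝ => Cr) (Set.Icc (-1:ℝ) 1) :=
    continuous_const.continuousOn.integrableOn_compact isCompact_Icc
  have hb := norm_integral_le_of_norm_le (μ := volume.restrict (Set.Icc (-1:ℝ) 1))
    (f := fun z => |pcDensity N s y z - r z|) (hm.1.add i4) (by
      refine Eventually.of_forall fun z => ?_
      rw [Real.norm_eq_abs, abs_abs]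
      refine (abs_sub _ _).trans ?_
      rw [abs_of_nonneg (pc_nonneg N s hs y hy z)]
      simp only [Pi.add_apply]
      linarith [hCr z])
  refine hb.trans ?_
  simp only [Pi.add_apply]
  rw [integral_add hm.1 i4, setIntegral_const]
  simp only [Measure.real, Real.volume_Icc, smul_eq_mul]
  rw [ENNReal.toReal_ofReal (by norm_num)]
  linarith [hm.2]

end S13


/-- Lemma 3.9, claim (eq:convdiff): convergence of the nonlocal
diffusion term. Under `L¹(Ω_T)` convergence of the piecewise constant densities, uniform
convergence of the nodes, and time-integrated `1`-Wasserstein convergence of the empirical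
measures, the discrete nonlocal diffusion term converges to the continuous one against any
test function `ζ ∈ C_c^∞((0,T)×(−1,1))`. -/
theorem stmt13
    (M d : ℕ) (hM : 1 ≤ M) (T : ℝ) (hT : 0 < T)
    (σ : Fin M → ℝ) (hσ : ∀ i, 0 < σ i)
    (A K A₁ : Fin M → Fin M → ℝ → ℝ → ℝ → ℝ)
    (cA c1A cK CK : ℝ) (hcK : 0 < cK)
    (hA_nonneg : ∀ i j x y c, 0 ≤ A i j x y c)
    (hA_deriv : ∀ i j y c x₀, HasDerivAt (fun s => A i j s y c) (A₁ i j x₀ y c) x₀)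
    (hA_lip : ∀ i j x x' y y' c, |A i j x' y' c - A i j x y c| ≤ cA * (|x' - x| + |y' - y|))
    (hA1_lip : ∀ i j x y y' c, |A₁ i j x y' c - A₁ i j x y c| ≤ c1A * |y' - y|)
    -- additional assumption: ∂₁A jointly continuous and bounded
    (hA1_cont : ∀ i j, Continuous (fun p : ℝ × ℝ × ℝ => A₁ i j p.1 p.2.1 p.2.2))
    (hA1_bdd : ∃ CA1 : ℝ, ∀ i j x y c, |A₁ i j x y c| ≤ CA1)
    (hK_bdd : ∀ i j x y c, |K i j x y c| ≤ CK)
    (hK_cont : ∀ i j, Continuous (fun p : ℝ × ℝ × ℝ => K i j p.1 p.2.1 p.2.2))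
    (hK_lip : ∀ i j x x' y y' c, |K i j x' y' c - K i j x y c| ≤ cK * (|x' - x| + |y' - y|))
    (hK_diag : ∀ i x c, K i i x x c = 0)
    (Φ : Fin M → ℝ → ℝ)
    (hΦ_mono : ∀ i, MonotoneOn (Φ i) (Set.Ici 0))
    (hΦ_lip : ∀ i, ∃ L : NNReal, LipschitzOnWith L (Φ i) (Set.Ici 0))
    (hΦ0 : ∀ i, Φ i 0 = 0)
    (V : ℝ → ℝ → ℝ → EuclideanSpace ℝ (Fin d))
    (hV_C1 : ContDiff ℝ 1 (fun p : ℝ × ℝ × ℝ => V p.1 p.2.1 p.2.2))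
    (hV_bdd : ∃ CV, ∀ p q r, ‖V p q r‖ ≤ CV)
    -- for each n, a DPA solution with N = n + 2
    (x : ℕ → Fin M → ℕ → ℝ → ℝ) (a : ℕ → Fin M → ℝ → EuclideanSpace ℝ (Fin d))
    (hx0 : ∀ n i t, x n i 0 t = -1) (hxN : ∀ n i t, x n i (n+2) t = 1)
    (hx_order : ∀ n i k t, k < n+2 → t ∈ Set.Icc (0:ℝ) T → x n i k t < x n i (k+1) t)
    (hx_ode : ∀ n i k, 0 < k → k < n+2 → ∀ t ∈ Set.Icc (0:ℝ) T,
      HasDerivAt (x n i k)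
        (((∑ j, ∑ l ∈ Finset.range (n+3),
              (σ j / (n+2)) * A i j (x n i k t) (x n j l t) (dist (a n i t) (a n j t)))
            / (σ i / (n+2))) *
            (Φ i ((σ i / (n+2)) / (x n i k t - x n i (k-1) t)) -
             Φ i ((σ i / (n+2)) / (x n i (k+1) t - x n i k t)))
          + ∑ j, ∑ l ∈ Finset.range (n+3),
              (σ j / (n+2)) * K i j (x n i k t) (x n j l t) (dist (a n i t) (a n j t))) t)
    (ha_ode : ∀ n i, ∀ t ∈ Set.Icc (0:ℝ) T,
      HasDerivAt (a n i)
        (∑ j, V (((n:ℝ)+3)⁻¹ * ∑ k ∈ Finset.range (n+3), x n i k t)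
                (((n:ℝ)+3)⁻¹ * ∑ k ∈ Finset.range (n+3), x n j k t)
                (dist (a n i t) (a n j t))) t)
    -- limit objects and convergence hypotheses
    (ρ : Fin M → ℝ → ℝ → ℝ) (aL : Fin M → ℝ → EuclideanSpace ℝ (Fin d))
    (hρ_bdd : ∀ i, ∃ C : ℝ, ∀ t y, |ρ i t y| ≤ C)
    (hρ_int : ∀ i, IntegrableOn (Function.uncurry (ρ i))
      (Set.Icc (0:ℝ) T ×ˢ Set.Icc (-1:ℝ) 1))
    (hρ_supp : ∀ i t y, y ∉ Set.Icc (-1:ℝ) 1 → ρ i t y = 0)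
    (hconv : ∀ i, Tendsto (fun n : ℕ => ∫ t in Set.Icc (0:ℝ) T, ∫ y in Set.Icc (-1:ℝ) 1,
        |pcDensity (n+2) (σ i) (fun k => x n i k t) y - ρ i t y|) atTop (nhds 0))
    (haconv : ∀ j, TendstoUniformlyOn (fun n t => a n j t) (aL j) atTop (Set.Icc (0:ℝ) T))
    (hW1conv : ∀ j, Tendsto (fun n : ℕ => ∫ t in Set.Icc (0:ℝ) T,
        ∫ z in Set.Icc (0:ℝ) (σ j),
          |pseudoInvMeas (ENNReal.ofReal (σ j / (n+2)) •
              ∑ k ∈ Finset.range (n+3), Measure.dirac (x n j k t)) z -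
           pseudoInvFun (ρ j t) z|) atTop (nhds 0)) :
    ∀ i : Fin M, ∀ ζ : ℝ → ℝ → ℝ,
      ContDiff ℝ (⊤ : ℕ∞) (Function.uncurry ζ) →
      HasCompactSupport (Function.uncurry ζ) →
      tsupport (Function.uncurry ζ) ⊆ Set.Ioo (0:ℝ) T ×ˢ Set.Ioo (-1:ℝ) 1 →
      Tendsto (fun n : ℕ => ∫ t in Set.Icc (0:ℝ) T, ∫ y in Set.Icc (-1:ℝ) 1,
          Φ i (pcDensity (n+2) (σ i) (fun k => x n i k t) y) *
            (∑ j, ∑ l ∈ Finset.range (n+3),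
              (σ j / (n+2)) * A₁ i j y (x n j l t) (dist (a n i t) (a n j t))) *
            deriv (fun z => ζ t z) y)
        atTop
        (nhds (∫ t in Set.Icc (0:ℝ) T, ∫ y in Set.Icc (-1:ℝ) 1,
          Φ i (ρ i t y) *
            (∑ j, ∫ z in Set.Icc (-1:ℝ) 1,
              A₁ i j y z (dist (aL i t) (aL j t)) * ρ j t z) *
            deriv (fun z => ζ t z) y)) := by
  intro i ζ hζ _ _
  obtain ⟨CA, hCA⟩ := hA1_bdd
  obtain ⟨L, hL⟩ := hΦ_lip i
  choose Cρ hCρ using hρ_bdd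
  have hCA0 : 0 ≤ CA := (abs_nonneg _).trans (hCA i i 0 0 0)
  have hCρ0 : ∀ j, 0 ≤ Cρ j := fun j => (abs_nonneg _).trans (hCρ j 0 0)
  -- continuity
  have hxc : ∀ n j k, k ≤ n + 2 → ContinuousOn (x n j k) (Set.Icc 0 T) := by
    intro n j k hk
    rcases Nat.eq_zero_or_pos k with rfl | hk0
    · rw [show x n j 0 = fun _ => -1 from funext (hx0 n j)]; exact continuousOn_const
    rcases hk.lt_or_eq with h | rfl
    · exact fun t ht => (hx_ode n j k hk0 h t ht).continuousAt.continuousWithinAt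
    · rw [show x n j (n+2) = fun _ => 1 from funext (hxN n j)]; exact continuousOn_const
  have hac : ∀ n j, ContinuousOn (a n j) (Set.Icc 0 T) := fun n j t ht =>
    (ha_ode n j t ht).continuousAt.continuousWithinAt
  have haL : ∀ j, ContinuousOn (aL j) (Set.Icc 0 T) := fun j =>
    (haconv j).continuousOn (Frequently.of_forall fun n => hac n j)
  have hdLc : ∀ j, ContinuousOn (fun t => dist (aL i t) (aL j t)) (Set.Icc 0 T) := fun j =>
    continuous_dist.comp_continuousOn ((haL i).prodMk (haL j))
  have hdu : ∀ j, TendstoUniformlyOn (fun n t => dist (a n i t) (a n j t))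
      (fun t => dist (aL i t) (aL j t)) atTop (Set.Icc 0 T) := by
    intro j
    have h1 := haconv i
    have h2 := haconv j
    rw [Metric.tendstoUniformlyOn_iff] at h1 h2 ⊢
    intro ε hε
    filter_upwards [h1 (ε/2) (by positivity), h2 (ε/2) (by positivity)] with n g1 g2 t ht
    have := dist_dist_dist_le (aL i t) (aL j t) (a n i t) (a n j t)
    linarith [g1 t ht, g2 t ht]
  have hdR : ∀ j, ∃ R, ∀ t ∈ Set.Icc 0 T, |dist (aL i t) (aL j t)| ≤ R := fun j => by
    obtain ⟨R, hR⟩ := isCompact_Icc.exists_bound_of_continuousOn (hdLc j)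
    exact ⟨R, fun t ht => hR t ht⟩
  have hDc := S13.zeta_deriv ζ hζ
  obtain ⟨CD, hCD⟩ := (isCompact_Icc.prod isCompact_Icc :
    IsCompact (Set.Icc (0:ℝ) T ×ˢ Set.Icc (-1:ℝ) 1)).exists_bound_of_continuousOn hDc.continuousOn
  have hCD0 : 0 ≤ CD := (norm_nonneg _).trans (hCD (0, 0) ⟨⟨le_rfl, hT.le⟩, by simp⟩)
  -- measures
  set μ : Measure ℝ := volume.restrict (Set.Icc (0:ℝ) T) with hμ
  set ν : Measure ℝ := volume.restrict (Set.Icc (-1:ℝ) 1) with hν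
  have hprod : (volume : Measure (ℝ × ℝ)).restrict (Set.Icc (0:ℝ) T ×ˢ Set.Icc (-1:ℝ) 1) = μ.prod ν := by
    rw [hμ, hν, Measure.prod_restrict, Measure.volume_eq_prod]
  have hρm : ∀ j, AEStronglyMeasurable (Function.uncurry (ρ j)) (μ.prod ν) := fun j => by
    have := (hρ_int j).aestronglyMeasurable
    rwa [hprod] at this
  have hmemI : ∀ᵐ t ∂μ, t ∈ Set.Icc (0:ℝ) T := ae_restrict_mem measurableSet_Icc
  have hxm : ∀ n j k, k ≤ n + 2 → AEMeasurable (x n j k) μ := fun n j k hk =>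
    (hxc n j k hk).aemeasurable measurableSet_Icc
  have hpcm : ∀ n j, AEStronglyMeasurable
      (fun p : ℝ × ℝ => pcDensity (n+2) (σ j) (fun k => x n j k p.1) p.2) (μ.prod ν) := fun n j =>
    S13.pc_aesm (μ.prod ν) (n+2) (σ j) (fun k p => x n j k p.1) (fun p => p.2)
      (fun k hk => (hxm n j k hk).comp_fst) measurable_snd.aemeasurable
  have hord : ∀ n j, ∀ t ∈ Set.Icc (0:ℝ) T, ∀ k < n+2, x n j k t < x n j (k+1) t :=
    fun n j t ht k hk => hx_order n j k t hk ht
  -- error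
  set e : ℕ → Fin M → ℝ → ℝ := fun n j t =>
    ∫ y, |pcDensity (n+2) (σ j) (fun k => x n j k t) y - ρ j t y| ∂ν with he
  have he_int : ∀ n j, Integrable (e n j) μ := by
    intro n j
    have hm : AEStronglyMeasurable (e n j) μ :=
      ((hpcm n j).sub (hρm j)).norm.integral_prod_right'
    refine Integrable.of_bound hm (((n+2:ℕ) + 2) * (σ j / (n+2:ℕ)) + 2 * Cρ j) ?_
    filter_upwards [hmemI] with t ht
    exact S13.e_bound (n+2) (by omega) (σ j) (hσ j) _ (hord n j t ht) (hx0 n j t) (hxN n j t)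
      (ρ j t) (Cρ j) (hCρ j t)
  have hρsec : ∀ j, ∀ᵐ t ∂μ, Integrable (ρ j t) ν := by
    intro j
    filter_upwards [(hρm j).prodMk_left] with t ht
    exact Integrable.of_bound ht (Cρ j) (Eventually.of_forall fun y => hCρ j t y)
  have hρnn : ∀ᵐ p ∂(μ.prod ν), 0 ≤ ρ i p.1 p.2 := by
    have hnm : AEStronglyMeasurable (fun p : ℝ × ℝ => max (-ρ i p.1 p.2) 0) (μ.prod ν) :=
      (by fun_prop : Continuous (fun s : ℝ => max (-s) 0)).comp_aestronglyMeasurable (hρm i)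
    have hle : ∀ t y, max (-ρ i t y) 0 ≤ Cρ i := fun t y =>
      max_le ((neg_le_abs _).trans (hCρ i t y)) (hCρ0 i)
    have hni : Integrable (fun p : ℝ × ℝ => max (-ρ i p.1 p.2) 0) (μ.prod ν) :=
      Integrable.of_bound hnm (Cρ i) (Eventually.of_forall fun p => by
        rw [Real.norm_eq_abs, abs_of_nonneg (le_max_right _ _)]; exact hle _ _)
    have hz : ∫ p, max (-ρ i p.1 p.2) 0 ∂(μ.prod ν) = 0 := by
      refine le_antisymm ?_ (integral_nonneg fun p => le_max_right _ _)
      refine ge_of_tendsto (hconv i) (Eventually.of_forall fun n => ?_)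
      rw [integral_prod _ hni]
      refine integral_mono_ae hni.integral_prod_left (he_int n i) ?_
      filter_upwards [hmemI, hρsec i] with t ht hrt
      have hpc := (S13.pc_mass (n+2) (by omega) (σ i) (hσ i) _ (hord n i t ht) (hx0 n i t)
        (hxN n i t)).1
      refine integral_mono_of_nonneg (Eventually.of_forall fun y => le_max_right _ _)
        (hpc.sub hrt).abs (Eventually.of_forall fun y => ?_)
      have h0 := S13.pc_nonneg (n+2) (σ i) (hσ i) _ (hord n i t ht) y
      refine max_le ((?_ : _ ≤ _).trans (le_abs_self _)) (abs_nonneg _)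
      linarith
    have hz2 := (integral_eq_zero_iff_of_nonneg_ae (f := fun p : ℝ × ℝ => max (-ρ i p.1 p.2) 0)
      (Eventually.of_forall fun p => le_max_right _ _) hni).1 hz
    filter_upwards [hz2] with p hp
    have : -ρ i p.1 p.2 ≤ 0 := (le_max_left _ _).trans hp.le
    linarith
  -- mobilities
  set Bn : ℕ → ℝ → ℝ → ℝ := fun n t y => ∑ j, ∑ l ∈ Finset.range (n+3),
              (σ j / (n+2)) * A₁ i j y (x n j l t) (dist (a n i t) (a n j t)) with hBn
  set B : ℝ → ℝ → ℝ := fun t y => ∑ j, ∫ z, A₁ i j y z (dist (aL i t) (aL j t)) * ρ j t z ∂ν with hB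
  have hBnm : ∀ n, AEStronglyMeasurable (fun p : ℝ × ℝ => Bn n p.1 p.2) (μ.prod ν) := by
    intro n
    refine Finset.aestronglyMeasurable_fun_sum _ fun j _ => ?_
    refine Finset.aestronglyMeasurable_fun_sum _ fun l hl => ?_
    have hl' := Finset.mem_range.1 hl
    have hd : AEMeasurable (fun t => dist (a n i t) (a n j t)) μ :=
      (continuous_dist.comp_continuousOn ((hac n i).prodMk (hac n j))).aemeasurable measurableSet_Icc
    exact (((hA1_cont i j).measurable.comp_aemeasurable (measurable_snd.aemeasurable.prodMk
      ((hxm n j l (by omega)).comp_fst.prodMk hd.comp_fst))).const_mul _).aestronglyMeasurable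
  have hBm : AEStronglyMeasurable (fun p : ℝ × ℝ => B p.1 p.2) (μ.prod ν) := by
    refine Finset.aestronglyMeasurable_fun_sum _ fun j _ => ?_
    exact S13.B_aesm μ ν _ (hA1_cont i j) _ ((hdLc j).aemeasurable measurableSet_Icc) (ρ j) (hρm j)
  set CB : ℝ := ∑ j, 2 * σ j * CA with hCB
  have hBnb : ∀ n t y, |Bn n t y| ≤ CB := by
    intro n t y
    refine (Finset.abs_sum_le_sum_abs _ _).trans (Finset.sum_le_sum fun j _ => ?_)
    refine (Finset.abs_sum_le_sum_abs _ _).trans ?_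
    have hs := hσ j
    have h1 : ∀ l ∈ Finset.range (n+3), |σ j / (n+2) * A₁ i j y (x n j l t)
        (dist (a n i t) (a n j t))| ≤ σ j / (n+2) * CA := by
      intro l _
      rw [abs_mul, abs_of_pos (by positivity)]
      gcongr
      exact hCA _ _ _ _ _
    refine (Finset.sum_le_sum h1).trans ?_
    rw [Finset.sum_const, Finset.card_range, nsmul_eq_mul]
    push_cast
    have h2 : ((n:ℝ)+3) * (σ j / (n+2)) ≤ 2 * σ j := by
      rw [mul_div_assoc', div_le_iff₀ (by positivity)]
      nlinarith [(Nat.cast_nonneg n : (0:ℝ) ≤ n)]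
    nlinarith
  set CB' : ℝ := ∑ j, CA * Cρ j * 2 with hCB'
  have hBb : ∀ t y, |B t y| ≤ CB' := by
    intro t y
    refine (Finset.abs_sum_le_sum_abs _ _).trans (Finset.sum_le_sum fun j _ => ?_)
    have := norm_setIntegral_le_of_norm_le_const (μ := (volume : Measure ℝ))
      (s := Set.Icc (-1:ℝ) 1) (f := fun z => A₁ i j y z (dist (aL i t) (aL j t)) * ρ j t z)
      (C := CA * Cρ j) (by simp) (by
        intro z _
        rw [Real.norm_eq_abs, abs_mul]
        gcongr
        · exact hCA _ _ _ _ _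
        · exact hCρ j t z)
    simp only [Measure.real, Real.volume_Icc] at this
    rw [ENNReal.toReal_ofReal (by norm_num)] at this
    refine this.trans (le_of_eq (by norm_num))
  -- final
  set c2 : ℝ := 2 * (L * Cρ i * CD) with hc2
  have hc20 : 0 ≤ c2 := by have := hCρ0 i; positivity
  set c1 : ℝ := L * CB * CD with hc1
  set K0 : ℝ := 2 * c1A + CA with hK0
  refine S13.tendsto_of_le _ _ (c2 * T * ∑ j, 2 * Cρ j)
    (mul_nonneg (by positivity) (Finset.sum_nonneg fun j _ => by linarith [hCρ0 j]))
    (fun n => c1 * (∫ t, e n i t ∂μ) + c2 * ∑ j, (T * (σ j / (n+2) * K0) + CA * ∫ t, e n j t ∂μ))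
    ?_ ?_
  · have hN : Tendsto (fun n : ℕ => ((n:ℝ)+2)⁻¹) atTop (nhds 0) :=
      tendsto_inv_atTop_zero.comp (tendsto_atTop_add_const_right _ _ tendsto_natCast_atTop_atTop)
    have hs : Tendsto (fun n : ℕ => ∑ j, (T * (σ j / (n+2) * K0) + CA * ∫ t, e n j t ∂μ)) atTop
        (nhds (∑ _j : Fin M, 0)) := by
      refine tendsto_finsetSum _ fun j _ => ?_
      have h1 := (hN.const_mul (T * σ j * K0)).add ((hconv j).const_mul CA)
      simp only [mul_zero, add_zero] at h1
      refine h1.congr fun n => ?_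
      simp only [he, hν, hμ]
      ring
    have := ((hconv i).const_mul c1).add (hs.const_mul c2)
    simpa using this
  intro ε hε
  have hunif : ∀ᶠ n in atTop, ∀ j, ∀ t ∈ Set.Icc 0 T, ∀ y ∈ Set.Icc (-1:ℝ) 1,
      ∀ z ∈ Set.Icc (-1:ℝ) 1, |A₁ i j y z (dist (a n i t) (a n j t)) -
        A₁ i j y z (dist (aL i t) (aL j t))| ≤ ε := by
    rw [eventually_all]
    intro j
    obtain ⟨R, hR⟩ := hdR j
    exact S13.unif_A (Set.Icc 0 T) _ (hA1_cont i j) _ _ R hR (hdu j) ε hε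
  filter_upwards [hunif] with n hn
  have hAc : ∀ j y c, Continuous (fun z => A₁ i j y z c) := fun j y c =>
    (hA1_cont i j).comp (by fun_prop : Continuous (fun z : ℝ => (y, z, c)))
  have hpt : ∀ᵐ t ∂μ, ‖(∫ y, Φ i (pcDensity (n+2) (σ i) (fun k => x n i k t) y) * Bn n t y *
        deriv (fun z => ζ t z) y ∂ν) - ∫ y, Φ i (ρ i t y) * B t y * deriv (fun z => ζ t z) y ∂ν‖ ≤
      c1 * e n i t + c2 * ∑ j, ((σ j / (n+2) * K0 + CA * e n j t) + 2 * Cρ j * ε) := by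
    filter_upwards [hmemI, eventually_all.2 hρsec, Measure.ae_ae_of_ae_prod hρnn,
      (hBnm n).prodMk_left, hBm.prodMk_left] with t ht hrt hr0 hb1 hb2
    have hBd : ∀ y ∈ Set.Icc (-1:ℝ) 1, |Bn n t y - B t y| ≤
        ∑ j, ((σ j / (n+2) * K0 + CA * e n j t) + 2 * Cρ j * ε) := by
      intro y hy
      simp only [hBn, hB]
      rw [← Finset.sum_sub_distrib]
      refine (Finset.abs_sum_le_sum_abs _ _).trans (Finset.sum_le_sum fun j _ => ?_)
      have := S13.B_diff (n+2) (by omega) (σ j) (hσ j) (fun k => x n j k t) (hord n j t ht)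
        (hx0 n j t) (hxN n j t) (fun z => A₁ i j y z (dist (a n i t) (a n j t)))
        (fun z => A₁ i j y z (dist (aL i t) (aL j t))) (hAc _ _ _) (hAc _ _ _) CA c1A
        (fun z => hCA _ _ _ _ _) (fun z z' => hA1_lip _ _ _ _ _ _) (ρ j t) (hrt j) (Cρ j) (hCρ j t)
        ε (fun z hz => hn j t ht y hy z hz)
      push_cast at this
      exact this
    exact S13.per_t (Φ i) L hL (hΦ0 i) _ (ρ i t) (Bn n t) (B t) (fun y => deriv (fun z => ζ t z) y)
      (Cρ i) CB CB' CD _ ((abs_nonneg _).trans (hBd 0 (by simp)))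
      (S13.pc_nonneg (n+2) (σ i) (hσ i) _ (hord n i t ht))
      (S13.pc_mass (n+2) (by omega) (σ i) (hσ i) _ (hord n i t ht) (hx0 n i t) (hxN n i t)).1
      hr0 (hrt i) (hCρ i t) hb1 hb2
      (hDc.comp (by fun_prop : Continuous (fun y : ℝ => (t, y)))).aestronglyMeasurable
      (hBnb n t) (hBb t) hBd (fun y hy => hCD (t, y) ⟨ht, hy⟩)
  have hDm : AEStronglyMeasurable (fun p : ℝ × ℝ => deriv (fun z => ζ p.1 z) p.2) (μ.prod ν) :=
    hDc.aestronglyMeasurable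
  have hpcnn : ∀ᵐ p ∂(μ.prod ν), 0 ≤ pcDensity (n+2) (σ i) (fun k => x n i k p.1) p.2 := by
    have : ∀ᵐ p ∂(μ.prod ν), p.1 ∈ Set.Icc (0:ℝ) T :=
      Measure.quasiMeasurePreserving_fst.ae hmemI
    filter_upwards [this] with p hp
    exact S13.pc_nonneg (n+2) (σ i) (hσ i) _ (hord n i _ hp) _
  have hFnm : AEStronglyMeasurable (fun t => ∫ y, Φ i (pcDensity (n+2) (σ i) (fun k => x n i k t) y) *
      Bn n t y * deriv (fun z => ζ t z) y ∂ν) μ :=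
    (((S13.phi_aesm _ (Φ i) L hL _ (hpcm n i) hpcnn).mul (hBnm n)).mul hDm).integral_prod_right'
  have hGm : AEStronglyMeasurable (fun p : ℝ × ℝ => Φ i (ρ i p.1 p.2) * B p.1 p.2 *
      deriv (fun z => ζ p.1 z) p.2) (μ.prod ν) :=
    ((S13.phi_aesm _ (Φ i) L hL _ (hρm i) hρnn).mul hBm).mul hDm
  have hFi : Integrable (fun t => ∫ y, Φ i (ρ i t y) * B t y * deriv (fun z => ζ t z) y ∂ν) μ := by
    have hmem2 : ∀ᵐ p ∂(μ.prod ν), p ∈ Set.Icc (0:ℝ) T ×ˢ Set.Icc (-1:ℝ) 1 := by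
      rw [← hprod]; exact ae_restrict_mem (measurableSet_Icc.prod measurableSet_Icc)
    refine (Integrable.of_bound hGm (L * Cρ i * CB' * CD) ?_).integral_prod_left
    filter_upwards [hmem2, hρnn] with p hp hp0
    rw [norm_mul, norm_mul]
    have h1 : ‖Φ i (ρ i p.1 p.2)‖ ≤ L * Cρ i := by
      have := hL.dist_le_mul _ (Set.mem_Ici.2 hp0) 0 (Set.mem_Ici.2 le_rfl)
      rw [hΦ0 i, dist_zero_right, dist_zero_right] at this
      exact this.trans (by gcongr; exact hCρ i _ _)
    have h2 : ‖B p.1 p.2‖ ≤ CB' := hBb _ _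
    have h3 := hCD p hp
    have := hCρ0 i
    have h4 : 0 ≤ CB' := (norm_nonneg _).trans h2
    gcongr
  have hji : ∀ j, Integrable (fun t => (σ j / (n+2) * K0 + CA * e n j t) + 2 * Cρ j * ε) μ := fun j =>
      ((integrable_const _).add ((he_int n j).const_mul CA)).add (integrable_const _)
  have hsi : Integrable (fun t => ∑ j, ((σ j / (n+2) * K0 + CA * e n j t) + 2 * Cρ j * ε)) μ :=
    integrable_finsetSum _ fun j _ => hji j
  have hgi : Integrable (fun t => c1 * e n i t + c2 * ∑ j, ((σ j / (n+2) * K0 + CA * e n j t)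
      + 2 * Cρ j * ε)) μ := ((he_int n i).const_mul c1).add (hsi.const_mul c2)
  have hdi := Integrable.mono' hgi (hFnm.sub hFi.aestronglyMeasurable) hpt
  have hFni : Integrable (fun t => ∫ y, Φ i (pcDensity (n+2) (σ i) (fun k => x n i k t) y) *
      Bn n t y * deriv (fun z => ζ t z) y ∂ν) μ := by
    refine (hdi.add hFi).congr (Eventually.of_forall fun t => ?_)
    simp
  have hfin := norm_integral_le_of_norm_le hgi hpt
  rw [integral_sub hFni hFi, Real.norm_eq_abs] at hfin
  refine hfin.trans (le_of_eq ?_)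
  have hT' : μ.real Set.univ = T := by
    simp [hμ, Measure.real, hT.le]
  rw [integral_add ((he_int n i).const_mul c1) (hsi.const_mul c2), integral_const_mul,
    integral_const_mul, integral_finsetSum _ fun j _ => hji j]
  have hj : ∀ j, ∫ t, ((σ j / (n+2) * K0 + CA * e n j t) + 2 * Cρ j * ε) ∂μ =
      (T * (σ j / (n+2) * K0) + CA * ∫ t, e n j t ∂μ) + T * ε * (2 * Cρ j) := by
    intro j
    have hq : Integrable (fun t => σ j / (n+2) * K0 + CA * e n j t) μ :=
      (integrable_const _).add ((he_int n j).const_mul CA)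
    rw [integral_add hq (integrable_const _),
      integral_add (integrable_const _) ((he_int n j).const_mul CA), integral_const_mul CA,
      integral_const, integral_const, hT', smul_eq_mul, smul_eq_mul]
    ring
  simp only [hj]
  rw [Finset.sum_add_distrib, ← Finset.mul_sum]
  ring
end

section
/- For each N ≥ 2 let (x_k^{i,N}, a_N^i) be a C¹ solution of the DPA system on [0,T] with ordered particles, let ρ^{i,N} be the piecewise constant densities and ρ̃^{i,N}(t) = σ_N^i Σ_{k=0}^N δ_{x_k^{i,N}(t)} the empirical measures. Suppose ρ^{i,N} → ρ^i in L¹(Ω_T) with ρ^i ∈ L¹∩L^∞(Ω_T), a_N^j → a^j uniformly on [0,T] for all j, and ∫_0^T d_{W¹}(ρ̃^{j,N}(t,·), ρ^j(t,·)) dt → 0 for all j. Then for every ζ ∈ C_c^∞((0,T)×(−1,1)), ∫_{Ω_T} ρ^{i,N}(t,x) θ^i(ρ̃^N, a_N; x) ∂_x ζ(t,x) dx dt → ∫_{Ω_T} ρ^i(t,x) θ^i(ρ, a; x) ∂_x ζ(t,x) dx dt as N → ∞, where for a vector of finite measures or densities ρ = (ρ^1,…,ρ^M) on Ω and nodes a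 = (a^1,…,a^M) ∈ (ℝ^d)^M with a^{ij} = |a^i − a^j|, the nonlocal transport operator is θ^i(ρ, a; x) = Σ_j ∫_Ω K^{ij}(x,y,a^{ij}) dρ^j(y). -/
open MeasureTheory Filter

lemma aux_mem (N : ℕ) (X : ℕ → ℝ) (h0 : X 0 = -1) (hN : X N = 1)
    (hX : ∀ k, k < N → X k < X (k+1)) (k : ℕ) (hk : k ≤ N) : X k ∈ Set.Icc (-1:ℝ) 1 := by
  constructor
  · induction k with
    | zero => exact h0.ge
    | succ k ih => exact (ih (by omega)).trans (hX k (by omega)).le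
  · induction hk using Nat.decreasingInduction with
    | self => exact hN.le
    | of_succ k hk ih => exact (hX k hk).le.trans ih

lemma aux_integral (N : ℕ) (s : ℝ) (X : ℕ → ℝ) (h0 : X 0 = -1) (hN : X N = 1)
    (hX : ∀ k, k < N → X k < X (k+1)) (f : ℝ → ℝ) (hf : Continuous f) :
    IntegrableOn (fun z => f z * pcDensity N s X z) (Set.Icc (-1) 1) ∧
    ∫ z in Set.Icc (-1:ℝ) 1, f z * pcDensity N s X z =
      ∑ k ∈ Finset.range N, ((s / N) / (X (k+1) - X k)) * ∫ z in (X k)..(X (k+1)), f z := by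
  have hmem := aux_mem N X h0 hN hX
  have hrw : (fun z => f z * pcDensity N s X z) = fun z => ∑ k ∈ Finset.range N,
      Set.indicator (Set.Ico (X k) (X (k+1)))
        (fun z => ((s / N) / (X (k+1) - X k)) * f z) z := by
    funext z
    unfold pcDensity
    rw [Finset.mul_sum]
    refine Finset.sum_congr rfl fun k _ => ?_
    by_cases h : z ∈ Set.Ico (X k) (X (k+1)) <;> simp [h, mul_comm]
  have hint : ∀ k ∈ Finset.range N, Integrable (Set.indicator (Set.Ico (X k) (X (k+1)))
        (fun z => ((s / N) / (X (k+1) - X k)) * f z)) (volume.restrict (Set.Icc (-1) 1)) := by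
    intro k _
    refine Integrable.indicator ?_ measurableSet_Ico
    exact (Continuous.integrableOn_Icc (by fun_prop))
  rw [hrw]
  refine ⟨integrable_finsetSum _ hint, ?_⟩
  rw [integral_finsetSum _ hint]
  refine Finset.sum_congr rfl fun k hk => ?_
  have hk := Finset.mem_range.1 hk
  have hsub : Set.Ico (X k) (X (k+1)) ⊆ Set.Icc (-1) 1 :=
    fun z hz => ⟨(hmem k (by omega)).1.trans hz.1, hz.2.le.trans (hmem (k+1) (by omega)).2⟩
  rw [setIntegral_indicator measurableSet_Ico, Set.inter_eq_right.2 hsub,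
    integral_const_mul, integral_Ico_eq_integral_Ioc, intervalIntegral.integral_of_le (hX k hk).le]

lemma aux_nonneg (N : ℕ) (s : ℝ) (hs : 0 ≤ s) (X : ℕ → ℝ) 
    (hX : ∀ k, k < N → X k < X (k+1)) (z : ℝ) : 0 ≤ pcDensity N s X z := by
  refine Finset.sum_nonneg fun k hk => Set.indicator_nonneg (fun _ _ => ?_) _
  have := hX k (Finset.mem_range.1 hk)
  exact div_nonneg (by positivity) (by linarith)

lemma aux_mass (N : ℕ) (hN0 : 0 < N) (s : ℝ) (X : ℕ → ℝ) (h0 : X 0 = -1) (hN : X N = 1)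
    (hX : ∀ k, k < N → X k < X (k+1)) :
    IntegrableOn (pcDensity N s X) (Set.Icc (-1) 1) ∧
    ∫ z in Set.Icc (-1:ℝ) 1, pcDensity N s X z = s := by
  obtain ⟨h1, h2⟩ := aux_integral N s X h0 hN hX (fun _ => 1) continuous_const
  simp only [one_mul] at h1 h2
  refine ⟨h1, h2.trans ?_⟩
  have : ∀ k ∈ Finset.range N, (s / N) / (X (k+1) - X k) * ∫ z in (X k)..(X (k+1)), (1:ℝ)
      = s / N := by
    intro k hk
    have := hX k (Finset.mem_range.1 hk)
    have h3 : X (k+1) - X k ≠ 0 := by linarith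
    simp
    field_simp
  rw [Finset.sum_congr rfl this]
  simp
  field_simp

lemma aux_est (N : ℕ) (s : ℝ) (hs : 0 ≤ s) (X : ℕ → ℝ) (h0 : X 0 = -1) (hN : X N = 1)
    (hX : ∀ k, k < N → X k < X (k+1)) (f : ℝ → ℝ) (hf : Continuous f) (C c : ℝ)
    (hc : 0 ≤ c)
    (hC : ∀ z, |f z| ≤ C) (hl : ∀ z z', |f z' - f z| ≤ c * |z' - z|) :
    |∑ l ∈ Finset.range (N+1), s / N * f (X l) -
      ∫ z in Set.Icc (-1:ℝ) 1, f z * pcDensity N s X z| ≤ s / N * (C + 2 * c) := by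
  rw [(aux_integral N s X h0 hN hX f hf).2, Finset.sum_range_succ]
  have hsN : 0 ≤ s / N := by positivity
  have key : ∀ k ∈ Finset.range N, |s / N * f (X k) -
      ((s / N) / (X (k+1) - X k)) * ∫ z in (X k)..(X (k+1)), f z| ≤
      s / N * c * (X (k+1) - X k) := by
    intro k hk
    have h := hX k (Finset.mem_range.1 hk)
    have h3 : 0 < X (k+1) - X k := by linarith
    have e : s / N * f (X k) - ((s / N) / (X (k+1) - X k)) * ∫ z in (X k)..(X (k+1)), f z
        = ((s / N) / (X (k+1) - X k)) * ∫ z in (X k)..(X (k+1)), (f (X k) - f z) := by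
      rw [intervalIntegral.integral_sub (by simp) (hf.intervalIntegrable _ _)]
      simp
      field_simp
    rw [e, abs_mul, abs_of_nonneg (by positivity)]
    have : ‖∫ z in (X k)..(X (k+1)), (f (X k) - f z)‖ ≤
        (c * (X (k+1) - X k)) * |X (k+1) - X k| := by
      refine intervalIntegral.norm_integral_le_of_norm_le_const fun z hz => ?_
      rw [Set.uIoc_of_le h.le] at hz
      refine (hl z (X k)).trans ?_
      gcongr
      rw [abs_sub_comm, abs_of_nonneg (by linarith [hz.1])]
      linarith [hz.2]
    rw [abs_of_pos h3, Real.norm_eq_abs] at this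
    calc _ ≤ (s / N) / (X (k+1) - X k) * ((c * (X (k+1) - X k)) * (X (k+1) - X k)) := by gcongr
      _ = _ := by field_simp
  have hsum : |∑ k ∈ Finset.range N, (s / N * f (X k) -
      ((s / N) / (X (k+1) - X k)) * ∫ z in (X k)..(X (k+1)), f z)| ≤ s / N * c * 2 := by
    refine (Finset.abs_sum_le_sum_abs _ _).trans ((Finset.sum_le_sum key).trans ?_)
    rw [← Finset.mul_sum, Finset.sum_range_sub, h0, hN]
    norm_num
  rw [Finset.sum_sub_distrib] at hsum
  have hlast : |s / N * f (X N)| ≤ s / N * C := by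
    rw [abs_mul, abs_of_nonneg hsN]
    exact mul_le_mul_of_nonneg_left (hC _) hsN
  rw [abs_le] at *
  constructor <;> nlinarith

lemma aux_unif {α : Type*} (S : Set α) (f : ℕ → α → ℝ) (B : ℝ) (hS : S.Nonempty)
    (hB : ∀ n, ∀ p ∈ S, |f n p| ≤ B)
    (h : ∀ ε > 0, ∀ᶠ n in atTop, ∀ p ∈ S, |f n p| ≤ ε) :
    ∃ e : ℕ → ℝ, Tendsto e atTop (nhds 0) ∧ ∀ n, ∀ p ∈ S, |f n p| ≤ e n := by
  have hb : ∀ n, BddAbove ((fun p => |f n p|) '' S) := fun n =>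
    ⟨B, by rintro _ ⟨p, hp, rfl⟩; exact hB n p hp⟩
  have hle : ∀ n, ∀ p ∈ S, |f n p| ≤ sSup ((fun p => |f n p|) '' S) := fun n p hp =>
    le_csSup (hb n) ⟨p, hp, rfl⟩
  refine ⟨fun n => sSup ((fun p => |f n p|) '' S), ?_, hle⟩
  obtain ⟨p0, hp0⟩ := hS
  rw [Metric.tendsto_nhds]
  intro ε hε
  filter_upwards [h (ε/2) (by positivity)] with n hn
  have h1 : sSup ((fun p => |f n p|) '' S) ≤ ε / 2 := by
    refine csSup_le ⟨_, p0, hp0, rfl⟩ ?_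
    rintro _ ⟨p, hp, rfl⟩
    exact hn p hp
  have h2 := (abs_nonneg _).trans (hle n p0 hp0)
  rw [Real.dist_eq, sub_zero, abs_of_nonneg h2]
  linarith

lemma aux_K (Kf : ℝ → ℝ → ℝ → ℝ) (CK : ℝ) (hb : ∀ x y c, |Kf x y c| ≤ CK)
    (hc : Continuous (fun p : ℝ × ℝ × ℝ => Kf p.1 p.2.1 p.2.2)) (T : ℝ) (hT : 0 < T)
    (q : ℕ → ℝ → ℝ) (qL : ℝ → ℝ) (hq : ∀ n, ContinuousOn (q n) (Set.Icc 0 T))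
    (hu : TendstoUniformlyOn q qL atTop (Set.Icc 0 T)) :
    ∃ e : ℕ → ℝ, Tendsto e atTop (nhds 0) ∧ ∀ n, ∀ t ∈ Set.Icc 0 T,
      ∀ y ∈ Set.Icc (-1:ℝ) 1, ∀ z ∈ Set.Icc (-1:ℝ) 1,
        |Kf y z (q n t) - Kf y z (qL t)| ≤ e n := by
  have hqL : ContinuousOn qL (Set.Icc 0 T) := hu.continuousOn (Filter.Eventually.frequently (Eventually.of_forall hq))
  obtain ⟨R, hR⟩ := isCompact_Icc.exists_bound_of_continuousOn hqL
  have huc : UniformContinuousOn (fun p : ℝ × ℝ × ℝ => Kf p.1 p.2.1 p.2.2)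
      (Set.Icc (-1) 1 ×ˢ Set.Icc (-1) 1 ×ˢ Set.Icc (-R-1) (R+1)) :=
    (isCompact_Icc.prod (isCompact_Icc.prod isCompact_Icc)).uniformContinuousOn_of_continuous
      hc.continuousOn
  obtain ⟨e, he, h⟩ := aux_unif (Set.Icc 0 T ×ˢ Set.Icc (-1:ℝ) 1 ×ˢ Set.Icc (-1:ℝ) 1)
    (fun n p => Kf p.2.1 p.2.2 (q n p.1) - Kf p.2.1 p.2.2 (qL p.1)) (CK + CK)
    ⟨(0, 0, 0), by simp [hT.le]⟩
    (fun n p _ => (abs_sub _ _).trans (add_le_add (hb _ _ _) (hb _ _ _))) (by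
      intro ε hε
      obtain ⟨δ, hδ, hd⟩ := Metric.uniformContinuousOn_iff.1 huc ε hε
      filter_upwards [Metric.tendstoUniformlyOn_iff.1 hu (min δ 1) (by positivity)] with n hn
      rintro ⟨t, y, z⟩ ⟨ht, hy, hz⟩
      have h1 := hn t ht
      have h2 := hR t ht
      rw [Real.dist_eq] at h1
      rw [Real.norm_eq_abs] at h2
      have h3 := lt_min_iff.1 h1
      have h4 := abs_lt.1 h3.2
      have h5 := abs_le.1 h2
      have := hd (y, z, q n t) ⟨hy, hz, by constructor <;> linarith⟩ (y, z, qL t)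
        ⟨hy, hz, by constructor <;> linarith⟩
        (by simp [Prod.dist_eq, Real.dist_eq]; rw [abs_sub_comm]; exact h3.1)
      rw [Real.dist_eq] at this
      exact this.le)
  exact ⟨e, he, fun n t ht y hy z hz => h n (t, y, z) ⟨ht, hy, hz⟩⟩

lemma aux_zeta (ζ : ℝ → ℝ → ℝ) (h : ContDiff ℝ (⊤ : ℕ∞) (Function.uncurry ζ))
    (hs : HasCompactSupport (Function.uncurry ζ)) :
    Continuous (fun p : ℝ × ℝ => deriv (fun z => ζ p.1 z) p.2) ∧
    ∃ C, 0 ≤ C ∧ ∀ t y, |deriv (fun z => ζ t z) y| ≤ C := by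
  have hf : Continuous (fderiv ℝ (Function.uncurry ζ)) := h.continuous_fderiv (by simp)
  have e : ∀ t y, deriv (fun z => ζ t z) y = fderiv ℝ (Function.uncurry ζ) (t, y) (0, 1) := by
    intro t y
    have h1 : HasFDerivAt (Function.uncurry ζ) (fderiv ℝ (Function.uncurry ζ) (t, y)) (t, y) :=
      (h.differentiable (by simp) _).hasFDerivAt
    have h2 : HasDerivAt (fun z : ℝ => (t, z)) ((0:ℝ), (1:ℝ)) y :=
      (hasDerivAt_const y t).prodMk (hasDerivAt_id y)
    exact (h1.comp_hasDerivAt y h2).deriv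
  simp only [e]
  refine ⟨by fun_prop, ?_⟩
  obtain ⟨C, hC⟩ := (hs.fderiv ℝ).exists_bound_of_continuous hf
  have hC0 : 0 ≤ C := (norm_nonneg _).trans (hC 0)
  refine ⟨C, hC0, fun t y => ?_⟩
  refine ((fderiv ℝ (Function.uncurry ζ) (t, y)).le_opNorm (0, 1)).trans ?_
  have : ‖((0:ℝ), (1:ℝ))‖ = 1 := by simp [Prod.norm_def]
  rw [this, mul_one]
  exact hC _

lemma aux_pc_meas (N : ℕ) (s : ℝ) (X : ℕ → ℝ → ℝ) (μ ν : Measure ℝ) [SFinite μ] [SFinite ν]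
    (hX : ∀ k ≤ N, AEMeasurable (X k) μ) :
    AEMeasurable (fun p : ℝ × ℝ => pcDensity N s (fun k => X k p.1) p.2) (μ.prod ν) := by
  have hX' : ∀ k ≤ N, AEMeasurable (fun p : ℝ × ℝ => X k p.1) (μ.prod ν) := fun k hk =>
    (hX k hk).comp_quasiMeasurePreserving Measure.quasiMeasurePreserving_fst
  unfold pcDensity
  refine Finset.aemeasurable_fun_sum _ fun k hk => ?_
  have hk := Finset.mem_range.1 hk
  have h1 := hX' k hk.le
  have h2 := hX' (k+1) hk
  have e : (fun p : ℝ × ℝ => Set.indicator (Set.Ico (X k p.1) (X (k+1) p.1))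
      (fun _ => (s / N) / (X (k+1) p.1 - X k p.1)) p.2) =
      Set.indicator ({p : ℝ × ℝ | X k p.1 ≤ p.2} ∩ {p : ℝ × ℝ | p.2 < X (k+1) p.1})
        (fun p => (s / N) / (X (k+1) p.1 - X k p.1)) := by
    funext p
    simp only [Set.indicator, Set.mem_Ico, Set.mem_inter_iff, Set.mem_ofPred_eq]
  rw [e]
  refine AEMeasurable.indicator₀ ((aemeasurable_const).div (h2.sub h1)) ?_
  exact (nullMeasurableSet_le h1 measurable_snd.aemeasurable).inter
    (nullMeasurableSet_lt measurable_snd.aemeasurable h2)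

lemma aux_pc_int_s14 (N : ℕ) (hN0 : 0 < N) (s : ℝ) (hs : 0 ≤ s) (X : ℕ → ℝ → ℝ) (T : ℝ)
    (hX : ∀ k ≤ N, AEMeasurable (X k) (volume.restrict (Set.Icc 0 T)))
    (h0 : ∀ t, X 0 t = -1) (hN : ∀ t, X N t = 1)
    (ho : ∀ k t, k < N → t ∈ Set.Icc (0:ℝ) T → X k t < X (k+1) t) :
    Integrable (fun p : ℝ × ℝ => pcDensity N s (fun k => X k p.1) p.2)
      ((volume.restrict (Set.Icc 0 T)).prod (volume.restrict (Set.Icc (-1) 1))) := by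
  have hm := aux_pc_meas N s X (volume.restrict (Set.Icc 0 T)) (volume.restrict (Set.Icc (-1) 1)) hX
  have hae : ∀ᵐ t ∂(volume.restrict (Set.Icc 0 T)), t ∈ Set.Icc 0 T :=
    ae_restrict_mem measurableSet_Icc
  rw [integrable_prod_iff hm.aestronglyMeasurable]
  constructor
  · filter_upwards [hae] with t ht
    exact (aux_mass N hN0 s (fun k => X k t) (h0 t) (hN t) (fun k hk => ho k t hk ht)).1
  · refine (integrable_const s).congr ?_
    filter_upwards [hae] with t ht
    have h2 := (aux_mass N hN0 s (fun k => X k t) (h0 t) (hN t) (fun k hk => ho k t hk ht)).2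
    have h3 := aux_nonneg N s hs (fun k => X k t) (fun k hk => ho k t hk ht)
    simp only [Real.norm_eq_abs, abs_of_nonneg (h3 _)]
    exact h2.symm

lemma aux_theta (N : ℕ) (hN0 : 0 < N) (s : ℝ) (hs : 0 ≤ s) (X : ℕ → ℝ) (h0 : X 0 = -1)
    (hN : X N = 1)
    (hX : ∀ k, k < N → X k < X (k+1)) (f g : ℝ → ℝ) (hf : Continuous f) (hg : Continuous g)
    (C c : ℝ) (hc : 0 ≤ c)
    (hC : ∀ z, |f z| ≤ C) (hCg : ∀ z, |g z| ≤ C) (hl : ∀ z z', |f z' - f z| ≤ c * |z' - z|)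
    (e : ℝ) (he : ∀ z ∈ Set.Icc (-1:ℝ) 1, |f z - g z| ≤ e)
    (r : ℝ → ℝ) (D : ℝ) (hD : ∀ z, |r z| ≤ D) (hr : IntegrableOn r (Set.Icc (-1) 1)) :
    |∑ l ∈ Finset.range (N+1), s / N * f (X l) - ∫ z in Set.Icc (-1:ℝ) 1, g z * r z| ≤
      s / N * (C + 2 * c) + C * (∫ z in Set.Icc (-1:ℝ) 1, |pcDensity N s X z - r z|) +
        2 * (e * D) := by
  have h1 := aux_est N s hs X h0 hN hX f hf C c hc hC hl
  have hfp := (aux_integral N s X h0 hN hX f hf).1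
  have hp := (aux_mass N hN0 s X h0 hN hX).1
  have hfr : IntegrableOn (fun z => f z * r z) (Set.Icc (-1) 1) :=
    hr.bdd_mul hf.aestronglyMeasurable (Eventually.of_forall hC)
  have hgr : IntegrableOn (fun z => g z * r z) (Set.Icc (-1) 1) :=
    hr.bdd_mul hg.aestronglyMeasurable (Eventually.of_forall hCg)
  have h2 : |(∫ z in Set.Icc (-1:ℝ) 1, f z * pcDensity N s X z) -
      ∫ z in Set.Icc (-1:ℝ) 1, f z * r z| ≤
      C * (∫ z in Set.Icc (-1:ℝ) 1, |pcDensity N s X z - r z|) := by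
    rw [← integral_sub hfp hfr, ← integral_const_mul]
    refine norm_integral_le_of_norm_le
      (f := fun z => f z * pcDensity N s X z - f z * r z) ((hp.sub hr).abs.const_mul C)
      (Eventually.of_forall fun z => ?_)
    rw [← mul_sub, Real.norm_eq_abs, abs_mul]
    exact mul_le_mul_of_nonneg_right (hC z) (abs_nonneg _)
  have h3 : |(∫ z in Set.Icc (-1:ℝ) 1, f z * r z) - ∫ z in Set.Icc (-1:ℝ) 1, g z * r z| ≤
      2 * (e * D) := by
    rw [← integral_sub hfr hgr]
    have := norm_setIntegral_le_of_norm_le_const (μ := volume) (s := Set.Icc (-1:ℝ) 1)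
      (f := fun z => f z * r z - g z * r z) (C := e * D) (by simp) (fun z hz => by
        rw [← sub_mul, Real.norm_eq_abs, abs_mul]
        exact mul_le_mul (he z hz) (hD z) (abs_nonneg _) ((abs_nonneg _).trans (he z hz)))
    refine this.trans (le_of_eq ?_)
    rw [Real.volume_real_Icc_of_le (by norm_num)]
    ring
  rw [abs_le] at *
  constructor <;> linarith [h1.1, h1.2, h2.1, h2.2, h3.1, h3.2]

lemma aux_prod {p q θ θ' z C1 C2 D E : ℝ} (h1 : |θ| ≤ C1) (h2 : |z| ≤ C2) (h3 : |q| ≤ D)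
    (h4 : |θ - θ'| ≤ E) :
    |p * θ * z - q * θ' * z| ≤ C1 * C2 * |p - q| + D * C2 * E := by
  have e : p * θ * z - q * θ' * z = θ * z * (p - q) + q * z * (θ - θ') := by ring
  rw [e]
  refine (abs_add_le _ _).trans ?_
  simp only [abs_mul]
  have a1 := (abs_nonneg _).trans h1
  have a2 := (abs_nonneg _).trans h2
  have a3 := (abs_nonneg _).trans h3
  gcongr

lemma aux_int_s14 (μ ν : Measure ℝ) [IsFiniteMeasure μ] [IsFiniteMeasure ν] (g : ℝ → ℝ)
    (hg : Integrable g μ) (c1 c2 c3 : ℝ) :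
    ∫ p, (c1 + c2 * g p.1 + c3) ∂(μ.prod ν) =
      μ.real Set.univ * ν.real Set.univ * c1 + c2 * (ν.real Set.univ * ∫ t, g t ∂μ) +
      μ.real Set.univ * ν.real Set.univ * c3 := by
  have h1 : Integrable (fun p : ℝ × ℝ => c2 * g p.1) (μ.prod ν) := (hg.comp_fst ν).const_mul c2
  have h2 : Integrable (fun p : ℝ × ℝ => c1 + c2 * g p.1) (μ.prod ν) :=
    (integrable_const _).add h1
  have hu : (μ.prod ν).real Set.univ = μ.real Set.univ * ν.real Set.univ := by
    rw [← Set.univ_prod_univ, measureReal_prod_prod]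
  rw [integral_add h2 (integrable_const _), integral_add (integrable_const _) h1,
    integral_const_mul, integral_prod _ (hg.comp_fst ν)]
  simp only [integral_const, smul_eq_mul, hu, integral_const_mul]

/-- Lemma 3.9, claim (eq:convnon): convergence of the nonlocal transport
term. Under `L¹(Ω_T)` convergence of the piecewise constant densities, uniform convergence
of the nodes, and time-integrated `1`-Wasserstein convergence of the empirical measures,
the discrete nonlocal transport term converges to the continuous one against any test
function `ζ ∈ C_c^∞((0,T)×(−1,1))`. -/
theorem stmt14
    (M d : ℕ) (hM : 1 ≤ M) (T : ℝ) (hT : 0 < T)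
    (σ : Fin M → ℝ) (hσ : ∀ i, 0 < σ i)
    (A K A₁ : Fin M → Fin M → ℝ → ℝ → ℝ → ℝ)
    (cA c1A cK CK : ℝ) (hcK : 0 < cK)
    (hA_nonneg : ∀ i j x y c, 0 ≤ A i j x y c)
    (hA_deriv : ∀ i j y c x₀, HasDerivAt (fun s => A i j s y c) (A₁ i j x₀ y c) x₀)
    (hA_lip : ∀ i j x x' y y' c, |A i j x' y' c - A i j x y c| ≤ cA * (|x' - x| + |y' - y|))
    (hA1_lip : ∀ i j x y y' c, |A₁ i j x y' c - A₁ i j x y c| ≤ c1A * |y' - y|)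
    (hK_bdd : ∀ i j x y c, |K i j x y c| ≤ CK)
    (hK_cont : ∀ i j, Continuous (fun p : ℝ × ℝ × ℝ => K i j p.1 p.2.1 p.2.2))
    (hK_lip : ∀ i j x x' y y' c, |K i j x' y' c - K i j x y c| ≤ cK * (|x' - x| + |y' - y|))
    (hK_diag : ∀ i x c, K i i x x c = 0)
    (Φ : Fin M → ℝ → ℝ)
    (hΦ_mono : ∀ i, MonotoneOn (Φ i) (Set.Ici 0))
    (hΦ_lip : ∀ i, ∃ L : NNReal, LipschitzOnWith L (Φ i) (Set.Ici 0))
    (hΦ0 : ∀ i, Φ i 0 = 0)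
    (V : ℝ → ℝ → ℝ → EuclideanSpace ℝ (Fin d))
    (hV_C1 : ContDiff ℝ 1 (fun p : ℝ × ℝ × ℝ => V p.1 p.2.1 p.2.2))
    (hV_bdd : ∃ CV, ∀ p q r, ‖V p q r‖ ≤ CV)
    -- for each n, a DPA solution with N = n + 2
    (x : ℕ → Fin M → ℕ → ℝ → ℝ) (a : ℕ → Fin M → ℝ → EuclideanSpace ℝ (Fin d))
    (hx0 : ∀ n i t, x n i 0 t = -1) (hxN : ∀ n i t, x n i (n+2) t = 1)
    (hx_order : ∀ n i k t, k < n+2 → t ∈ Set.Icc (0:ℝ) T → x n i k t < x n i (k+1) t)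
    (hx_ode : ∀ n i k, 0 < k → k < n+2 → ∀ t ∈ Set.Icc (0:ℝ) T,
      HasDerivAt (x n i k)
        (((∑ j, ∑ l ∈ Finset.range (n+3),
              (σ j / (n+2)) * A i j (x n i k t) (x n j l t) (dist (a n i t) (a n j t)))
            / (σ i / (n+2))) *
            (Φ i ((σ i / (n+2)) / (x n i k t - x n i (k-1) t)) -
             Φ i ((σ i / (n+2)) / (x n i (k+1) t - x n i k t)))
          + ∑ j, ∑ l ∈ Finset.range (n+3),
              (σ j / (n+2)) * K i j (x n i k t) (x n j l t) (dist (a n i t) (a n j t))) t)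
    (ha_ode : ∀ n i, ∀ t ∈ Set.Icc (0:ℝ) T,
      HasDerivAt (a n i)
        (∑ j, V (((n:ℝ)+3)⁻¹ * ∑ k ∈ Finset.range (n+3), x n i k t)
                (((n:ℝ)+3)⁻¹ * ∑ k ∈ Finset.range (n+3), x n j k t)
                (dist (a n i t) (a n j t))) t)
    -- limit objects and convergence hypotheses
    (ρ : Fin M → ℝ → ℝ → ℝ) (aL : Fin M → ℝ → EuclideanSpace ℝ (Fin d))
    (hρ_bdd : ∀ i, ∃ C : ℝ, ∀ t y, |ρ i t y| ≤ C)
    (hρ_int : ∀ i, IntegrableOn (Function.uncurry (ρ i))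
      (Set.Icc (0:ℝ) T ×ˢ Set.Icc (-1:ℝ) 1))
    (hρ_supp : ∀ i t y, y ∉ Set.Icc (-1:ℝ) 1 → ρ i t y = 0)
    (hconv : ∀ i, Tendsto (fun n : ℕ => ∫ t in Set.Icc (0:ℝ) T, ∫ y in Set.Icc (-1:ℝ) 1,
        |pcDensity (n+2) (σ i) (fun k => x n i k t) y - ρ i t y|) atTop (nhds 0))
    (haconv : ∀ j, TendstoUniformlyOn (fun n t => a n j t) (aL j) atTop (Set.Icc (0:ℝ) T))
    (hW1conv : ∀ j, Tendsto (fun n : ℕ => ∫ t in Set.Icc (0:ℝ) T,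
        ∫ z in Set.Icc (0:ℝ) (σ j),
          |pseudoInvMeas (ENNReal.ofReal (σ j / (n+2)) •
              ∑ k ∈ Finset.range (n+3), Measure.dirac (x n j k t)) z -
           pseudoInvFun (ρ j t) z|) atTop (nhds 0)) :
    ∀ i : Fin M, ∀ ζ : ℝ → ℝ → ℝ,
      ContDiff ℝ (⊤ : ℕ∞) (Function.uncurry ζ) →
      HasCompactSupport (Function.uncurry ζ) →
      tsupport (Function.uncurry ζ) ⊆ Set.Ioo (0:ℝ) T ×ˢ Set.Ioo (-1:ℝ) 1 →
      Tendsto (fun n : ℕ => ∫ t in Set.Icc (0:ℝ) T, ∫ y in Set.Icc (-1:ℝ) 1,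
          pcDensity (n+2) (σ i) (fun k => x n i k t) y *
            (∑ j, ∑ l ∈ Finset.range (n+3),
              (σ j / (n+2)) * K i j y (x n j l t) (dist (a n i t) (a n j t))) *
            deriv (fun z => ζ t z) y)
        atTop
        (nhds (∫ t in Set.Icc (0:ℝ) T, ∫ y in Set.Icc (-1:ℝ) 1,
          ρ i t y *
            (∑ j, ∫ z in Set.Icc (-1:ℝ) 1,
              K i j y z (dist (aL i t) (aL j t)) * ρ j t z) *
            deriv (fun z => ζ t z) y)) := by

  intro i ζ hζ1 hζ2 _
  obtain ⟨hZc, CZ, hCZ0, hZb⟩ := aux_zeta ζ hζ1 hζ2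
  set μ : Measure ℝ := volume.restrict (Set.Icc (0:ℝ) T) with hμ
  set ν : Measure ℝ := volume.restrict (Set.Icc (-1:ℝ) 1) with hν
  have hCK : 0 ≤ CK := (abs_nonneg _).trans (hK_bdd i i 0 0 0)
  choose D hD using hρ_bdd
  have hcast : ∀ n : ℕ, ((n + 2 : ℕ) : ℝ) = (n:ℝ) + 2 := fun n => by push_cast; ring
  -- continuity
  have hxc : ∀ n j k, k ≤ n + 2 → ContinuousOn (x n j k) (Set.Icc 0 T) := by
    intro n j k hk
    rcases Nat.eq_zero_or_pos k with rfl | h0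
    · exact (continuousOn_const (c := (-1:ℝ))).congr fun t _ => hx0 n j t
    rcases hk.lt_or_eq with h | rfl
    · exact fun t ht => (hx_ode n j k h0 h t ht).continuousAt.continuousWithinAt
    · exact (continuousOn_const (c := (1:ℝ))).congr fun t _ => hxN n j t
  have hac : ∀ n j, ContinuousOn (a n j) (Set.Icc 0 T) :=
    fun n j t ht => (ha_ode n j t ht).continuousAt.continuousWithinAt
  have haLc : ∀ j, ContinuousOn (aL j) (Set.Icc 0 T) := fun j =>
    (haconv j).continuousOn (Filter.Eventually.frequently (Eventually.of_forall fun n => hac n j))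
  have hxm : ∀ n j k, k ≤ n + 2 → AEMeasurable (x n j k) μ :=
    fun n j k hk => (hxc n j k hk).aemeasurable measurableSet_Icc
  have hqc : ∀ n j, ContinuousOn (fun t => dist (a n i t) (a n j t)) (Set.Icc 0 T) :=
    fun n j => continuous_dist.comp_continuousOn ((hac n i).prodMk (hac n j))
  have hqLc : ∀ j, ContinuousOn (fun t => dist (aL i t) (aL j t)) (Set.Icc 0 T) :=
    fun j => continuous_dist.comp_continuousOn ((haLc i).prodMk (haLc j))
  have hqu : ∀ j, TendstoUniformlyOn (fun n t => dist (a n i t) (a n j t))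
      (fun t => dist (aL i t) (aL j t)) atTop (Set.Icc 0 T) := by
    intro j
    rw [Metric.tendstoUniformlyOn_iff]
    intro ε hε
    filter_upwards [Metric.tendstoUniformlyOn_iff.1 (haconv i) (ε/2) (by positivity),
      Metric.tendstoUniformlyOn_iff.1 (haconv j) (ε/2) (by positivity)] with n h1 h2 t ht
    have := dist_dist_dist_le (aL i t) (aL j t) (a n i t) (a n j t)
    linarith [h1 t ht, h2 t ht]
  choose e he heb using fun j => aux_K (K i j) CK (hK_bdd i j) (hK_cont i j) T hT
    (fun n t => dist (a n i t) (a n j t)) (fun t => dist (aL i t) (aL j t))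
    (fun n => hqc n j) (hqu j)
  -- integrability
  have hpint : ∀ n j, Integrable (fun p : ℝ × ℝ =>
      pcDensity (n+2) (σ j) (fun k => x n j k p.1) p.2) (μ.prod ν) := fun n j =>
    aux_pc_int_s14 (n+2) (by omega) (σ j) (hσ j).le (x n j) T (hxm n j) (hx0 n j) (hxN n j)
      (hx_order n j)
  have hrint : ∀ j, Integrable (Function.uncurry (ρ j)) (μ.prod ν) := by
    intro j
    have := hρ_int j
    rwa [IntegrableOn, Measure.volume_eq_prod, ← Measure.prod_restrict] at this
  have hθm : ∀ n, AEStronglyMeasurable (fun p : ℝ × ℝ => ∑ j, ∑ l ∈ Finset.range (n+3),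
      (σ j / (n+2)) * K i j p.2 (x n j l p.1) (dist (a n i p.1) (a n j p.1))) (μ.prod ν) := by
    intro n
    refine AEMeasurable.aestronglyMeasurable ?_
    refine Finset.aemeasurable_fun_sum _ fun j _ => Finset.aemeasurable_fun_sum _ fun l hl => ?_
    refine AEMeasurable.const_mul ?_ _
    have h1 : AEMeasurable (fun p : ℝ × ℝ => x n j l p.1) (μ.prod ν) :=
      (hxm n j l (by have := Finset.mem_range.1 hl; omega)).comp_quasiMeasurePreserving
        Measure.quasiMeasurePreserving_fst
    have h2 : AEMeasurable (fun p : ℝ × ℝ => dist (a n i p.1) (a n j p.1)) (μ.prod ν) :=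
      ((hqc n j).aemeasurable measurableSet_Icc).comp_quasiMeasurePreserving
        Measure.quasiMeasurePreserving_fst
    exact (hK_cont i j).measurable.comp_aemeasurable
      (measurable_snd.aemeasurable.prodMk (h1.prodMk h2))
  have hθb : ∀ n t y, |∑ j, ∑ l ∈ Finset.range (n+3),
      (σ j / (n+2)) * K i j y (x n j l t) (dist (a n i t) (a n j t))| ≤ ∑ j, 2 * σ j * CK := by
    intro n t y
    refine (Finset.abs_sum_le_sum_abs _ _).trans (Finset.sum_le_sum fun j _ => ?_)
    have hn : (0:ℝ) < n + 2 := by positivity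
    calc _ ≤ ∑ l ∈ Finset.range (n+3), σ j / (n+2) * CK := by
          refine (Finset.abs_sum_le_sum_abs _ _).trans (Finset.sum_le_sum fun l _ => ?_)
          have : 0 ≤ σ j / (n+2) := div_nonneg (hσ j).le hn.le
          rw [abs_mul, abs_of_nonneg this]
          exact mul_le_mul_of_nonneg_left (hK_bdd _ _ _ _ _) this
      _ = ((n:ℝ)+3)/(n+2) * (σ j * CK) := by
          rw [Finset.sum_const, Finset.card_range, nsmul_eq_mul]; push_cast; ring
      _ ≤ 2 * (σ j * CK) := by
          refine mul_le_mul_of_nonneg_right ?_ (mul_nonneg (hσ j).le hCK)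
          rw [div_le_iff₀ hn]
          have : (0:ℝ) ≤ n := by positivity
          linarith
      _ = _ := by ring
  have hθLm : AEStronglyMeasurable (fun p : ℝ × ℝ => ∑ j, ∫ z,
      K i j p.2 z (dist (aL i p.1) (aL j p.1)) * ρ j p.1 z ∂ν) (μ.prod ν) := by
    refine Finset.aestronglyMeasurable_fun_sum _ fun j _ => ?_
    refine AEStronglyMeasurable.integral_prod_right' (μ := μ.prod ν) (ν := ν)
      (f := fun w : (ℝ × ℝ) × ℝ =>
        K i j w.1.2 w.2 (dist (aL i w.1.1) (aL j w.1.1)) * ρ j w.1.1 w.2) ?_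
    have hq : Measure.QuasiMeasurePreserving (Prod.map Prod.fst id : (ℝ × ℝ) × ℝ → ℝ × ℝ)
        ((μ.prod ν).prod ν) (μ.prod ν) :=
      MeasureTheory.QuasiMeasurePreserving.prodMap Measure.quasiMeasurePreserving_fst
        (Measure.QuasiMeasurePreserving.id ν)
    refine AEStronglyMeasurable.mul ?_
      ((hrint j).aestronglyMeasurable.comp_quasiMeasurePreserving hq)
    have hq1 : Measure.QuasiMeasurePreserving (fun w : (ℝ × ℝ) × ℝ => w.1.1)
        ((μ.prod ν).prod ν) μ := 
      Measure.quasiMeasurePreserving_fst.comp Measure.quasiMeasurePreserving_fst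
    have h2 : AEMeasurable (fun w : (ℝ × ℝ) × ℝ => dist (aL i w.1.1) (aL j w.1.1))
        ((μ.prod ν).prod ν) :=
      ((hqLc j).aemeasurable measurableSet_Icc).comp_quasiMeasurePreserving hq1
    refine AEMeasurable.aestronglyMeasurable ?_
    exact (hK_cont i j).measurable.comp_aemeasurable
      ((measurable_snd.comp measurable_fst).aemeasurable.prodMk
        (measurable_snd.aemeasurable.prodMk h2))
  have hθLb : ∀ t y, |∑ j, ∫ z, K i j y z (dist (aL i t) (aL j t)) * ρ j t z ∂ν| ≤
      ∑ j, CK * D j * 2 := by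
    intro t y
    refine (Finset.abs_sum_le_sum_abs _ _).trans (Finset.sum_le_sum fun j _ => ?_)
    have := norm_setIntegral_le_of_norm_le_const (μ := volume) (s := Set.Icc (-1:ℝ) 1)
      (f := fun z => K i j y z (dist (aL i t) (aL j t)) * ρ j t z) (C := CK * D j) (by simp)
      (fun z hz => by
        rw [Real.norm_eq_abs, abs_mul]
        exact mul_le_mul (hK_bdd _ _ _ _ _) (hD _ _ _) (abs_nonneg _) hCK)
    refine this.trans (le_of_eq ?_)
    rw [Real.volume_real_Icc_of_le (by norm_num)]
    ring
  have hFint : ∀ n, Integrable (fun p : ℝ × ℝ =>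
      pcDensity (n+2) (σ i) (fun k => x n i k p.1) p.2 *
        (∑ j, ∑ l ∈ Finset.range (n+3),
          (σ j / (n+2)) * K i j p.2 (x n j l p.1) (dist (a n i p.1) (a n j p.1))) *
        deriv (fun z => ζ p.1 z) p.2) (μ.prod ν) := fun n =>
    ((hpint n i).mul_bdd (hθm n) (Eventually.of_forall fun p => hθb n p.1 p.2)).mul_bdd
      hZc.aestronglyMeasurable (Eventually.of_forall fun p => hZb p.1 p.2)
  have hLint : Integrable (fun p : ℝ × ℝ => ρ i p.1 p.2 *
        (∑ j, ∫ z, K i j p.2 z (dist (aL i p.1) (aL j p.1)) * ρ j p.1 z ∂ν) *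
        deriv (fun z => ζ p.1 z) p.2) (μ.prod ν) :=
    ((hrint i).mul_bdd hθLm (Eventually.of_forall fun p => hθLb p.1 p.2)).mul_bdd
      hZc.aestronglyMeasurable (Eventually.of_forall fun p => hZb p.1 p.2)
  have hdint : ∀ n j, Integrable (fun p : ℝ × ℝ =>
      |pcDensity (n+2) (σ j) (fun k => x n j k p.1) p.2 - ρ j p.1 p.2|) (μ.prod ν) :=
    fun n j => ((hpint n j).sub (hrint j)).abs
  have hgint : ∀ n j, Integrable (fun t => ∫ y,
      |pcDensity (n+2) (σ j) (fun k => x n j k t) y - ρ j t y| ∂ν) μ :=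
    fun n j => (hdint n j).integral_prod_left
  -- pointwise bound
  set B : ℕ → ℝ × ℝ → ℝ := fun n p =>
    (∑ j, 2 * σ j * CK) * CZ *
      |pcDensity (n+2) (σ i) (fun k => x n i k p.1) p.2 - ρ i p.1 p.2| +
    D i * CZ * ∑ j, (σ j / (n+2) * (CK + 2 * cK) +
      CK * (∫ y, |pcDensity (n+2) (σ j) (fun k => x n j k p.1) y - ρ j p.1 y| ∂ν) +
      2 * (e j n * D j)) with hB
  have hsumint : ∀ n, ∀ j, Integrable (fun p : ℝ × ℝ => σ j / (n+2) * (CK + 2 * cK) +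
      CK * (∫ y, |pcDensity (n+2) (σ j) (fun k => x n j k p.1) y - ρ j p.1 y| ∂ν) +
      2 * (e j n * D j)) (μ.prod ν) := fun n j =>
    ((integrable_const _).add (((hgint n j).comp_fst ν).const_mul CK)).add (integrable_const _)
  have hBint : ∀ n, Integrable (B n) (μ.prod ν) := fun n =>
    ((hdint n i).const_mul _).add
      ((integrable_finsetSum _ fun j _ => hsumint n j).const_mul _)
  have hμr : μ.real Set.univ = T := by
    simp [hμ, Measure.real, hT.le]
  have hνr : ν.real Set.univ = 2 := by
    simp [hν, Measure.real]; norm_num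
  have hBval : ∀ n : ℕ, ∫ p, B n p ∂(μ.prod ν) =
      (∑ j, 2 * σ j * CK) * CZ *
        (∫ t, ∫ y, |pcDensity (n+2) (σ i) (fun k => x n i k t) y - ρ i t y| ∂ν ∂μ) +
      D i * CZ * ∑ j, (T * 2 * (σ j / (n+2) * (CK + 2 * cK)) +
        CK * (2 * ∫ t, ∫ y, |pcDensity (n+2) (σ j) (fun k => x n j k t) y - ρ j t y| ∂ν ∂μ) +
        T * 2 * (2 * (e j n * D j))) := by
    intro n
    rw [hB, integral_add ((hdint n i).const_mul _)
      ((integrable_finsetSum _ fun j _ => hsumint n j).const_mul _), integral_const_mul,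
      integral_const_mul, integral_finsetSum _ fun j _ => hsumint n j, integral_prod _ (hdint n i)]
    congr 2
    refine Finset.sum_congr rfl fun j _ => ?_
    rw [aux_int_s14 μ ν _ (hgint n j), hμr, hνr]
  have hB0 : Tendsto (fun n => ∫ p, B n p ∂(μ.prod ν)) atTop (nhds 0) := by
    simp only [hBval]
    have hN : ∀ j, Tendsto (fun n : ℕ => σ j / ((n:ℝ)+2)) atTop (nhds 0) := fun j =>
      tendsto_const_nhds.div_atTop
        (tendsto_atTop_add_const_right _ _ tendsto_natCast_atTop_atTop)
    have := ((hconv i).const_mul ((∑ j, 2 * σ j * CK) * CZ)).add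
      ((tendsto_finsetSum Finset.univ fun j _ =>
        ((((hN j).mul_const (CK + 2 * cK)).const_mul (T * 2)).add
          (((hconv j).const_mul 2).const_mul CK)).add
          ((((he j).mul_const (D j)).const_mul 2).const_mul (T * 2))).const_mul (D i * CZ))
    simpa using this
  have hslice : ∀ᵐ p ∂(μ.prod ν), (∀ j, Integrable (ρ j p.1) ν) := by
    have : ∀ᵐ t ∂μ, ∀ j, Integrable (ρ j t) ν :=
      ae_all_iff.2 fun j => (hrint j).prod_right_ae
    exact Measure.quasiMeasurePreserving_fst.ae this
  have hmem1 : ∀ᵐ p ∂(μ.prod ν), p.1 ∈ Set.Icc 0 T := 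
    Measure.quasiMeasurePreserving_fst.ae (ae_restrict_mem measurableSet_Icc)
  have hmem2 : ∀ᵐ p ∂(μ.prod ν), p.2 ∈ Set.Icc (-1:ℝ) 1 := 
    Measure.quasiMeasurePreserving_snd.ae (ae_restrict_mem measurableSet_Icc)
  rw [tendsto_iff_norm_sub_tendsto_zero]
  refine squeeze_zero (fun _ => norm_nonneg _) (fun n => ?_) hB0
  rw [← integral_prod _ (hFint n), ← integral_prod _ hLint, ← integral_sub (hFint n) hLint]
  refine norm_integral_le_of_norm_le (hBint n) ?_
  filter_upwards [hslice, hmem1, hmem2] with p hp1 hp2 hp3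
  refine aux_prod (hθb n p.1 p.2) (hZb p.1 p.2) (hD i p.1 p.2) ?_
  rw [← Finset.sum_sub_distrib]
  refine (Finset.abs_sum_le_sum_abs _ _).trans (Finset.sum_le_sum fun j _ => ?_)
  have hf : ∀ c, Continuous (fun z => K i j p.2 z c) := fun c =>
    (hK_cont i j).comp (by fun_prop : Continuous fun z : ℝ => (p.2, z, c))
  have := aux_theta (n+2) (by omega) (σ j) (hσ j).le (fun k => x n j k p.1) (hx0 n j _) (hxN n j _)
    (fun k hk => hx_order n j k p.1 hk hp2)
    (fun z => K i j p.2 z (dist (a n i p.1) (a n j p.1)))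
    (fun z => K i j p.2 z (dist (aL i p.1) (aL j p.1))) (hf _) (hf _) CK cK hcK.le
    (fun z => hK_bdd _ _ _ _ _) (fun z => hK_bdd _ _ _ _ _)
    (fun z z' => by simpa using hK_lip i j p.2 p.2 z z' (dist (a n i p.1) (a n j p.1)))
    (e j n) (fun z hz => heb j n p.1 hp2 p.2 hp3 z hz) (ρ j p.1) (D j) (hD j p.1) (hp1 j)
  rw [hcast] at this
  exact this
end

section
/- For each N ≥ 2 let (x_k^{i,N}, a_N^i) be a C¹ solution of the DPA system on [0,T] with ordered particles, built from initial data satisfying the standing assumptions, let ρ^{i,N} be the piecewise constant densities and ρ̃^{i,N}(t) = σ_N^i Σ_{k=0}^N δ_{x_k^{i,N}(t)} the empirical measures. Then for every i ∈ {1,…,M} and every test function ζ ∈ C_c^∞((0,T)×(−1,1)), the weak-formulation residual R_N(ζ) = ∫_{Ω_T} [ ρ^{i,N} ∂_t ζ + ρ^{i,N} θ^i(ρ̃^N, a_N; x) ∂_x ζ + Φ^i(ρ^{i,N}) ( ∂_x β^i(ρ̃^N, a_N; x) ∂_x ζ + β^i(ρ̃^N, a_N; x) ∂_{xx} ζ )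 ] dx dt converges to 0 as N → ∞, where β^i(ρ̃^N, a_N; x) = Σ_j ∫_Ω A^{ij}(x,y,a_N^{ij}) dρ̃^{j,N}(y), ∂_x β^i(ρ̃^N, a_N; x) = Σ_j ∫_Ω ∂₁A^{ij}(x,y,a_N^{ij}) dρ̃^{j,N}(y), and θ^i(ρ̃^N, a_N; x) = Σ_j ∫_Ω K^{ij}(x,y,a_N^{ij}) dρ̃^{j,N}(y). -/
open MeasureTheory Filter

lemma time_lemma (F g G : ℝ → ℝ) (T ε : ℝ) (hT : 0 < T)
    (hg : ∀ t ∈ Set.Icc (0:ℝ) T, HasDerivAt g (G t) t) (g0 : g 0 = 0) (gT : g T = 0)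
    (h : ∀ t ∈ Set.Icc (0:ℝ) T, |F t - G t| ≤ ε) :
    |∫ t in Set.Icc (0:ℝ) T, F t| ≤ ε * T := by
  have hε : 0 ≤ ε := (abs_nonneg _).trans (h 0 ⟨le_rfl, hT.le⟩)
  by_cases hF : IntegrableOn F (Set.Icc 0 T)
  · have hd : IntegrableOn (deriv g) (Set.Icc 0 T) := by
      have h1 : IntegrableOn (fun t => |F t| + ε) (Set.Icc 0 T) :=
        hF.abs.add (integrableOn_const (by simp))
      refine Integrable.mono' h1 (measurable_deriv g).aestronglyMeasurable ?_
      filter_upwards [ae_restrict_mem measurableSet_Icc] with t ht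
      rw [(hg t ht).deriv, Real.norm_eq_abs]
      have h2 := h t ht
      have h3 := abs_sub_abs_le_abs_sub (G t) (F t)
      rw [abs_sub_comm] at h3
      linarith
    have h0 : ∫ t in Set.Icc 0 T, deriv g t = 0 := by
      rw [integral_Icc_eq_integral_Ioc, ← intervalIntegral.integral_of_le hT.le,
        intervalIntegral.integral_eq_sub_of_hasDerivAt (f := g)]
      · rw [g0, gT]; simp
      · intro t ht
        rw [Set.uIcc_of_le hT.le] at ht
        have := hg t ht
        rwa [this.deriv]
      · rw [intervalIntegrable_iff_integrableOn_Icc_of_le hT.le]; exact hd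
    have h1 : ∫ t in Set.Icc 0 T, F t = ∫ t in Set.Icc 0 T, (F t - deriv g t) := by
      rw [integral_sub hF hd, h0, sub_zero]
    rw [h1]
    have := norm_setIntegral_le_of_norm_le_const (μ := volume) (s := Set.Icc 0 T) (C := ε)
      (f := fun t => F t - deriv g t) (by simp) (by
        intro t ht
        rw [(hg t ht).deriv]; exact h t ht)
    simpa [hT.le] using this
  · rw [integral_undef hF]; simp; positivity

lemma abel_lemma (φ b : ℕ → ℝ) (h0 : b 0 = 0) (n : ℕ) :
    ∑ k ∈ Finset.range n, φ k * (b (k+1) - b k)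
      = φ (n-1) * b n + ∑ k ∈ Finset.range n, b k * (φ (k-1) - φ k) := by
  induction n with
  | zero => simp [h0]
  | succ n ih => rw [Finset.sum_range_succ, Finset.sum_range_succ, ih]; simp; ring

lemma X_mono (N : ℕ) (X : ℕ → ℝ) (hX : ∀ k < N, X k < X (k+1)) :
    ∀ i j, i ≤ j → j ≤ N → X i ≤ X j := by
  intro i j hij
  induction j, hij using Nat.le_induction with
  | base => simp
  | succ j hj ih => intro h; exact (ih (by omega)).trans (hX j (by omega)).le

lemma pc_eq (N : ℕ) (σi : ℝ) (X : ℕ → ℝ) (hX : ∀ k < N, X k < X (k+1)) (k : ℕ) (hk : k < N)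
    (y : ℝ) (hy : y ∈ Set.Ico (X k) (X (k+1))) :
    pcDensity N σi X y = (σi / N) / (X (k+1) - X k) := by
  unfold pcDensity
  rw [Finset.sum_eq_single k]
  · rw [Set.indicator_of_mem hy]
  · intro j hj hjk
    rw [Finset.mem_range] at hj
    apply Set.indicator_of_notMem
    intro hy'
    rcases lt_or_gt_of_ne hjk with h | h
    · have := X_mono N X hX (j+1) k h hk.le
      linarith [hy.1, hy'.2]
    · have := X_mono N X hX (k+1) j h hj.le
      linarith [hy.2, hy'.1]
  · intro h; simp [hk] at h

lemma space_lemma (N : ℕ) (σi : ℝ) (hσ : 0 < σi) (X : ℕ → ℝ) (hX : ∀ k < N, X k < X (k+1))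
    (hX0 : X 0 = -1) (hXN : X N = 1) (Φ f b b' : ℝ → ℝ) (L : ℝ)
    (hf : Continuous f) (hfL : ∀ y z, |f y - f z| ≤ L * |y - z|)
    (hb : ∀ y, HasDerivAt b (b' y) y) (hb' : ∀ u v, IntervalIntegrable b' volume u v) :
    |(∫ y in Set.Icc (-1:ℝ) 1, (pcDensity N σi X y * f y + Φ (pcDensity N σi X y) * b' y))
      - ∑ k ∈ Finset.range N, (σi / N * f (X k)
          + Φ ((σi / N) / (X (k+1) - X k)) * (b (X (k+1)) - b (X k)))| ≤ σi / N * (L * 2) := by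
  set F : ℝ → ℝ := fun y => pcDensity N σi X y * f y + Φ (pcDensity N σi X y) * b' y with hF
  have hL : 0 ≤ L := by
    have := (abs_nonneg _).trans (hfL 1 0); simpa using this
  let F' : ℕ → ℝ → ℝ := fun k y => (σi / N) / (X (k+1) - X k) * f y
    + Φ ((σi / N) / (X (k+1) - X k)) * b' y
  have hfi : ∀ u v, IntervalIntegrable f volume u v := fun u v => hf.intervalIntegrable u v
  have hF'i : ∀ k u v, IntervalIntegrable (F' k) volume u v := fun k u v =>
    ((hfi u v).const_mul _).add ((hb' u v).const_mul _)
  have hae : ∀ k < N, ∀ᵐ y ∂volume, y ∈ Set.uIoc (X k) (X (k+1)) → F' k y = F y := by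
    intro k hk
    have : ∀ᵐ y ∂(volume : Measure ℝ), y ≠ X (k+1) := by
      simp [ae_iff]
    filter_upwards [this] with y hy hy'
    rw [Set.uIoc_of_le (hX k hk).le] at hy'
    have := pc_eq N σi X hX k hk y ⟨hy'.1.le, lt_of_le_of_ne hy'.2 hy⟩
    simp only [F', hF, this]
  have hFi : ∀ k < N, IntervalIntegrable F volume (X k) (X (k+1)) := by
    intro k hk
    refine (hF'i k _ _).congr_ae ?_
    exact (ae_restrict_iff' measurableSet_uIoc).2 (hae k hk)
  have hsum : ∫ y in Set.Icc (-1:ℝ) 1, F y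
      = ∑ k ∈ Finset.range N, ∫ y in (X k)..(X (k+1)), F y := by
    rw [intervalIntegral.sum_integral_adjacent_intervals hFi, hX0, hXN,
      integral_Icc_eq_integral_Ioc, ← intervalIntegral.integral_of_le (by norm_num)]
  have hcell : ∀ k < N, |(∫ y in (X k)..(X (k+1)), F y) - (σi / N * f (X k)
          + Φ ((σi / N) / (X (k+1) - X k)) * (b (X (k+1)) - b (X k)))|
          ≤ σi / N * L * (X (k+1) - X k) := by
    intro k hk
    have hlt := hX k hk
    have hd : 0 < X (k+1) - X k := by linarith
    have hN : (0:ℝ) < N := by exact_mod_cast (by omega : 0 < N)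
    rw [← intervalIntegral.integral_congr_ae (hae k hk)]
    simp only [F']
    rw [intervalIntegral.integral_add ((hfi _ _).const_mul _) ((hb' _ _).const_mul _),
      intervalIntegral.integral_const_mul, intervalIntegral.integral_const_mul,
      intervalIntegral.integral_eq_sub_of_hasDerivAt (f := b) (fun y _ => hb y) (hb' _ _)]
    have h1 : |(∫ y in (X k)..(X (k+1)), f y) - (X (k+1) - X k) * f (X k)|
        ≤ L * (X (k+1) - X k) * (X (k+1) - X k) := by
      have e : (∫ y in (X k)..(X (k+1)), f y) - (X (k+1) - X k) * f (X k)
          = ∫ y in (X k)..(X (k+1)), (f y - f (X k)) := by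
        rw [intervalIntegral.integral_sub (hfi _ _) (by simp)]; simp
      rw [e]
      have := intervalIntegral.norm_integral_le_of_norm_le_const (a := X k) (b := X (k+1))
        (f := fun y => f y - f (X k)) (C := L * (X (k+1) - X k)) (by
          intro y hy
          rw [Set.uIoc_of_le hlt.le] at hy
          refine (hfL y (X k)).trans ?_
          gcongr
          rw [abs_of_pos (by linarith [hy.1])]
          linarith [hy.2])
      rwa [abs_of_pos hd] at this
    have e2 : (σi / N) / (X (k+1) - X k) * (∫ y in (X k)..(X (k+1)), f y)
        + Φ ((σi / N) / (X (k+1) - X k)) * (b (X (k+1)) - b (X k))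
        - (σi / N * f (X k) + Φ ((σi / N) / (X (k+1) - X k)) * (b (X (k+1)) - b (X k)))
        = (σi / N) / (X (k+1) - X k) *
          ((∫ y in (X k)..(X (k+1)), f y) - (X (k+1) - X k) * f (X k)) := by
      field_simp; ring
    rw [e2, abs_mul, abs_of_pos (by positivity)]
    calc _ ≤ (σi / N) / (X (k+1) - X k) * (L * (X (k+1) - X k) * (X (k+1) - X k)) := by
            gcongr
      _ = _ := by field_simp
  rw [hsum, ← Finset.sum_sub_distrib]
  calc _ ≤ ∑ k ∈ Finset.range N, σi / N * L * (X (k+1) - X k) :=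
        (Finset.abs_sum_le_sum_abs _ _).trans
          (Finset.sum_le_sum fun k hk => hcell k (Finset.mem_range.1 hk))
    _ = σi / N * (L * 2) := by
        rw [← Finset.mul_sum, Finset.sum_range_sub, hX0, hXN]; ring

lemma test_lip (Z : ℝ × ℝ → ℝ) (h : ContDiff ℝ (⊤ : ℕ∞) Z) (hc : HasCompactSupport Z) :
    ∃ C : ℝ, 0 ≤ C ∧ (∀ p, |Z p| ≤ C) ∧ ∀ t y z, |Z (t, y) - Z (t, z)| ≤ C * |y - z| := by
  obtain ⟨C1, hC1⟩ := hc.exists_bound_of_continuous h.continuous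
  obtain ⟨C2, hC2⟩ := ContDiff.lipschitzWith_of_hasCompactSupport hc h (by simp)
  refine ⟨max C1 C2, le_max_of_le_right C2.2, fun p => (hC1 p).trans (le_max_left _ _), ?_⟩
  intro t y z
  have := hC2.dist_le_mul (t, y) (t, z)
  rw [Real.dist_eq, Prod.dist_eq] at this
  simp only [dist_self, Real.dist_eq] at this
  rw [max_eq_right (abs_nonneg _)] at this
  exact this.trans (by gcongr; exact le_max_right _ _)

lemma test_facts (T : ℝ) (ζ : ℝ → ℝ → ℝ)
    (h : ContDiff ℝ (⊤ : ℕ∞) (Function.uncurry ζ))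
    (hc : HasCompactSupport (Function.uncurry ζ))
    (hs : tsupport (Function.uncurry ζ) ⊆ Set.Ioo (0:ℝ) T ×ˢ Set.Ioo (-1:ℝ) 1) :
    ∃ (zt zx zxx : ℝ → ℝ → ℝ) (C : ℝ), 0 ≤ C ∧
      (∀ t u u', HasDerivAt u u' t →
        HasDerivAt (fun s => ζ s (u s)) (zt t (u t) + zx t (u t) * u') t) ∧
      (∀ t y, deriv (fun s => ζ s y) t = zt t y) ∧
      (∀ t y, deriv (fun z => ζ t z) y = zx t y) ∧
      (∀ t y, deriv (deriv (fun z => ζ t z)) y = zxx t y) ∧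
      (∀ t y, HasDerivAt (zx t) (zxx t y) y) ∧
      (∀ t, Continuous (zt t)) ∧ (∀ t, Continuous (zx t)) ∧ (∀ t, Continuous (zxx t)) ∧
      (∀ t y z, |zt t y - zt t z| ≤ C * |y - z|) ∧
      (∀ t y z, |zx t y - zx t z| ≤ C * |y - z|) ∧
      (∀ t y, |zx t y| ≤ C) ∧
      (∀ y, ζ 0 y = 0) ∧ (∀ y, ζ T y = 0) ∧ (∀ t, zx t (-1) = 0) ∧ (∀ t, zx t 1 = 0) := by
  have smooth : ∀ (Z : ℝ × ℝ → ℝ) (v : ℝ × ℝ), ContDiff ℝ (⊤ : ℕ∞) Z →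
      ContDiff ℝ (⊤ : ℕ∞) (fun p => fderiv ℝ Z p v) := fun Z v hZ =>
    (hZ.fderiv_right (m := (⊤ : ℕ∞)) (by simp)).clm_apply contDiff_const
  have chain : ∀ (Z : ℝ × ℝ → ℝ), ContDiff ℝ (⊤ : ℕ∞) Z → ∀ (t : ℝ) (v u : ℝ → ℝ) (v' u' : ℝ),
      HasDerivAt v v' t → HasDerivAt u u' t → HasDerivAt (fun s => Z (v s, u s))
        (v' * fderiv ℝ Z (v t, u t) (1, 0) + fderiv ℝ Z (v t, u t) (0, 1) * u') t := by
    intro Z hZ t v u v' u' hv hu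
    have hd : HasFDerivAt Z (fderiv ℝ Z (v t, u t)) (v t, u t) :=
      (hZ.differentiable (by simp) _).hasFDerivAt
    have := hd.comp_hasDerivAt t (hv.prodMk hu)
    have e : ((v', u') : ℝ × ℝ) = v' • ((1:ℝ), (0:ℝ)) + u' • ((0:ℝ), (1:ℝ)) := by simp
    have e2 : fderiv ℝ Z (v t, u t) (v', u')
        = v' * fderiv ℝ Z (v t, u t) (1, 0) + fderiv ℝ Z (v t, u t) (0, 1) * u' := by
      rw [e, map_add, map_smul, map_smul]; simp [mul_comm]
    rw [e2] at this
    exact this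
  set Z := Function.uncurry ζ with hZ
  set Zx : ℝ × ℝ → ℝ := fun p => fderiv ℝ Z p (0, 1) with hZx
  set Zt : ℝ × ℝ → ℝ := fun p => fderiv ℝ Z p (1, 0) with hZt
  have sx : ContDiff ℝ (⊤ : ℕ∞) Zx := smooth Z _ h
  have st : ContDiff ℝ (⊤ : ℕ∞) Zt := smooth Z _ h
  have sxx := smooth Zx (0, 1) sx
  obtain ⟨C1, hC1, -, hl1⟩ := test_lip Zt st (hc.fderiv_apply (𝕜 := ℝ) (1, 0))
  obtain ⟨C2, hC2, hb2, hl2⟩ := test_lip Zx sx (hc.fderiv_apply (𝕜 := ℝ) (0, 1))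
  have dx : ∀ t y, HasDerivAt (fun z => ζ t z) (Zx (t, y)) y := by
    intro t y
    have := chain Z h y (fun _ => t) (fun z => z) 0 1 (hasDerivAt_const _ _) (hasDerivAt_id' _)
    rw [zero_mul, zero_add, mul_one] at this
    exact this
  have dxx : ∀ t y, HasDerivAt (fun z => Zx (t, z)) (fderiv ℝ Zx (t, y) (0, 1)) y := by
    intro t y
    have := chain Zx sx y (fun _ => t) (fun z => z) 0 1 (hasDerivAt_const _ _) (hasDerivAt_id' _)
    simpa using this
  have dt : ∀ t u u', HasDerivAt u u' t →
        HasDerivAt (fun s => ζ s (u s)) (Zt (t, u t) + Zx (t, u t) * u') t := by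
    intro t u u' hu
    have := chain Z h t (fun s => s) u 1 u' (hasDerivAt_id' _) hu
    rw [one_mul] at this
    exact this
  have z0 : ∀ p, p ∉ Set.Ioo (0:ℝ) T ×ˢ Set.Ioo (-1:ℝ) 1 → Z p = 0 := fun p hp =>
    image_eq_zero_of_notMem_tsupport fun h' => hp (hs h')
  have zx0 : ∀ p, p ∉ Set.Ioo (0:ℝ) T ×ˢ Set.Ioo (-1:ℝ) 1 → Zx p = 0 := fun p hp =>
    image_eq_zero_of_notMem_tsupport fun h' =>
      hp (hs (tsupport_fderiv_apply_subset ℝ (0, 1) h'))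
  refine ⟨fun t y => Zt (t, y), fun t y => Zx (t, y), fun t y => fderiv ℝ Zx (t, y) (0, 1),
    max C1 C2, le_max_of_le_left hC1, dt, ?_, fun t y => (dx t y).deriv, ?_, dxx, ?_, ?_, ?_,
    ?_, ?_, ?_, ?_, ?_, ?_, ?_⟩
  · intro t y
    have := dt t (fun _ => y) 0 (hasDerivAt_const _ _)
    simpa using this.deriv
  · intro t y
    have : deriv (fun z => ζ t z) = fun z => Zx (t, z) := by
      ext z; exact (dx t z).deriv
    rw [this]; exact (dxx t y).deriv
  · intro t; exact st.continuous.comp (by fun_prop)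
  · intro t; exact sx.continuous.comp (by fun_prop)
  · intro t; exact sxx.continuous.comp (f := fun y : ℝ => (t, y)) (by fun_prop)
  · intro t y z; exact (hl1 t y z).trans (by gcongr; exact le_max_left _ _)
  · intro t y z; exact (hl2 t y z).trans (by gcongr; exact le_max_right _ _)
  · intro t y; exact (hb2 _).trans (le_max_right _ _)
  · intro y; exact z0 (0, y) (by simp)
  · intro y; exact z0 (T, y) (by simp)
  · intro t; exact zx0 _ (by simp)
  · intro t; exact zx0 _ (by simp)

/-- Proposition 3.10: the discrete solutions asymptotically satisfy the
weak formulation. For DPA solutions (one for each `N = n+2`) built from BV initial data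
with `0 < m^i ≤ ρ̄^i ≤ M^i`, the weak-formulation residual
`R_N(ζ) = ∫_{Ω_T} [ρ^{i,N} ∂_t ζ + ρ^{i,N} θ^i(ρ̃^N,a_N;x) ∂_x ζ
  + Φ^i(ρ^{i,N})(∂_x β^i(ρ̃^N,a_N;x) ∂_x ζ + β^i(ρ̃^N,a_N;x) ∂_{xx} ζ)]`
tends to `0` as `N → ∞`, for every `ζ ∈ C_c^∞((0,T)×(−1,1))`. -/
theorem stmt15
    (M d : ℕ) (hM : 1 ≤ M) (T : ℝ) (hT : 0 < T)
    (σ : Fin M → ℝ) (hσ : ∀ i, 0 < σ i)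
    (A K A₁ : Fin M → Fin M → ℝ → ℝ → ℝ → ℝ)
    (cA c1A cK CK : ℝ) (hcK : 0 < cK)
    (hA_nonneg : ∀ i j x y c, 0 ≤ A i j x y c)
    (hA_deriv : ∀ i j y c x₀, HasDerivAt (fun s => A i j s y c) (A₁ i j x₀ y c) x₀)
    (hA_lip : ∀ i j x x' y y' c, |A i j x' y' c - A i j x y c| ≤ cA * (|x' - x| + |y' - y|))
    (hA1_lip : ∀ i j x y y' c, |A₁ i j x y' c - A₁ i j x y c| ≤ c1A * |y' - y|)
    (hK_bdd : ∀ i j x y c, |K i j x y c| ≤ CK)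
    (hK_cont : ∀ i j, Continuous (fun p : ℝ × ℝ × ℝ => K i j p.1 p.2.1 p.2.2))
    (hK_lip : ∀ i j x x' y y' c, |K i j x' y' c - K i j x y c| ≤ cK * (|x' - x| + |y' - y|))
    (hK_diag : ∀ i x c, K i i x x c = 0)
    (Φ : Fin M → ℝ → ℝ)
    (hΦ_mono : ∀ i, MonotoneOn (Φ i) (Set.Ici 0))
    (hΦ_lip : ∀ i, ∃ L : NNReal, LipschitzOnWith L (Φ i) (Set.Ici 0))
    (hΦ0 : ∀ i, Φ i 0 = 0)
    (V : ℝ → ℝ → ℝ → EuclideanSpace ℝ (Fin d))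
    (hV_C1 : ContDiff ℝ 1 (fun p : ℝ × ℝ × ℝ => V p.1 p.2.1 p.2.2))
    (hV_bdd : ∃ CV, ∀ p q r, ‖V p q r‖ ≤ CV)
    -- initial data
    (ρbar : Fin M → ℝ → ℝ) (m Mb : Fin M → ℝ) (hm : ∀ i, 0 < m i)
    (hρbar_BV : ∀ i, BoundedVariationOn (ρbar i) (Set.Icc (-1 : ℝ) 1))
    (hρbar_bnd : ∀ i, ∀ y ∈ Set.Icc (-1 : ℝ) 1, m i ≤ ρbar i y ∧ ρbar i y ≤ Mb i)
    (hρbar_mass : ∀ i, ∫ y in Set.Icc (-1 : ℝ) 1, ρbar i y = σ i)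
    (abar : Fin M → EuclideanSpace ℝ (Fin d))
    -- for each n, a DPA solution with N = n + 2
    (x : ℕ → Fin M → ℕ → ℝ → ℝ) (a : ℕ → Fin M → ℝ → EuclideanSpace ℝ (Fin d))
    (hx0 : ∀ n i t, x n i 0 t = -1) (hxN : ∀ n i t, x n i (n+2) t = 1)
    (hx_order : ∀ n i k t, k < n+2 → t ∈ Set.Icc (0:ℝ) T → x n i k t < x n i (k+1) t)
    (hx_init : ∀ n i k, k < n+2 →
      ∫ y in (x n i k 0)..(x n i (k+1) 0), ρbar i y = σ i / (n+2))
    (ha_init : ∀ n i, a n i 0 = abar i)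
    (hx_ode : ∀ n i k, 0 < k → k < n+2 → ∀ t ∈ Set.Icc (0:ℝ) T,
      HasDerivAt (x n i k)
        (((∑ j, ∑ l ∈ Finset.range (n+3),
              (σ j / (n+2)) * A i j (x n i k t) (x n j l t) (dist (a n i t) (a n j t)))
            / (σ i / (n+2))) *
            (Φ i ((σ i / (n+2)) / (x n i k t - x n i (k-1) t)) -
             Φ i ((σ i / (n+2)) / (x n i (k+1) t - x n i k t)))
          + ∑ j, ∑ l ∈ Finset.range (n+3),
              (σ j / (n+2)) * K i j (x n i k t) (x n j l t) (dist (a n i t) (a n j t))) t)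
    (ha_ode : ∀ n i, ∀ t ∈ Set.Icc (0:ℝ) T,
      HasDerivAt (a n i)
        (∑ j, V (((n:ℝ)+3)⁻¹ * ∑ k ∈ Finset.range (n+3), x n i k t)
                (((n:ℝ)+3)⁻¹ * ∑ k ∈ Finset.range (n+3), x n j k t)
                (dist (a n i t) (a n j t))) t) :
    ∀ i : Fin M, ∀ ζ : ℝ → ℝ → ℝ,
      ContDiff ℝ (⊤ : ℕ∞) (Function.uncurry ζ) →
      HasCompactSupport (Function.uncurry ζ) →
      tsupport (Function.uncurry ζ) ⊆ Set.Ioo (0:ℝ) T ×ˢ Set.Ioo (-1:ℝ) 1 →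
      Tendsto (fun n : ℕ => ∫ t in Set.Icc (0:ℝ) T, ∫ y in Set.Icc (-1:ℝ) 1,
          (pcDensity (n+2) (σ i) (fun k => x n i k t) y * deriv (fun s => ζ s y) t
           + pcDensity (n+2) (σ i) (fun k => x n i k t) y *
              (∑ j, ∑ l ∈ Finset.range (n+3),
                (σ j / (n+2)) * K i j y (x n j l t) (dist (a n i t) (a n j t))) *
              deriv (fun z => ζ t z) y
           + Φ i (pcDensity (n+2) (σ i) (fun k => x n i k t) y) *
              ((∑ j, ∑ l ∈ Finset.range (n+3),
                  (σ j / (n+2)) * A₁ i j y (x n j l t) (dist (a n i t) (a n j t))) *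
                deriv (fun z => ζ t z) y
               + (∑ j, ∑ l ∈ Finset.range (n+3),
                  (σ j / (n+2)) * A i j y (x n j l t) (dist (a n i t) (a n j t))) *
                deriv (deriv (fun z => ζ t z)) y)))
        atTop (nhds 0) := by
  intro i ζ hζ hζc hζs
  obtain ⟨zt, zx, zxx, C, hC, hchain, ezt, ezx, ezxx, hzxx, czt, czx, czxx, lzt, lzx, bzx,
    ζ0, ζT, zxm, zxp⟩ := test_facts T ζ hζ hζc hζs
  simp only [ezt, ezx, ezxx]
  set S := ∑ j, σ j with hS
  have hSpos : 0 ≤ S := Finset.sum_nonneg fun j _ => (hσ j).le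
  have hCK : 0 ≤ CK := (abs_nonneg _).trans (hK_bdd i i 0 0 0)
  -- sums bound
  have sumbd : ∀ (n : ℕ) (q : Fin M → ℕ → ℝ) (B : ℝ), 0 ≤ B → (∀ j l, |q j l| ≤ B) →
      |∑ j, ∑ l ∈ Finset.range (n+3), (σ j / (n+2)) * q j l| ≤ 2 * S * B := by
    intro n q B hB hq
    have hn : (0:ℝ) < (n:ℝ) + 2 := by positivity
    calc |∑ j, ∑ l ∈ Finset.range (n+3), (σ j / (n+2)) * q j l|
        ≤ ∑ j, ∑ l ∈ Finset.range (n+3), (σ j / (n+2)) * B := by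
          refine (Finset.abs_sum_le_sum_abs _ _).trans (Finset.sum_le_sum fun j _ => ?_)
          refine (Finset.abs_sum_le_sum_abs _ _).trans (Finset.sum_le_sum fun l _ => ?_)
          have := hσ j
          rw [abs_mul, abs_of_pos (by positivity)]
          gcongr
          exact hq j l
      _ = ((n+3)/(n+2)) * S * B := by
          simp only [Finset.sum_const, Finset.card_range, nsmul_eq_mul, hS, Finset.mul_sum,
            Finset.sum_mul]
          refine Finset.sum_congr rfl fun j _ => ?_
          push_cast; field_simp
      _ ≤ 2 * S * B := by
          gcongr
          rw [div_le_iff₀ hn]; linarith [(Nat.cast_nonneg n : (0:ℝ) ≤ n)]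
  set L : ℝ := C + 2 * S * CK * C + 2 * S * cK * C with hL
  have key : ∀ n : ℕ, |∫ t in Set.Icc (0:ℝ) T, ∫ y in Set.Icc (-1:ℝ) 1,
          (pcDensity (n+2) (σ i) (fun k => x n i k t) y * zt t y
           + pcDensity (n+2) (σ i) (fun k => x n i k t) y *
              (∑ j, ∑ l ∈ Finset.range (n+3),
                (σ j / (n+2)) * K i j y (x n j l t) (dist (a n i t) (a n j t))) *
              zx t y
           + Φ i (pcDensity (n+2) (σ i) (fun k => x n i k t) y) *
              ((∑ j, ∑ l ∈ Finset.range (n+3),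
                  (σ j / (n+2)) * A₁ i j y (x n j l t) (dist (a n i t) (a n j t))) *
                zx t y
               + (∑ j, ∑ l ∈ Finset.range (n+3),
                  (σ j / (n+2)) * A i j y (x n j l t) (dist (a n i t) (a n j t))) *
                zxx t y))| ≤ (σ i / (n+2) * (L * 2)) * T := by
    intro n
    have hn : (0:ℝ) < (n:ℝ) + 2 := by positivity
    have hσi := hσ i
    set s : ℝ := σ i / (n+2) with hsdef
    have hs : 0 < s := by positivity
    let θ : ℝ → ℝ → ℝ := fun t y => ∑ j, ∑ l ∈ Finset.range (n+3),
                (σ j / (n+2)) * K i j y (x n j l t) (dist (a n i t) (a n j t))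
    let β : ℝ → ℝ → ℝ := fun t y => ∑ j, ∑ l ∈ Finset.range (n+3),
                (σ j / (n+2)) * A i j y (x n j l t) (dist (a n i t) (a n j t))
    let β₁ : ℝ → ℝ → ℝ := fun t y => ∑ j, ∑ l ∈ Finset.range (n+3),
                (σ j / (n+2)) * A₁ i j y (x n j l t) (dist (a n i t) (a n j t))
    have θbd : ∀ t y, |θ t y| ≤ 2 * S * CK := fun t y =>
      sumbd n (fun j l => K i j y (x n j l t) (dist (a n i t) (a n j t))) CK hCK
        (fun j l => hK_bdd _ _ _ _ _)
    have θlip : ∀ t y z, |θ t y - θ t z| ≤ 2 * S * (cK * |y - z|) := by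
      intro t y z
      have := sumbd n (fun j l => K i j y (x n j l t) (dist (a n i t) (a n j t))
        - K i j z (x n j l t) (dist (a n i t) (a n j t))) (cK * |y - z|) (by positivity)
        (fun j l => by simpa using hK_lip i j z y (x n j l t) (x n j l t) _)
      simpa only [θ, mul_sub, Finset.sum_sub_distrib] using this
    have θcont : ∀ t, Continuous (θ t) := by
      intro t
      refine continuous_finsetSum _ fun j _ => continuous_finsetSum _ fun l _ => ?_
      exact continuous_const.mul ((hK_cont i j).comp
        (f := fun y : ℝ => (y, x n j l t, dist (a n i t) (a n j t))) (by fun_prop))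
    have βder : ∀ t y, HasDerivAt (β t) (β₁ t y) y := by
      intro t y
      refine HasDerivAt.fun_sum fun j _ => HasDerivAt.fun_sum fun l _ => ?_
      exact (hA_deriv i j _ _ y).const_mul _
    have hcA : 0 ≤ cA := by
      have := (abs_nonneg _).trans (hA_lip i i 0 1 0 0 0); simpa using this
    have β₁int : ∀ t u v, IntervalIntegrable (β₁ t) volume u v := by
      intro t u v
      have e : β₁ t = deriv (β t) := by ext y; exact (βder t y).deriv.symm
      have bd : ∀ y, ‖β₁ t y‖ ≤ 2 * S * cA := fun y =>
        sumbd n (fun j l => A₁ i j y (x n j l t) (dist (a n i t) (a n j t))) cA hcA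
          (fun j l => (hA_deriv i j (x n j l t) _ y).le_of_lip' hcA (by
            refine Filter.Eventually.of_forall fun z => ?_
            simpa using hA_lip i j y z (x n j l t) (x n j l t) _))
      rw [intervalIntegrable_iff]
      refine Integrable.mono' (g := fun _ => 2 * S * cA) (integrableOn_const (by simp)) ?_
        (Filter.Eventually.of_forall bd)
      rw [e]; exact (measurable_deriv _).aestronglyMeasurable
    let X : ℝ → ℕ → ℝ := fun t k => x n i k t
    let φ : ℝ → ℕ → ℝ := fun t k => Φ i (s / (X t (k+1) - X t k))
    let G : ℝ → ℝ := fun t => ∑ k ∈ Finset.range (n+2), s * (zt t (X t k) + zx t (X t k) *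
      ((β t (X t k) / s) * (φ t (k-1) - φ t k) + θ t (X t k)))
    refine time_lemma _ (fun t => ∑ k ∈ Finset.range (n+2), s * ζ t (x n i k t)) G T _ hT ?_ ?_ ?_ ?_
    · intro t ht
      refine HasDerivAt.fun_sum fun k hk => HasDerivAt.const_mul _ ?_
      rw [Finset.mem_range] at hk
      rcases Nat.eq_zero_or_pos k with rfl | hk0
      · have h1 : x n i 0 = fun _ => -1 := funext (hx0 n i)
        have := hchain t (x n i 0) 0 (by rw [h1]; exact hasDerivAt_const _ _)
        have h2 : zx t (x n i 0 t) = 0 := by rw [hx0, zxm]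
        simpa [X, h2] using this
      · have h1 := hchain t (x n i k) _ (hx_ode n i k hk0 hk t ht)
        have h2 : k - 1 + 1 = k := by omega
        simp only [X, φ, h2]
        exact h1
    · simp [ζ0]
    · simp [ζT]
    · intro t ht
      have hsp := space_lemma (n+2) (σ i) hσi (X t) (fun k hk => hx_order n i k t hk ht)
        (hx0 n i t) (hxN n i t) (Φ i) (fun y => zt t y + θ t y * zx t y)
        (fun y => β t y * zx t y) (fun y => β₁ t y * zx t y + β t y * zxx t y) L
        ((czt t).add ((θcont t).mul (czx t))) ?_
        (fun y => (βder t y).mul (hzxx t y)) ?_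
      · have hcast : (((n+2 : ℕ) : ℝ)) = (n:ℝ) + 2 := by push_cast; ring
        rw [hcast, ← hsdef, Finset.sum_add_distrib] at hsp
        have hab := abel_lemma (φ t) (fun k => β t (X t k) * zx t (X t k))
          (by simp only [X, hx0, zxm, mul_zero]) (n+2)
        have hend : zx t (X t (n+2)) = 0 := by simp only [X, hxN, zxp]
        simp only [hend, mul_zero, zero_add] at hab
        simp only [φ] at hab
        rw [hab, ← Finset.sum_add_distrib] at hsp
        convert hsp using 2
        congr 1
        · refine integral_congr_ae (Filter.Eventually.of_forall fun y => ?_)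
          simp only [θ, β, β₁, X]; ring
        · refine Finset.sum_congr rfl fun k _ => ?_
          simp only [φ]
          field_simp
          ring
      · intro y z
        have e : zt t y + θ t y * zx t y - (zt t z + θ t z * zx t z)
            = (zt t y - zt t z) + θ t y * (zx t y - zx t z) + (θ t y - θ t z) * zx t z := by ring
        rw [e]
        calc _ ≤ |zt t y - zt t z| + |θ t y * (zx t y - zx t z)| + |(θ t y - θ t z) * zx t z| :=
              abs_add_three _ _ _
          _ ≤ C * |y - z| + (2 * S * CK) * (C * |y - z|) + (2 * S * (cK * |y - z|)) * C := by
              rw [abs_mul, abs_mul]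
              gcongr
              · exact lzt t y z
              · exact θbd t y
              · exact lzx t y z
              · exact θlip t y z
              · exact bzx t z
          _ = L * |y - z| := by rw [hL]; ring
      · intro u v
        refine ((β₁int t u v).mul_continuousOn (czx t).continuousOn).add ?_
        have : Continuous (β t) := continuous_iff_continuousAt.2 fun y => (βder t y).continuousAt
        exact (this.mul (czxx t)).intervalIntegrable _ _
  refine squeeze_zero_norm key ?_
  have h1 : Tendsto (fun n : ℕ => (n:ℝ) + 2) atTop atTop :=
    tendsto_atTop_add_const_right _ _ tendsto_natCast_atTop_atTop
  have h2 := (((tendsto_const_nhds (x := σ i)).div_atTop h1).mul_const (L * 2)).mul_const T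
  simpa using h2
end
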